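/- For all integers k ≥ 3 and 1 ≤ ℓ < k/2 and every γ > 0 there exists n₀ such that every k-uniform hypergraph H = (V,E) on |V| = n ≥ n₀ vertices with n divisible by k−ℓ and δ_{k−2}(H) ≥ ((4(k−ℓ)−1)/(4(k−ℓ)²) + γ)·C(n,2) contains a Hamiltonian ℓ-cycle. -/

import Mathlib

open Finset

/-- `E` is the edge set of a `k`-uniform hypergraph on vertex set `Fin n`:
every edge is a `k`-element set of vertices. -/
def Uniform (n k : ℕ) (E : Finset (Finset (Fin n))) : Prop :=
  ∀ e ∈ E, e.card = k

/-- The degree `d(S)` of a vertex set `S`: the number of edges containing `S`. -/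
def deg {n : ℕ} (E : Finset (Finset (Fin n))) (S : Finset (Fin n)) : ℕ :=
  (E.filter fun e => S ⊆ e).card

/-- The minimum `s`-degree `δ_s(H)`: the minimum of `d(S)` over all `s`-element
vertex sets `S`. -/
noncomputable def minDeg (n : ℕ) (E : Finset (Finset (Fin n))) (s : ℕ) : ℕ :=
  sInf {d | ∃ S : Finset (Fin n), S.card = s ∧ deg E S = d}

/-- `d(L, X^(i) Y^(j))`: the number of edges of the form `L ∪ I ∪ J` with
`I ∈ X^(i)`, `J ∈ Y^(j)` (take `Y = ∅`, `j = 0` when `Y^(j)` is omitted). -/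
def degIn {n : ℕ} (E : Finset (Finset (Fin n))) (L X Y : Finset (Fin n)) (i j : ℕ) : ℕ :=
  (E.filter fun e =>
    L ⊆ e ∧ e \ L ⊆ X ∪ Y ∧ ((e \ L) ∩ X).card = i ∧ ((e \ L) ∩ Y).card = j).card

/-- The `i`-th edge of an ℓ-cycle given by the cyclic ordering `f` of the `n`
vertices: `k` cyclically consecutive vertices starting at position `i * (k - ℓ)`. -/
def cycEdge (n k ℓ : ℕ) (f : ℕ → Fin n) (i : ℕ) : Finset (Fin n) :=
  (Finset.range k).image fun j => f ((i * (k - ℓ) + j) % n)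

/-- `H = (Fin n, E)` contains a Hamiltonian ℓ-cycle: there is a cyclic ordering of
all `n` vertices such that each of the `n / (k - ℓ)` windows of `k` consecutive
vertices (consecutive windows overlapping in `ℓ` vertices) is an edge, and two
consecutive edges share exactly `ℓ` vertices. -/
def HasHamCycle (n k ℓ : ℕ) (E : Finset (Finset (Fin n))) : Prop :=
  ∃ f : ℕ → Fin n, Set.InjOn f (Set.Iio n) ∧
    (∀ i < n / (k - ℓ), cycEdge n k ℓ f i ∈ E) ∧
    (∀ i < n / (k - ℓ),
      (cycEdge n k ℓ f i ∩ cycEdge n k ℓ f ((i + 1) % (n / (k - ℓ)))).card = ℓ)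

/-- The `i`-th edge of an ℓ-path given by the linear ordering `f`. -/
def pathEdge (n k ℓ : ℕ) (f : ℕ → Fin n) (i : ℕ) : Finset (Fin n) :=
  (Finset.range k).image fun j => f (i * (k - ℓ) + j)

/-- `f` is (the linear ordering of the vertices of) an ℓ-path with `t` edges all of
which belong to `E`: the path has `t * (k - ℓ) + ℓ` vertices, every edge consists of
`k` consecutive vertices and two consecutive edges intersect in exactly `ℓ` vertices. -/
def IsPath (n k ℓ t : ℕ) (E : Finset (Finset (Fin n))) (f : ℕ → Fin n) : Prop :=
  Set.InjOn f (Set.Iio (t * (k - ℓ) + ℓ)) ∧ ∀ i < t, pathEdge n k ℓ f i ∈ E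

/-- The vertex set of the ℓ-path described by `f` with `t` edges. -/
def pathVerts (n k ℓ t : ℕ) (f : ℕ → Fin n) : Finset (Fin n) :=
  (Finset.range (t * (k - ℓ) + ℓ)).image f

/-- The first end (first `ℓ` vertices) of the ℓ-path described by `f`. -/
def pathEnd0 (n ℓ : ℕ) (f : ℕ → Fin n) : Finset (Fin n) :=
  (Finset.range ℓ).image f

/-- The last end (last `ℓ` vertices) of the ℓ-path described by `f` with `t` edges. -/
def pathEnd1 (n k ℓ t : ℕ) (f : ℕ → Fin n) : Finset (Fin n) :=
  (Finset.Ico (t * (k - ℓ)) (t * (k - ℓ) + ℓ)).image f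

/-- The extremal hypergraph `X_{k,ℓ}(n)` on `Fin n`.  If `n` is an odd multiple of
`k - ℓ`, take `A` to be the first `⌊n / (2(k-ℓ))⌋` vertices and all `k`-sets meeting
`A` as edges.  If `n` is an even multiple of `k - ℓ`, take `A` to be the first
`n / (2(k-ℓ)) - 1` vertices, fix the `ℓ + 1` following vertices (which lie in
`B = V ∖ A`), and take as edges all `k`-sets meeting `A` together with all `k`-subsets
of `B` containing all `ℓ + 1` fixed vertices. -/
def Xedges (n k ℓ : ℕ) : Finset (Finset (Fin n)) :=
  if Odd (n / (k - ℓ)) then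
    (Finset.powersetCard k (Finset.univ : Finset (Fin n))).filter fun e =>
      ∃ v ∈ e, (v : ℕ) < n / (2 * (k - ℓ))
  else
    (Finset.powersetCard k (Finset.univ : Finset (Fin n))).filter fun e =>
      (∃ v ∈ e, (v : ℕ) < n / (2 * (k - ℓ)) - 1) ∨
      ((∀ v ∈ e, n / (2 * (k - ℓ)) - 1 ≤ (v : ℕ)) ∧
        ∀ w : Fin n, n / (2 * (k - ℓ)) - 1 ≤ (w : ℕ) → (w : ℕ) < n / (2 * (k - ℓ)) + ℓ →
          w ∈ e)

/-- `e(B)`: the number of edges lying entirely inside `B`. -/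
def edgesIn {n : ℕ} (E : Finset (Finset (Fin n))) (B : Finset (Fin n)) : ℕ :=
  (E.filter fun e => e ⊆ B).card

/-- `(A, B)` is an `(ℓ,ξ)`-extremal partition of the vertex set:
`|A| = ⌈n/(2(k-ℓ))⌉ - 1`, `|B| = ⌊(2(k-ℓ)-1)n/(2(k-ℓ)) + 1⌋` and
`e(B) ≤ ξ · C(n,k)`. -/
def IsExtremalPartition (n k ℓ : ℕ) (E : Finset (Finset (Fin n))) (ξ : ℝ)
    (A B : Finset (Fin n)) : Prop :=
  Disjoint A B ∧ A ∪ B = Finset.univ ∧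
  A.card = ⌈(n : ℝ) / (2 * ((k - ℓ : ℕ) : ℝ))⌉₊ - 1 ∧
  B.card = ⌊(2 * ((k - ℓ : ℕ) : ℝ) - 1) * (n : ℝ) / (2 * ((k - ℓ : ℕ) : ℝ)) + 1⌋₊ ∧
  (edgesIn E B : ℝ) ≤ ξ * (n.choose k : ℝ)

/-- `H` is `(ℓ,ξ)`-extremal. -/
def IsExtremal (n k ℓ : ℕ) (E : Finset (Finset (Fin n))) (ξ : ℝ) : Prop :=
  ∃ A B, IsExtremalPartition n k ℓ E ξ A B

/-- `(A, B)` is a minimal `(ℓ,ξ)`-extremal partition: among all `(ℓ,ξ)`-extremal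
partitions it minimises `e(B)`. -/
def IsMinExtremalPartition (n k ℓ : ℕ) (E : Finset (Finset (Fin n))) (ξ : ℝ)
    (A B : Finset (Fin n)) : Prop :=
  IsExtremalPartition n k ℓ E ξ A B ∧
  ∀ A' B' : Finset (Fin n), IsExtremalPartition n k ℓ E ξ A' B' →
    edgesIn E B ≤ edgesIn E B'

open scoped Classical in
/-- `A_ε`: the set of vertices `v` with `d(v, B^(k-1)) ≥ (1-ε)·C(|B|, k-1)`. -/
noncomputable def Aeps (n k : ℕ) (E : Finset (Finset (Fin n))) (B : Finset (Fin n)) (ε : ℝ) :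
    Finset (Fin n) :=
  Finset.univ.filter fun v =>
    (1 - ε) * (B.card.choose (k - 1) : ℝ) ≤ (degIn E {v} B ∅ (k - 1) 0 : ℝ)

open scoped Classical in
/-- `B_ε`: the set of vertices `v` with `d(v, B^(k-1)) ≤ ε·C(|B|, k-1)`. -/
noncomputable def Beps (n k : ℕ) (E : Finset (Finset (Fin n))) (B : Finset (Fin n)) (ε : ℝ) :
    Finset (Fin n) :=
  Finset.univ.filter fun v =>
    (degIn E {v} B ∅ (k - 1) 0 : ℝ) ≤ ε * (B.card.choose (k - 1) : ℝ)

/-- `V_ε = V ∖ (A_ε ∪ B_ε)`. -/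
noncomputable def Veps (n k : ℕ) (E : Finset (Finset (Fin n))) (B : Finset (Fin n)) (ε : ℝ) :
    Finset (Fin n) :=
  Finset.univ \ (Aeps n k E B ε ∪ Beps n k E B ε)

/-- `L` is an ε-typical ℓ-set: `L ⊆ B_ε`, `|L| = ℓ` and
`d(L, B^(k-ℓ)) ≤ ε·C(|B|, k-ℓ)`. -/
def IsTypical (n k ℓ : ℕ) (E : Finset (Finset (Fin n))) (B : Finset (Fin n)) (ε : ℝ)
    (L : Finset (Fin n)) : Prop :=
  L.card = ℓ ∧ L ⊆ Beps n k E B ε ∧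
    (degIn E L B ∅ (k - ℓ) 0 : ℝ) ≤ ε * (B.card.choose (k - ℓ) : ℝ)

namespace LooseHam

/-- `Conn k ℓ E X I Y`: some `ℓ`-path of the hypergraph `E` has first end `X`, last end `Y`
and interior vertex set `I`. -/
inductive Conn {V : Type*} [DecidableEq V] (k ℓ : ℕ) (E : Finset (Finset V)) :
    Finset V → Finset V → Finset V → Prop
  | edge {X M Y : Finset V} (hX : #X = ℓ) (hM : #M = k - 2 * ℓ) (hY : #Y = ℓ)
      (hXM : Disjoint X M) (hXY : Disjoint X Y) (hMY : Disjoint M Y) (he : X ∪ M ∪ Y ∈ E) :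
      Conn k ℓ E X M Y
  | trans {X I Y J Z : Finset V} (h₁ : Conn k ℓ E X I Y) (h₂ : Conn k ℓ E Y J Z)
      (hd : Disjoint (X ∪ I) (J ∪ Z)) : Conn k ℓ E X (I ∪ Y ∪ J) Z

/-- `Sys k ℓ E L A`: there are pairwise disjoint `ℓ`-paths with the ends listed in `L`, whose
vertex sets have union `A`. -/
inductive Sys {V : Type*} [DecidableEq V] (k ℓ : ℕ) (E : Finset (Finset V)) :
    List (Finset V × Finset V) → Finset V → Prop
  | nil : Sys k ℓ E [] ∅
  | cons {X I Y : Finset V} {L : List (Finset V × Finset V)} {A : Finset V}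
      (h : Conn k ℓ E X I Y) (hL : Sys k ℓ E L A) (hd : Disjoint (X ∪ I ∪ Y) A) :
      Sys k ℓ E ((X, Y) :: L) (X ∪ I ∪ Y ∪ A)

/-- `Links k ℓ E L J`: there are pairwise disjoint sets with union `J` serving as interiors of
`ℓ`-paths which join the last end of each entry of `L` to the first end of the next one. -/
inductive Links {V : Type*} [DecidableEq V] (k ℓ : ℕ) (E : Finset (Finset V)) :
    List (Finset V × Finset V) → Finset V → Prop
  | single (p : Finset V × Finset V) : Links k ℓ E [p] ∅
  | cons {p p' : Finset V × Finset V} {C J : Finset V} {L : List (Finset V × Finset V)}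
      (h : Conn k ℓ E p.2 C p'.1) (hL : Links k ℓ E (p' :: L) J) (hd : Disjoint C J) :
      Links k ℓ E (p :: p' :: L) (C ∪ J)

section
variable {V : Type*} [DecidableEq V] {k ℓ : ℕ} {E : Finset (Finset V)}

namespace Conn

variable {X I Y J Z : Finset V}

lemma card_left (h : Conn k ℓ E X I Y) : #X = ℓ := by
  induction h <;> assumption

lemma card_right (h : Conn k ℓ E X I Y) : #Y = ℓ := by
  induction h <;> assumption

lemma disjoint (h : Conn k ℓ E X I Y) : Disjoint X I ∧ Disjoint X Y ∧ Disjoint I Y := by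
  induction h with
  | edge _ _ _ h1 h2 h3 _ => exact ⟨h1, h2, h3⟩
  | trans h₁ h₂ hd ih₁ ih₂ =>
    simp only [disjoint_union_left, disjoint_union_right] at *
    tauto

lemma exists_card (hl : 2 * ℓ < k) (h : Conn k ℓ E X I Y) : ∃ t, #I + ℓ = t * (k - ℓ) := by
  induction h with
  | edge _ hM _ _ _ _ _ => exact ⟨1, by omega⟩
  | @trans X I Y J Z h₁ h₂ hd ih₁ ih₂ =>
    obtain ⟨s, hs⟩ := ih₁
    obtain ⟨t, ht⟩ := ih₂
    refine ⟨s + t, ?_⟩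
    have d1 := h₁.disjoint
    have d2 := h₂.disjoint
    simp only [disjoint_union_left, disjoint_union_right] at hd
    rw [card_union_of_disjoint (by simp only [disjoint_union_left]; tauto),
      card_union_of_disjoint (by tauto), h₁.card_right, add_mul, ← hs, ← ht]
    ring

lemma sys (h : Conn k ℓ E X I Y) : Sys k ℓ E [(X, Y)] (X ∪ I ∪ Y) := by
  simpa using Sys.cons h Sys.nil (disjoint_empty_right _)

end Conn

namespace Sys

variable {L L' : List (Finset V × Finset V)} {A A' : Finset V}

lemma append (h : Sys k ℓ E L A) (h' : Sys k ℓ E L' A') (hd : Disjoint A A') :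
    Sys k ℓ E (L ++ L') (A ∪ A') := by
  induction h with
  | nil => simpa
  | @cons X I Y L A h hL hd' ih =>
    rw [disjoint_union_left] at hd
    rw [List.cons_append, union_assoc _ A A']
    exact .cons h (ih hd.2) (by rw [disjoint_union_right]; exact ⟨hd', hd.1⟩)

lemma flatMap {ι : Type*} [DecidableEq ι] (f : ι → List (Finset V × Finset V))
    (A : ι → Finset V) (l : List ι) (hl : l.Nodup) (h : ∀ i ∈ l, Sys k ℓ E (f i) (A i))
    (hd : ∀ i ∈ l, ∀ j ∈ l, i ≠ j → Disjoint (A i) (A j)) :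
    Sys k ℓ E (l.flatMap f) (l.toFinset.biUnion A) := by
  induction l with
  | nil => simpa using Sys.nil
  | cons a l ih =>
    rw [List.flatMap_cons, List.toFinset_cons, biUnion_insert]
    rw [List.nodup_cons] at hl
    refine append (h a (by simp)) (ih hl.2 (fun i hi => h i (by simp [hi]))
      fun i hi j hj => hd i (by simp [hi]) j (by simp [hj])) ?_
    rw [disjoint_biUnion_right]
    intro i hi
    rw [List.mem_toFinset] at hi
    exact hd a (by simp) i (by simp [hi]) (by rintro rfl; exact hl.1 hi)

lemma mem (h : Sys k ℓ E L A) {p : Finset V × Finset V} (hp : p ∈ L) :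
    #p.1 = ℓ ∧ #p.2 = ℓ ∧ p.1 ⊆ A ∧ p.2 ⊆ A ∧ Disjoint p.1 p.2 := by
  induction h with
  | nil => simp at hp
  | @cons X I Y L A h hL hd' ih =>
    rcases List.mem_cons.1 hp with rfl | hp
    · exact ⟨h.card_left, h.card_right, by grind, by grind, h.disjoint.2.1⟩
    · obtain ⟨h1, h2, h3, h4, h5⟩ := ih hp
      exact ⟨h1, h2, h3.trans subset_union_right, h4.trans subset_union_right, h5⟩

lemma exists_conn (h : Sys k ℓ E L A) {J : Finset V} (hJ : Links k ℓ E L J)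
    (hd : Disjoint A J) : ∃ (hne : L ≠ []) (I : Finset V),
      Conn k ℓ E (L.head hne).1 I (L.getLast hne).2 ∧
      (L.head hne).1 ∪ I ∪ (L.getLast hne).2 = A ∪ J := by
  induction hJ generalizing A with
  | single p =>
    cases h with
    | @cons X I Y _ A h hL _ =>
      cases hL
      exact ⟨by simp, I, h, by simp⟩
  | @cons p p' C J L hC hL hCJ ih =>
    cases h with
    | @cons X I Y _ A h hA hXA =>
      replace hd := And.imp disjoint_union_left.1 disjoint_union_left.1 (disjoint_union_right.1 hd)
      obtain ⟨_, K, hK, hKe⟩ := ih hA hd.2.2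
      simp only [List.head_cons, ne_eq, reduceCtorEq, not_false_eq_true, List.getLast_cons]
        at hK hKe ⊢
      have hsub : p'.1 ∪ K ∪ ((p' :: L).getLast (by simp)).2 ⊆ A ∪ J := hKe.le
      set Z := ((p' :: L).getLast (by simp)).2
      have hCA : Disjoint C (A ∪ J) := by
        rw [disjoint_union_right]; exact ⟨hd.1.2.symm, hCJ⟩
      have hXAJ : Disjoint (X ∪ I ∪ Y) (A ∪ J) := by
        rw [disjoint_union_right]; exact ⟨hXA, hd.2.1⟩
      have h1 : Conn k ℓ E Y (C ∪ p'.1 ∪ K) Z := by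
        refine hC.trans hK ?_
        simp only [disjoint_union_left]
        have : K ∪ Z ⊆ A ∪ J := by grind
        exact ⟨(hXAJ.mono_left (by grind)).mono_right this, hCA.mono_right this⟩
      refine ⟨by simp, _, h.trans h1 ?_, ?_⟩
      · have e : C ∪ p'.1 ∪ K ∪ Z = C ∪ (A ∪ J) := by rw [← hKe]; simp only [union_assoc]
        rw [e, disjoint_union_right]
        exact ⟨hd.1.1.mono_left (by grind), hXAJ.mono_left (by grind)⟩
      · have e : A ∪ (C ∪ J) = C ∪ (A ∪ J) := by rw [union_left_comm]
        rw [union_assoc _ A, e, ← hKe]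
        simp only [union_assoc]

end Sys

/-- Every pair of disjoint `ℓ`-sets can be joined inside `R` by an `ℓ`-path whose interior has
size at most `m` and avoids any prescribed set of at most `N` vertices. -/
def Flex (k ℓ : ℕ) (E : Finset (Finset V)) (R : Finset V) (m N : ℕ) : Prop :=
  ∀ X Y F : Finset V, #X = ℓ → #Y = ℓ → Disjoint X Y → #F ≤ N →
    ∃ C ⊆ R, Conn k ℓ E X C Y ∧ Disjoint C F ∧ #C ≤ m

lemma Flex.exists_links {R : Finset V} {m N : ℕ} (h : Flex k ℓ E R m N) :
    ∀ (L : List (Finset V × Finset V)) (A F : Finset V), L ≠ [] → Sys k ℓ E L A →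
      #F + m * L.length ≤ N → ∃ J ⊆ R, Links k ℓ E L J ∧ Disjoint J F ∧ #J ≤ m * L.length
  | [], _, _, hL, _, _ => absurd rfl hL
  | [p], _, _, _, _, _ => ⟨∅, by simp, .single p, by simp, by simp⟩
  | p :: p' :: L, A, F, _, hA, hN => by
    cases hA with
    | @cons X I Y _ A hc hA hd =>
    obtain ⟨J, hJR, hJ, hJF, hJc⟩ := h.exists_links (p' :: L) A F (by simp) hA (by
      simp only [List.length_cons] at hN ⊢; nlinarith)
    have hp := hA.mem (p := p') (by simp)
    obtain ⟨C, hCR, hC, hCF, hCm⟩ := h Y p'.1 (F ∪ J) hc.card_right hp.1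
      (hd.mono subset_union_right hp.2.2.1) (by
        refine (card_union_le _ _).trans ?_
        simp only [List.length_cons] at hN hJc; nlinarith)
    rw [disjoint_union_right] at hCF
    refine ⟨C ∪ J, union_subset hCR hJR, .cons hC hJ hCF.2, ?_, ?_⟩
    · rw [disjoint_union_left]; exact ⟨hCF.1, hJF⟩
    · refine (card_union_le _ _).trans ?_
      simp only [List.length_cons] at hJc ⊢; nlinarith

end

section
variable {V : Type*} [DecidableEq V] {k ℓ : ℕ} {E : Finset (Finset V)}

/-- An `ℓ`-path, without its last end, as a list of vertices. -/
lemma Conn.exists_list (hl : 2 * ℓ < k) {X I Y : Finset V} (h : Conn k ℓ E X I Y) :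
    ∃ l : List V, l.Nodup ∧ l.toFinset = X ∪ I ∧ (l.take ℓ).toFinset = X ∧
      (∃ t, l.length = (t + 1) * (k - ℓ)) ∧
      ∀ l' : List V, ℓ ≤ l'.length → (l'.take ℓ).toFinset = Y → ∀ i, i * (k - ℓ) < l.length →
        (((l ++ l').drop (i * (k - ℓ))).take k).toFinset ∈ E := by
  induction h with
  | @edge X M Y hX hM hY hXM hXY hMY he =>
    have hlen : (X.toList ++ M.toList).length = k - ℓ := by simp; omega
    refine ⟨X.toList ++ M.toList, ?_, ?_, ?_, ⟨0, by simpa using hlen⟩, ?_⟩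
    · rw [List.nodup_append]
      refine ⟨X.nodup_toList, M.nodup_toList, ?_⟩
      intro a ha b hb
      rw [mem_toList] at ha hb
      exact disjoint_iff_ne.1 hXM a ha b hb
    · ext; simp
    · rw [List.take_left' (by simpa using hX)]; simp
    · intro l' hl' hYl i hi
      rw [hlen] at hi
      obtain rfl : i = 0 := by
        rcases Nat.eq_zero_or_pos i with h | h
        · exact h
        · nlinarith
      rw [zero_mul, List.drop_zero, List.take_append, hlen,
        List.take_of_length_le (by rw [hlen]; omega), show k - (k - ℓ) = ℓ by omega,
        List.toFinset_append, hYl]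
      simpa using he
  | @trans X I Y J Z h₁ h₂ hd ih₁ ih₂ =>
    obtain ⟨l₁, n₁, e₁, x₁, ⟨t₁, c₁⟩, p₁⟩ := ih₁
    obtain ⟨l₂, n₂, e₂, x₂, ⟨t₂, c₂⟩, p₂⟩ := ih₂
    have hr : ℓ ≤ k - ℓ := by omega
    have b₁ : ℓ ≤ l₁.length := by rw [c₁]; nlinarith
    have b₂ : ℓ ≤ l₂.length := by rw [c₂]; nlinarith
    have dj := h₁.disjoint
    have dj' := h₂.disjoint
    refine ⟨l₁ ++ l₂, ?_, ?_, ?_, ⟨t₁ + t₂ + 1, by rw [List.length_append, c₁, c₂]; ring⟩, ?_⟩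
    · rw [List.nodup_append]
      refine ⟨n₁, n₂, ?_⟩
      intro a ha b hb
      rw [← List.mem_toFinset, e₁] at ha
      rw [← List.mem_toFinset, e₂] at hb
      have hdj : Disjoint (X ∪ I) (Y ∪ J) := by
        simp only [disjoint_union_left, disjoint_union_right] at hd ⊢
        tauto
      exact disjoint_iff_ne.1 hdj a ha b hb
    · rw [List.toFinset_append, e₁, e₂]; simp only [union_assoc]
    · rw [List.take_append_of_le_length b₁, x₁]
    · intro l' hl' hZ i hi
      rw [List.append_assoc]
      rcases lt_or_ge (i * (k - ℓ)) l₁.length with h | h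
      · refine p₁ _ (by simp; omega) ?_ i h
        rw [List.take_append_of_le_length b₂, x₂]
      · have hi' : t₁ + 1 ≤ i := by
          rw [c₁] at h
          exact Nat.le_of_mul_le_mul_right h (by omega)
        obtain ⟨j, rfl⟩ := Nat.exists_eq_add_of_le hi'
        rw [add_mul, ← c₁, List.drop_append, List.drop_eq_nil_of_le (by omega),
          List.nil_append, Nat.add_sub_cancel_left]
        refine p₂ l' hl' hZ j ?_
        rw [List.length_append, add_mul, ← c₁] at hi
        omega

end

lemma hasHamCycle_of_list {n k ℓ : ℕ} {E : Finset (Finset (Fin n))} (hl : 2 * ℓ < k)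
    (hn : 2 * k ≤ n) (hdvd : (k - ℓ) ∣ n) (l : List (Fin n)) (hnd : l.Nodup)
    (hlen : l.length = n)
    (hE : ∀ i, i * (k - ℓ) < n → (((l ++ l).drop (i * (k - ℓ))).take k).toFinset ∈ E) :
    HasHamCycle n k ℓ E := by
  have hn0 : 0 < n := by omega
  have hr0 : 0 < k - ℓ := by omega
  obtain ⟨N, hN⟩ := hdvd
  have hdiv : n / (k - ℓ) = N := by rw [hN]; exact Nat.mul_div_cancel_left _ hr0
  have hmod : ∀ j, j % n < l.length := fun j => by rw [hlen]; exact Nat.mod_lt _ hn0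
  set f : ℕ → Fin n := fun j => l[j % n]'(hmod j) with hf
  have hfmod : ∀ j, f (j % n) = f j := fun j => by simp [hf]
  have hfinj : ∀ a b, f a = f b → a % n = b % n := fun a b h =>
    (hnd.getElem_inj_iff).1 h
  have hcyc : ∀ i, cycEdge n k ℓ f i = (range k).image fun j => f (i * (k - ℓ) + j) := by
    intro i
    simp only [cycEdge, hfmod]
  have hlt : ∀ i < N, i * (k - ℓ) < n := by
    intro i hi
    rw [hN, mul_comm]
    exact (Nat.mul_lt_mul_left hr0).2 hi
  refine ⟨f, ?_, ?_, ?_⟩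
  · intro a ha b hb h
    have := hfinj a b h
    rwa [Nat.mod_eq_of_lt ha, Nat.mod_eq_of_lt hb] at this
  · intro i hi
    rw [hdiv] at hi
    rw [hcyc]
    convert hE i (hlt i hi) using 1
    ext x
    have h2 : ∀ j < k, (l ++ l)[i * (k - ℓ) + j]? = some (f (i * (k - ℓ) + j)) := by
      intro j hj
      have := hlt i hi
      rcases lt_or_ge (i * (k - ℓ) + j) n with h | h
      · rw [List.getElem?_append_left (by omega), List.getElem?_eq_getElem (by omega)]
        simp only [hf, Nat.mod_eq_of_lt h]
      · rw [List.getElem?_append_right (by omega), List.getElem?_eq_getElem (by omega)]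
        have : (i * (k - ℓ) + j) % n = i * (k - ℓ) + j - l.length := by
          rw [hlen, Nat.mod_eq_sub_mod h, Nat.mod_eq_of_lt (by omega)]
        simp only [hf, this]
    simp only [mem_image, mem_range, List.mem_toFinset, List.mem_iff_getElem?,
      List.getElem?_take, List.getElem?_drop]
    constructor
    · rintro ⟨j, hj, rfl⟩
      exact ⟨j, by rw [if_pos hj, h2 j hj]⟩
    · rintro ⟨j, hj⟩
      split_ifs at hj with hjk
      rw [h2 j hjk] at hj
      exact ⟨j, hjk, by simpa using hj⟩
  · intro i hi
    rw [hdiv] at hi ⊢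
    have hshift : cycEdge n k ℓ f ((i + 1) % N)
        = (Ico (k - ℓ) (k - ℓ + k)).image fun j => f (i * (k - ℓ) + j) := by
      rw [hcyc]
      have e : ∀ j, f ((i + 1) % N * (k - ℓ) + j) = f (i * (k - ℓ) + ((k - ℓ) + j)) := by
        intro j
        rw [← hfmod, ← hfmod (i * (k - ℓ) + _)]
        congr 1
        have : ((i + 1) % N) * (k - ℓ) = ((i + 1) * (k - ℓ)) % n := by
          rw [hN, mul_comm (k - ℓ) N, Nat.mul_mod_mul_right]
        rw [this, Nat.mod_add_mod]
        ring_nf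
      simp only [e]
      ext x
      simp only [mem_image, mem_range, mem_Ico]
      constructor
      · rintro ⟨j, hj, rfl⟩
        exact ⟨k - ℓ + j, by omega, rfl⟩
      · rintro ⟨j, hj, rfl⟩
        exact ⟨j - (k - ℓ), by omega, by rw [Nat.add_sub_cancel' hj.1]⟩
    have hinj : Set.InjOn (fun j => f (i * (k - ℓ) + j)) (Iio (2 * k) : Finset ℕ) := by
      intro a ha b hb h
      simp only [coe_Iio, Set.mem_Iio] at ha hb
      have h2 : a ≡ b [MOD n] := Nat.ModEq.add_left_cancel' _ (hfinj _ _ h)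
      exact h2.eq_of_lt_of_lt (by omega) (by omega)
    rw [hshift, hcyc, ← image_inter_of_injOn _ _ (hinj.mono ?_), card_image_of_injOn
      (hinj.mono ?_)]
    · have : range k ∩ Ico (k - ℓ) (k - ℓ + k) = Ico (k - ℓ) k := by
        ext; simp only [mem_inter, mem_range, mem_Ico]; omega
      rw [this, Nat.card_Ico]
      omega
    · intro j
      simp only [coe_inter, Set.mem_inter_iff, mem_coe, mem_range, mem_Ico, mem_Iio]
      omega
    · intro j
      simp only [Set.mem_union, mem_coe, mem_range, mem_Ico, mem_Iio]
      omega

lemma hasHamCycle_of_conn {n k ℓ : ℕ} {E : Finset (Finset (Fin n))} (hl : 2 * ℓ < k)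
    (hn : 2 * k ≤ n) (hdvd : (k - ℓ) ∣ n) {X I Y J : Finset (Fin n)}
    (h₁ : Conn k ℓ E X I Y) (h₂ : Conn k ℓ E Y J X) (hd : Disjoint (X ∪ I) (Y ∪ J))
    (hu : X ∪ I ∪ (Y ∪ J) = univ) : HasHamCycle n k ℓ E := by
  obtain ⟨l₁, n₁, e₁, x₁, ⟨t₁, c₁⟩, p₁⟩ := h₁.exists_list hl
  obtain ⟨l₂, n₂, e₂, x₂, ⟨t₂, c₂⟩, p₂⟩ := h₂.exists_list hl
  have hr : ℓ ≤ k - ℓ := by omega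
  have b₁ : ℓ ≤ l₁.length := by rw [c₁]; nlinarith
  have b₂ : ℓ ≤ l₂.length := by rw [c₂]; nlinarith
  have hnd : (l₁ ++ l₂).Nodup := by
    rw [List.nodup_append]
    refine ⟨n₁, n₂, ?_⟩
    intro a ha b hb
    rw [← List.mem_toFinset, e₁] at ha
    rw [← List.mem_toFinset, e₂] at hb
    exact disjoint_iff_ne.1 hd a ha b hb
  have hlen : (l₁ ++ l₂).length = n := by
    rw [← List.toFinset_card_of_nodup hnd, List.toFinset_append, e₁, e₂, hu]
    simp
  refine hasHamCycle_of_list hl hn hdvd _ hnd hlen fun i hi => ?_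
  rw [List.append_assoc]
  rcases lt_or_ge (i * (k - ℓ)) l₁.length with h | h
  · refine p₁ _ (by simp; omega) ?_ i h
    rw [List.take_append_of_le_length b₂, x₂]
  · have hi' : t₁ + 1 ≤ i := by
      rw [c₁] at h
      exact Nat.le_of_mul_le_mul_right h (by omega)
    obtain ⟨j, rfl⟩ := Nat.exists_eq_add_of_le hi'
    rw [add_mul, ← c₁, List.drop_append, List.drop_eq_nil_of_le (by omega),
      List.nil_append, Nat.add_sub_cancel_left]
    refine p₂ _ (by simp; omega) ?_ j ?_
    · rw [List.take_append_of_le_length b₁, x₁]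
    · rw [← hlen, List.length_append, add_mul, ← c₁] at hi
      omega

section Density

open scoped Classical in
/-- The predicate `P` holds for at least a proportion `c` of all points of `Ω`. -/
def Dens {Ω : Type*} [Fintype Ω] (c : ℝ) (P : Ω → Prop) : Prop :=
  c * Fintype.card Ω ≤ #{ω | P ω}

lemma dens_iff {Ω : Type*} [Fintype Ω] {c : ℝ} {P : Ω → Prop} [DecidablePred P] :
    Dens c P ↔ c * Fintype.card Ω ≤ #{ω | P ω} := by
  unfold Dens
  convert Iff.rfl

namespace Dens

variable {Ω Ω' : Type*} [Fintype Ω] [Fintype Ω'] {c c' d : ℝ} {P Q : Ω → Prop}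

lemma mono (h : Dens c P) (hPQ : ∀ ω, P ω → Q ω) : Dens c Q :=
  h.trans (by
    gcongr with ω
    exact hPQ ω)

lemma mono_left (h : Dens c P) (hc : c' ≤ c) : Dens c' P :=
  le_trans (by unfold Dens at *; gcongr) h

lemma exists_mem (h : Dens c P) (hc : 0 < c) [Nonempty Ω] : ∃ ω, P ω := by
  classical
  rw [dens_iff] at h
  have : 0 < Fintype.card Ω := Fintype.card_pos
  have h1 : (0 : ℝ) < #{ω | P ω} := lt_of_lt_of_le (by positivity) h
  rw [Nat.cast_pos, card_pos] at h1
  obtain ⟨ω, hω⟩ := h1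
  exact ⟨ω, by simpa using hω⟩

lemma of_forall (hP : ∀ ω, P ω) : Dens 1 P := by
  simp [Dens, hP, card_univ]

lemma equiv (e : Ω' ≃ Ω) (h : Dens c P) : Dens c (fun ω => P (e ω)) := by
  classical
  rw [dens_iff] at *
  rw [Fintype.card_congr e]
  refine h.trans (le_of_eq ?_)
  congr 1
  exact (card_bijective e e.bijective (by simp)).symm

lemma prod {P' : Ω → Ω' → Prop} (h : Dens c P) (hd : 0 ≤ d) (h' : ∀ ω, P ω → Dens d (P' ω)) :
    Dens (c * d) (fun ω : Ω × Ω' => P ω.1 ∧ P' ω.1 ω.2) := by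
  classical
  simp only [dens_iff] at *
  have e : (#{ω : Ω × Ω' | P ω.1 ∧ P' ω.1 ω.2} : ℝ)
      = ∑ ω ∈ ({ω | P ω} : Finset Ω), (#{ω' | P' ω ω'} : ℝ) := by
    rw [← Nat.cast_sum, ← card_sigma]
    congr 1
    refine card_bij (fun p _ => ⟨p.1, p.2⟩) (by simp) ?_ ?_
    · rintro ⟨a, b⟩ _ ⟨a', b'⟩ _ h
      simpa using h
    · rintro ⟨a, b⟩ hab
      exact ⟨(a, b), by simpa using hab, rfl⟩
  rw [e, Fintype.card_prod, Nat.cast_mul]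
  calc c * d * (Fintype.card Ω * Fintype.card Ω') = (c * Fintype.card Ω) * (d * Fintype.card Ω') :=
        by ring
    _ ≤ #{ω | P ω} * (d * Fintype.card Ω') := by gcongr
    _ = ∑ ω ∈ ({ω | P ω} : Finset Ω), d * Fintype.card Ω' := by simp
    _ ≤ _ := by
      refine sum_le_sum fun ω hω => h' ω ?_
      simpa using hω

lemma and_not (h : Dens c P) [DecidablePred Q] (hQ : (#{ω | Q ω} : ℝ) ≤ d * Fintype.card Ω) :
    Dens (c - d) (fun ω => P ω ∧ ¬ Q ω) := by
  classical
  rw [dens_iff] at *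
  have : (#{ω | P ω} : ℝ) ≤ #{ω | P ω ∧ ¬ Q ω} + #{ω | Q ω} := by
    rw [← Nat.cast_add, Nat.cast_le]
    refine (card_le_card ?_).trans (card_union_le _ _)
    intro ω
    simp only [mem_filter, mem_univ, true_and, mem_union]
    tauto
  linarith

lemma and (h : Dens c P) (h' : Dens d Q) : Dens (c + d - 1) (fun ω => P ω ∧ Q ω) := by
  classical
  have : (#{ω | ¬ Q ω} : ℝ) ≤ (1 - d) * Fintype.card Ω := by
    have h2 := card_filter_add_card_filter_not (s := (Finset.univ : Finset Ω)) Q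
    rw [card_univ] at h2
    have h3 : (#{ω | Q ω} : ℝ) + #{ω | ¬ Q ω} = Fintype.card Ω := by exact_mod_cast h2
    rw [dens_iff] at h'
    linarith
  refine ((h.and_not this).mono ?_).mono_left (by linarith)
  tauto

section Pow
variable {ι κ V : Type*} [Fintype ι] [Fintype κ] [Fintype V] [DecidableEq ι] [DecidableEq κ] {R : (ι → V) → Prop}

lemma sum {R' : (ι → V) → (κ → V) → Prop} (h : Dens c R) (hd : 0 ≤ d)
    (h' : ∀ x, R x → Dens d (R' x)) :
    Dens (c * d) (fun y : ι ⊕ κ → V => R (y ∘ Sum.inl) ∧ R' (y ∘ Sum.inl) (y ∘ Sum.inr)) :=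
  (h.prod hd h').equiv (Equiv.sumArrowEquivProdArrow ι κ V)

lemma unit {S : V → Prop} (h : Dens c S) : Dens c (fun x : Unit → V => S (x ())) :=
  h.equiv (Equiv.funUnique Unit V)

end Pow
end Dens

section Pow
variable {ι V : Type*} [Fintype ι] [Fintype V] [DecidableEq ι] [DecidableEq V]

lemma card_filter_apply_mem (i : ι) (F : Finset V) :
    Fintype.card V * #{x : ι → V | x i ∈ F} ≤ #F * Fintype.card (ι → V) := by
  rw [← card_univ, ← card_univ, ← card_product, ← card_product]
  refine card_le_card_of_injOn (fun p => (p.2 i, Function.update p.2 i p.1)) ?_ ?_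
  · rintro ⟨a, x⟩ h
    simpa using h
  · rintro ⟨a, x⟩ _ ⟨b, y⟩ _ h
    simp only [Prod.mk.injEq] at h
    have h1 := congrFun h.2 i
    simp only [Function.update_self] at h1
    refine Prod.ext h1 ?_
    funext j
    rcases eq_or_ne j i with rfl | hj
    · exact h.1
    · simpa [hj] using congrFun h.2 j

lemma card_filter_apply_eq {i j : ι} (hij : i ≠ j) :
    Fintype.card V * #{x : ι → V | x i = x j} ≤ Fintype.card (ι → V) := by
  rw [← card_univ, ← card_univ, ← card_product]
  refine card_le_card_of_injOn (fun p => Function.update p.2 i p.1) (by simp) ?_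
  · rintro ⟨a, x⟩ hx ⟨b, y⟩ hy h
    simp only [coe_product, Set.mem_prod, mem_coe, mem_univ, mem_filter, true_and] at hx hy h
    have h1 := congrFun h i
    simp only [Function.update_self] at h1
    have h2 : ∀ l, l ≠ i → x l = y l := fun l hl => by simpa [hl] using congrFun h l
    refine Prod.ext h1 ?_
    funext l
    rcases eq_or_ne l i with rfl | hl
    · show x l = y l
      rw [hx, hy, h2 j hij.symm]
    · exact h2 l hl

lemma Dens.injective_of_le {c d : ℝ} {P : (ι → V) → Prop} (h : Dens c P)
    (hn : (Fintype.card ι : ℝ) ^ 2 ≤ d * Fintype.card V) (hV : 0 < Fintype.card V) :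
    Dens (c - d) (fun x => P x ∧ Function.Injective x) := by
  classical
  have hb : (#{x : ι → V | ¬ Function.Injective x} : ℝ) ≤ d * Fintype.card (ι → V) := by
    have h1 : #{x : ι → V | ¬ Function.Injective x} ≤
        ∑ p ∈ (univ : Finset ι).offDiag, #{x : ι → V | x p.1 = x p.2} := by
      refine (card_le_card ?_).trans card_biUnion_le
      intro x hx
      simp only [Function.Injective, mem_filter, mem_univ, true_and, not_forall] at hx
      obtain ⟨a, b, h, hab⟩ := hx
      simp only [mem_biUnion, mem_filter, mem_univ, true_and, mem_offDiag, Prod.exists]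
      exact ⟨a, b, hab, h⟩
    have h2 : Fintype.card V * #{x : ι → V | ¬ Function.Injective x} ≤
        Fintype.card ι ^ 2 * Fintype.card (ι → V) := by
      calc _ ≤ _ := Nat.mul_le_mul_left _ h1
        _ = ∑ p ∈ (univ : Finset ι).offDiag, Fintype.card V * #{x : ι → V | x p.1 = x p.2} :=
          mul_sum _ _ _
        _ ≤ ∑ p ∈ (univ : Finset ι).offDiag, Fintype.card (ι → V) := by
          refine sum_le_sum fun p hp => card_filter_apply_eq ?_
          simpa using hp
        _ ≤ _ := by
          rw [sum_const, smul_eq_mul, offDiag_card, card_univ, sq]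
          exact Nat.mul_le_mul_right _ (Nat.sub_le _ _)
    have h3 : (Fintype.card V : ℝ) * #{x : ι → V | ¬ Function.Injective x} ≤
        (Fintype.card ι : ℝ) ^ 2 * Fintype.card (ι → V) := by exact_mod_cast h2
    have hV' : (0 : ℝ) < Fintype.card V := by exact_mod_cast hV
    refine le_of_mul_le_mul_left (h3.trans ?_) hV'
    calc _ ≤ (d * Fintype.card V) * (Fintype.card (ι → V) : ℝ) := by gcongr
      _ = _ := by ring
  refine (h.and_not hb).mono ?_
  simp

lemma Dens.injective {c : ℝ} {P : (ι → V) → Prop} (h : Dens c P)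
    (hn : (Fintype.card ι : ℝ) ^ 2 ≤ c / 2 * Fintype.card V) (hV : 0 < Fintype.card V) :
    Dens (c / 2) (fun x => P x ∧ Function.Injective x) :=
  (h.injective_of_le hn hV).mono_left (by linarith)

lemma Dens.avoid {c : ℝ} {P : (ι → V) → Prop} (h : Dens c P) (F : Finset V)
    (hn : (Fintype.card ι : ℝ) * #F ≤ c / 2 * Fintype.card V) (hV : 0 < Fintype.card V) :
    Dens (c / 2) (fun x => P x ∧ ∀ i, x i ∉ F) := by
  classical
  have hb : (#{x : ι → V | ∃ i, x i ∈ F} : ℝ) ≤ c / 2 * Fintype.card (ι → V) := by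
    have h1 : #{x : ι → V | ∃ i, x i ∈ F} ≤ ∑ i : ι, #{x : ι → V | x i ∈ F} := by
      refine (card_le_card ?_).trans card_biUnion_le
      intro x hx
      simpa using hx
    have h2 : Fintype.card V * #{x : ι → V | ∃ i, x i ∈ F} ≤
        Fintype.card ι * #F * Fintype.card (ι → V) := by
      calc _ ≤ _ := Nat.mul_le_mul_left _ h1
        _ = ∑ i : ι, Fintype.card V * #{x : ι → V | x i ∈ F} := mul_sum _ _ _
        _ ≤ ∑ i : ι, #F * Fintype.card (ι → V) :=
          sum_le_sum fun i _ => card_filter_apply_mem i F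
        _ = _ := by rw [sum_const, smul_eq_mul, card_univ, mul_assoc]
    have h3 : (Fintype.card V : ℝ) * #{x : ι → V | ∃ i, x i ∈ F} ≤
        (Fintype.card ι : ℝ) * #F * Fintype.card (ι → V) := by exact_mod_cast h2
    have hV' : (0 : ℝ) < Fintype.card V := by exact_mod_cast hV
    refine le_of_mul_le_mul_left (h3.trans ?_) hV'
    calc _ ≤ (c / 2 * Fintype.card V) * (Fintype.card (ι → V) : ℝ) := by gcongr
      _ = _ := by ring
  refine ((h.and_not hb).mono_left (by linarith)).mono ?_
  simp

end Pow

/-- `P` holds for the vertex sets of a proportion `c` of all `m`-tuples of vertices. -/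
def Rob {V : Type*} [Fintype V] [DecidableEq V] (c : ℝ) (m : ℕ) (P : Finset V → Prop) : Prop :=
  Dens c (fun x : Fin m → V => P (univ.image x))

lemma Dens.rob {ι V : Type*} [Fintype ι] [DecidableEq ι] [Fintype V] [DecidableEq V] {c : ℝ} {P : Finset V → Prop}
    (h : Dens c (fun x : ι → V => P (univ.image x))) : Rob c (Fintype.card ι) P := by
  refine (h.equiv (Equiv.arrowCongr (Fintype.equivFin ι).symm (Equiv.refl V))).mono ?_
  intro x hx
  convert hx using 1
  ext v
  simp only [mem_image, mem_univ, true_and, Equiv.arrowCongr_apply, Equiv.coe_refl,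
    Function.comp_apply, id_eq, Equiv.symm_symm]
  exact ((Fintype.equivFin ι).surjective.exists (p := fun a => x a = v))

namespace Rob
variable {V : Type*} [Fintype V] [DecidableEq V] {c d : ℝ} {m m' : ℕ} {P Q : Finset V → Prop}

lemma mono (h : Rob c m P) (hPQ : ∀ A, P A → Q A) : Rob c m Q :=
  Dens.mono h fun _ => hPQ _

lemma mono_left (h : Rob c m P) (hc : d ≤ c) : Rob d m P := Dens.mono_left h hc

lemma exists_set (h : Rob c m P) (hc : 0 < c) (hV : 0 < Fintype.card V) : ∃ A, P A ∧ #A ≤ m := by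
  have : Nonempty V := Fintype.card_pos_iff.1 hV
  obtain ⟨x, hx⟩ := h.exists_mem hc
  exact ⟨_, hx, card_image_le.trans (by simp)⟩

lemma card_le (h : Rob c m P) : Rob c m (fun A => P A ∧ #A ≤ m) :=
  Dens.mono h fun x hx => ⟨hx, card_image_le.trans (by simp)⟩

lemma comp {P' : Finset V → Finset V → Prop} (h : Rob c m P) (hd : 0 ≤ d)
    (h' : ∀ A, P A → #A ≤ m → Rob d m' (P' A)) :
    Rob (c * d) (m + m') (fun B => ∃ A A', B = A ∪ A' ∧ P A ∧ P' A A') := by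
  have := Dens.sum h.card_le hd (R' := fun x y => P' (univ.image x) (univ.image y))
    fun x hx => h' _ hx.1 hx.2
  have h2 := Dens.rob (P := fun B => ∃ A A', B = A ∪ A' ∧ P A ∧ P' A A') (this.mono ?_)
  · simpa using h2
  · rintro y ⟨⟨h1, -⟩, h2⟩
    refine ⟨_, _, ?_, h1, h2⟩
    ext v
    simp

lemma avoid (h : Rob c m P) (F : Finset V) (hn : (m : ℝ) * #F ≤ c / 2 * Fintype.card V)
    (hV : 0 < Fintype.card V) : Rob (c / 2) m (fun A => P A ∧ Disjoint A F) := by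
  refine (Dens.avoid h F (by simpa using hn) hV).mono ?_
  rintro x ⟨h1, h2⟩
  refine ⟨h1, ?_⟩
  rw [disjoint_left]
  intro v hv
  obtain ⟨i, -, rfl⟩ := mem_image.1 hv
  exact h2 i

lemma free (hn : (m : ℝ) ^ 2 ≤ 1 / 2 * Fintype.card V) (hV : 0 < Fintype.card V) :
    Rob (1 / 2) m (fun A : Finset V => #A = m) := by
  have := (Dens.of_forall (P := fun _ : Fin m → V => True) (by simp)).injective (by simpa using hn) hV
  refine this.mono ?_
  rintro x ⟨-, hx⟩
  show #(univ.image x) = m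
  rw [card_image_of_injective _ hx, card_univ, Fintype.card_fin]

end Rob
end Density

section Blowup

lemma Dens.clone {Ω X B : Type*} [Fintype Ω] [Fintype X] [Fintype B] [DecidableEq B] {c : ℝ}
    {P : Ω → X → Prop} (hc : 0 ≤ c) (h : Dens c (fun p : Ω × X => P p.1 p.2)) :
    Dens (c ^ Fintype.card B) (fun p : Ω × (B → X) => ∀ b, P p.1 (p.2 b)) := by
  classical
  obtain ⟨N, hNB⟩ : ∃ N, N = Fintype.card B := ⟨_, rfl⟩
  rw [dens_iff] at h ⊢
  have e1 : (#{p : Ω × X | P p.1 p.2} : ℝ) = ∑ ω, (#{x | P ω x} : ℝ) := by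
    rw [← Nat.cast_sum, ← card_sigma]
    congr 1
    refine card_bij (fun p _ => ⟨p.1, p.2⟩) (by simp) ?_ ?_
    · rintro ⟨a, b⟩ _ ⟨a', b'⟩ _ h
      simpa using h
    · rintro ⟨a, b⟩ hab
      exact ⟨(a, b), by simpa using hab, rfl⟩
  have e2 : (#{p : Ω × (B → X) | ∀ b, P p.1 (p.2 b)} : ℝ) = ∑ ω, (#{x | P ω x} : ℝ) ^ N := by
    have : ∀ ω, (#{x | P ω x} : ℝ) ^ N = #(Fintype.piFinset fun _ : B => ({x | P ω x} : Finset X)) := by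
      intro ω
      rw [Fintype.card_piFinset]
      simp [hNB]
    simp only [this]
    rw [← Nat.cast_sum, ← card_sigma]
    congr 1
    refine card_bij (fun p _ => ⟨p.1, p.2⟩) (by simp) ?_ ?_
    · rintro ⟨a, b⟩ _ ⟨a', b'⟩ _ h
      simpa using h
    · rintro ⟨a, b⟩ hab
      exact ⟨(a, b), by simpa using hab, rfl⟩
  rw [e1, Fintype.card_prod, Nat.cast_mul] at h
  rw [e2, Fintype.card_prod, Nat.cast_mul, Fintype.card_fun, Nat.cast_pow, ← hNB]
  rcases Nat.eq_zero_or_pos N with hN | hN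
  · simp [hN]
  obtain ⟨m, hm⟩ := Nat.exists_eq_add_of_le' hN
  rcases Nat.eq_zero_or_pos (Fintype.card Ω) with hΩ | hΩ
  · rw [hΩ, Nat.cast_zero, zero_mul, mul_zero]
    exact sum_nonneg fun _ _ => pow_nonneg (Nat.cast_nonneg _) _
  have hΩ' : (0 : ℝ) < Fintype.card Ω := by exact_mod_cast hΩ
  have key := pow_sum_div_card_le_sum_pow (s := (univ : Finset Ω))
    (f := fun ω => (#{x | P ω x} : ℝ)) (fun _ _ => Nat.cast_nonneg _) m
  rw [card_univ] at key
  rw [hm]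
  refine le_trans ?_ key
  rw [le_div_iff₀ (by positivity)]
  calc _ = (c * (Fintype.card Ω * Fintype.card X)) ^ (m + 1) := by ring
    _ ≤ _ := by gcongr

lemma Dens.blowup_fin {W B : Type} [Fintype W] [Fintype B] [DecidableEq B] :
    ∀ (s : ℕ) {Ω : Type} [Fintype Ω] {c : ℝ} {P : Ω → (Fin s → W) → Prop}, 0 ≤ c →
      Dens c (fun p : Ω × (Fin s → W) => P p.1 p.2) →
      Dens (c ^ (Fintype.card B ^ s)) (fun p : Ω × (Fin s → B → W) =>
        ∀ g : Fin s → B, P p.1 (fun i => p.2 i (g i)))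
  | 0, Ω, _, c, P, _, h => by
    rw [pow_zero, pow_one]
    refine (h.equiv (Equiv.prodCongr (Equiv.refl Ω) (Equiv.ofUnique (Fin 0 → B → W) (Fin 0 → W)))).mono ?_
    intro p hp g
    convert hp
    rfl
  | s + 1, Ω, _, c, P, hc, h => by
    have h1 := (h.equiv (⟨fun p => (p.1.1, Fin.cons p.2 p.1.2),
      fun p => ((p.1, Fin.tail p.2), p.2 0), fun p => by simp, fun p => by simp⟩ :
      (Ω × (Fin s → W)) × W ≃ Ω × (Fin (s + 1) → W)))
    have h2 := Dens.clone (B := B) (P := fun (p : Ω × (Fin s → W)) (w : W) =>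
      P p.1 (Fin.cons w p.2)) hc h1
    have h3 := (h2.equiv (⟨fun p => ((p.1.1, p.2), p.1.2), fun p => ((p.1.1, p.2), p.1.2),
      fun p => by simp, fun p => by simp⟩ :
      (Ω × (B → W)) × (Fin s → W) ≃ (Ω × (Fin s → W)) × (B → W)))
    have h4 := Dens.blowup_fin (B := B) s (Ω := Ω × (B → W)) (P := fun (p : Ω × (B → W)) (x : Fin s → W) =>
      ∀ b, P p.1 (Fin.cons (p.2 b) x)) (pow_nonneg hc _) h3
    have h5 := (h4.equiv (⟨fun p => ((p.1, p.2 0), Fin.tail p.2),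
      fun p => (p.1.1, Fin.cons p.1.2 p.2), fun p => by simp, fun p => by simp⟩ :
      Ω × (Fin (s + 1) → B → W) ≃ (Ω × (B → W)) × (Fin s → B → W)))
    rw [← pow_mul, ← pow_succ'] at h5
    refine h5.mono ?_
    intro p hp g
    have hg : (fun i => p.2 i (g i)) = Fin.cons (p.2 0 (g 0))
        (fun i => Fin.tail p.2 i (Fin.tail g i)) := by
      funext i
      refine Fin.cases ?_ (fun j => ?_) i <;> simp [Fin.tail]
    rw [hg]
    exact hp (Fin.tail g) (g 0)

/-- The blow-up lemma: a positive density of patterns yields a positive density of patterns all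
of whose coordinates are replaced by families of clones. -/
lemma Dens.blowup {ι W B : Type} [Fintype ι] [DecidableEq ι] [Fintype W] [Fintype B]
    [DecidableEq B] {c : ℝ} {P : (ι → W) → Prop} (hc : 0 ≤ c) (h : Dens c P) :
    Dens (c ^ (Fintype.card B ^ Fintype.card ι)) (fun x : ι → B → W =>
      ∀ g : ι → B, P (fun i => x i (g i))) := by
  set e := Fintype.equivFin ι
  have h1 := h.equiv ((Equiv.punitProd _).trans (Equiv.arrowCongr e.symm (Equiv.refl W)) :
    Unit × (Fin (Fintype.card ι) → W) ≃ (ι → W))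
  have h2 := Dens.blowup_fin (B := B) _ (P := fun (_ : Unit) x =>
    P ((Equiv.arrowCongr e.symm (Equiv.refl W)) x)) hc h1
  have h3 := h2.equiv (((Equiv.arrowCongr e (Equiv.refl (B → W)))).trans (Equiv.punitProd _).symm)
  refine h3.mono fun x hx g => ?_
  convert hx (g ∘ e.symm) using 1
  funext i
  simp

end Blowup

/-- `k`-uniform hypergraphs in which every `(k-2)`-set is completed to an edge by at least a
proportion `θ` of all ordered pairs of vertices. -/
structure PairDense {V : Type} [Fintype V] [DecidableEq V] (k : ℕ) (θ : ℝ)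
    (E : Finset (Finset V)) : Prop where
  card_eq : ∀ e ∈ E, #e = k
  dens : ∀ S : Finset V, #S = k - 2 → Dens θ (fun p : V × V => insert p.1 (insert p.2 S) ∈ E)

section Edge
variable {V : Type} [DecidableEq V] {k ℓ : ℕ} {E : Finset (Finset V)}

lemma conn_of_card_le (hl : 2 * ℓ < k) (hE : ∀ e ∈ E, #e = k) {X M Y : Finset V} (hX : #X ≤ ℓ)
    (hM : #M ≤ k - 2 * ℓ) (hY : #Y ≤ ℓ) (he : X ∪ M ∪ Y ∈ E) : Conn k ℓ E X M Y := by
  have h := hE _ he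
  have h1 := card_union_add_card_inter (X ∪ M) Y
  have h2 := card_union_add_card_inter X M
  have h3 : (X ∪ M) ∩ Y = ∅ := card_eq_zero.1 (by omega)
  have h4 : X ∩ M = ∅ := card_eq_zero.1 (by omega)
  rw [← disjoint_iff_inter_eq_empty] at h3 h4
  rw [disjoint_union_left] at h3
  exact .edge (by omega) (by omega) (by omega) h4 h3.1 h3.2 he

end Edge

section
variable {V : Type} [Fintype V] [DecidableEq V] {k ℓ : ℕ} {θ : ℝ} {E : Finset (Finset V)}

lemma PairDense.pair (h : PairDense k θ E) {S : Finset V} (hS : #S = k - 2) :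
    Rob θ 2 (fun A => S ∪ A ∈ E) := by
  have := (h.dens S hS).equiv (finTwoArrowEquiv V)
  refine this.mono fun x hx => ?_
  convert hx using 1
  ext v
  simp only [mem_union, mem_image, mem_univ, true_and, Fin.exists_fin_two, mem_insert,
    finTwoArrowEquiv_apply]
  tauto

lemma PairDense.extend (h : PairDense k θ E) (hk : 2 ≤ k) (hθ : 0 ≤ θ)
    (hn : 4 * k ^ 2 ≤ Fintype.card V) {S : Finset V} (hS : #S ≤ k - 2) :
    Rob (θ / 4) (k - #S) (fun A => S ∪ A ∈ E) := by
  have hV : 0 < Fintype.card V := by nlinarith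
  have hn' : 4 * (k : ℝ) ^ 2 ≤ Fintype.card V := by exact_mod_cast hn
  have hk1 : ((k - 2 - #S : ℕ) : ℝ) ≤ k := by exact_mod_cast (by omega)
  have hk2 : (#S : ℝ) ≤ k := by exact_mod_cast (by omega)
  have h0 : (0 : ℝ) ≤ ((k - 2 - #S : ℕ) : ℝ) := Nat.cast_nonneg _
  have h0' : (0 : ℝ) ≤ #S := Nat.cast_nonneg _
  have h1 : Rob (1 / 2) (k - 2 - #S) (fun A : Finset V => #A = k - 2 - #S) :=
    Rob.free (by nlinarith) hV
  have h2 := (h1.avoid S (by nlinarith) hV).comp (P' := fun A A' => S ∪ A ∪ A' ∈ E) hθ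
    (m' := 2) (fun A hA _ => h.pair (by rw [card_union_of_disjoint hA.2.symm, hA.1]; omega))
  rw [show k - 2 - #S + 2 = k - #S by omega] at h2
  refine (h2.mono ?_).mono_left (by linarith)
  rintro B ⟨A, A', rfl, -, h3⟩
  rwa [← union_assoc]

/-- A version of `PairDense.extend` for tuples with an arbitrary index type. -/
lemma PairDense.extend_tuple (h : PairDense k θ E) (hk : 2 ≤ k) (hθ : 0 ≤ θ)
    (hn : 4 * k ^ 2 ≤ Fintype.card V) (κ : Type) [Fintype κ] [DecidableEq κ] {S : Finset V}
    (hS : #S ≤ k - 2) (hκ : Fintype.card κ = k - #S) :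
    Dens (θ / 4) (fun x : κ → V => S ∪ univ.image x ∈ E) := by
  have := h.extend hk hθ hn hS
  rw [← hκ] at this
  refine (this.equiv (Equiv.arrowCongr (Fintype.equivFin κ) (Equiv.refl V))).mono ?_
  intro x hx
  convert hx using 2
  ext v
  simp only [mem_image, mem_univ, true_and]
  exact ((Fintype.equivFin κ).symm.surjective.exists (p := fun a => x a = v))

/-- In the case `k = 3`, most pairs containing a given vertex have large codegree. -/
lemma PairDense.codegree (h : PairDense 3 θ E) (hθ : 7 / 16 ≤ θ) (x : V) :
    Dens (3 / 5) (fun z => Dens (3 / 100) (fun a => ({x, z, a} : Finset V) ∈ E)) := by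
  classical
  set n := Fintype.card V with hn
  have h1 := h.dens {x} (by simp)
  set P : Finset V := {z | Dens (3 / 100) (fun a => ({x, z, a} : Finset V) ∈ E)} with hP
  have hsym : ∀ a b : V, ({x, a, b} : Finset V) = {x, b, a} := by intro a b; ext; simp; tauto
  have hz : ∀ z, z ∉ P → (#{a | ({x, z, a} : Finset V) ∈ E} : ℝ) ≤ 3 / 100 * n := by
    intro z hz
    simp only [hP, mem_filter, mem_univ, true_and, dens_iff, not_le] at hz
    exact hz.le
  rw [dens_iff] at h1 ⊢
  by_contra! hlt
  change (#P : ℝ) < _ at hlt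
  have hsub : ({p : V × V | insert p.1 (insert p.2 {x}) ∈ E} : Finset (V × V)) ⊆
      P ×ˢ P ∪ ((Pᶜ).biUnion (fun z => ({a | ({x, z, a} : Finset V) ∈ E} : Finset V).image
        (fun a => (z, a))) ∪ (Pᶜ).biUnion (fun z =>
        ({a | ({x, z, a} : Finset V) ∈ E} : Finset V).image (fun a => (a, z)))) := by
    rintro ⟨a, b⟩ hab
    have hab' : ({x, a, b} : Finset V) ∈ E := by
      simp only [mem_filter, mem_univ, true_and] at hab
      convert hab using 1
      ext; simp; tauto
    simp only [mem_union, mem_product, mem_biUnion, mem_image, mem_filter, mem_univ, true_and,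
      mem_compl, Prod.mk.injEq]
    by_cases ha : a ∈ P
    · by_cases hb : b ∈ P
      · exact Or.inl ⟨ha, hb⟩
      · exact Or.inr (Or.inr ⟨b, hb, a, by rwa [hsym], rfl, rfl⟩)
    · exact Or.inr (Or.inl ⟨a, ha, b, hab', rfl, rfl⟩)
  have hbi : ∀ g : V → V → V × V, (#((Pᶜ).biUnion (fun z =>
      ({a | ({x, z, a} : Finset V) ∈ E} : Finset V).image (g z))) : ℝ) ≤ n * (3 / 100 * n) := by
    intro g
    calc _ ≤ ∑ z ∈ Pᶜ, (#(({a | ({x, z, a} : Finset V) ∈ E} : Finset V).image (g z)) : ℝ) := by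
          exact_mod_cast card_biUnion_le
      _ ≤ ∑ z ∈ Pᶜ, 3 / 100 * (n : ℝ) := by
          refine sum_le_sum fun z hzz => le_trans ?_ (hz z (by simpa using hzz))
          exact_mod_cast card_image_le
      _ = #(Pᶜ) * (3 / 100 * n) := by simp
      _ ≤ _ := by
          gcongr
          exact card_le_univ _
  have h2 : (#{p : V × V | insert p.1 (insert p.2 {x}) ∈ E} : ℝ) ≤
      #P * #P + (n * (3 / 100 * n) + n * (3 / 100 * n)) := by
    refine le_trans (b := ((#(P ×ˢ P) + (_ + _) : ℕ) : ℝ)) (Nat.cast_le.2 ((card_le_card hsub).trans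
      ((card_union_le _ _).trans (Nat.add_le_add_left (card_union_le _ _) _)))) ?_
    push_cast [card_product]
    gcongr
    · exact hbi fun z a => (z, a)
    · exact hbi fun z a => (a, z)
  rw [Fintype.card_prod] at h1
  push_cast at h1
  have hp : (0 : ℝ) ≤ #P := Nat.cast_nonneg _
  have hn0 : (0 : ℝ) < n := by
    by_contra! h0
    have : (n : ℝ) = 0 := le_antisymm h0 (Nat.cast_nonneg _)
    rw [this] at hlt
    linarith
  nlinarith [mul_pos hn0 hn0]

end

section
variable {V : Type} [Fintype V] [DecidableEq V] {k ℓ : ℕ} {θ : ℝ} {E : Finset (Finset V)}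

lemma Dens.injective_avoid {ι : Type} [Fintype ι] [DecidableEq ι] {c : ℝ} {P : (ι → V) → Prop}
    (hc : 0 ≤ c) (h : Dens c P) (F : Finset V)
    (hn : (Fintype.card ι : ℝ) * (Fintype.card ι + #F + 1) ≤ c / 4 * Fintype.card V)
    (hV : 0 < Fintype.card V) :
    Dens (c / 4) (fun x => P x ∧ Function.Injective x ∧ ∀ i, x i ∉ F) := by
  have h0 : (0 : ℝ) ≤ Fintype.card ι := Nat.cast_nonneg _
  have h1 : (0 : ℝ) ≤ #F := Nat.cast_nonneg _
  have h3 : (0 : ℝ) < Fintype.card V := by exact_mod_cast hV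
  refine (((h.injective ?_ hV).avoid F ?_ hV).mono_left (by linarith)).mono ?_
  · nlinarith [mul_nonneg h0 h1, mul_nonneg hc h3.le]
  · nlinarith [mul_nonneg h0 h1, mul_nonneg hc h3.le]
  · rintro x ⟨⟨h1, h2⟩, h3⟩
    exact ⟨h1, h2, h3⟩

lemma PairDense.connect_three (h : PairDense 3 θ E) (hθ : 7 / 16 ≤ θ)
    (hn : 100000000 ≤ Fintype.card V) {x y : V} (hxy : x ≠ y) :
    Rob (1 / 100000) 3 (fun A => ∃ I ⊆ A, Conn 3 1 E {x} I {y} ∧ #I = 3) := by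
  have hn' : (100000000 : ℝ) ≤ Fintype.card V := by exact_mod_cast hn
  have h1 := (((h.codegree hθ x).and (h.codegree hθ y)).unit).sum (κ := Unit ⊕ Unit)
    (R' := fun z w => ({x, z (), w (Sum.inl ())} : Finset V) ∈ E ∧
      ({y, z (), w (Sum.inr ())} : Finset V) ∈ E) (d := 3 / 100 * (3 / 100)) (by norm_num)
    (by
      rintro z ⟨hx, hy⟩
      exact hx.unit.sum (R' := fun _ w => ({y, z (), w ()} : Finset V) ∈ E) (by norm_num)
        fun _ _ => hy.unit)
  have h2 := Dens.injective_avoid (by norm_num) h1 {x, y} (by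
    rw [card_pair hxy]
    simp only [Fintype.card_sum, Fintype.card_unit]
    push_cast
    linarith) (by omega)
  suffices hs : _ from (show Fintype.card (Unit ⊕ (Unit ⊕ Unit)) = 3 from rfl) ▸
    (Dens.rob (P := fun A => ∃ I ⊆ A, Conn 3 1 E {x} I {y} ∧ #I = 3)
    (h2.mono hs)).mono_left (d := 1 / 100000) (by norm_num)
  rintro w ⟨⟨-, h3, h4⟩, hinj, hF⟩
  simp only [Function.comp_apply] at h3 h4
  set z := w (Sum.inl ())
  set a := w (Sum.inr (Sum.inl ()))
  set b := w (Sum.inr (Sum.inr ()))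
  have e1 : z ≠ a := fun h => by simpa using hinj h
  have e2 : z ≠ b := fun h => by simpa using hinj h
  have e3 : a ≠ b := fun h => by simpa using hinj h
  have f1 := hF (Sum.inl ())
  have f2 := hF (Sum.inr (Sum.inl ()))
  have f3 := hF (Sum.inr (Sum.inr ()))
  simp only [mem_insert, mem_singleton, not_or] at f1 f2 f3
  refine ⟨{a} ∪ {z} ∪ {b}, ?_, Conn.trans (conn_of_card_le (by norm_num) h.card_eq (by simp)
    (by simp) (by simp) ?_) (conn_of_card_le (by norm_num) h.card_eq (by simp) (by simp)
    (by simp) ?_) ?_, ?_⟩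
  · intro v
    simp only [mem_union, mem_singleton, mem_image, mem_univ, true_and]
    rintro ((rfl | rfl) | rfl) <;> exact ⟨_, rfl⟩
  · convert h3 using 1
    ext; simp; tauto
  · convert h4 using 1
    ext; simp; tauto
  · simp only [disjoint_union_left, disjoint_union_right, disjoint_singleton]
    exact ⟨⟨fun h => f3.1 h.symm, e3⟩, hxy, f2.2⟩
  · rw [card_union_of_disjoint, card_union_of_disjoint] <;>
      simp [e1.symm, e2.symm, e3.symm]

/-- A version of `PairDense.extend_tuple` for sets which may degenerate. -/
lemma PairDense.extend_tuple_of_card (h : PairDense k θ E) (hk : 2 ≤ k) (hθ : 0 ≤ θ) (hθ1 : θ ≤ 1)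
    (hn : 4 * k ^ 2 ≤ Fintype.card V) (κ : Type) [Fintype κ] [DecidableEq κ] (S : Finset V)
    {s : ℕ} (hs : s ≤ k - 2) (hκ : Fintype.card κ = k - s) :
    Dens (θ / 4) (fun x : κ → V => #S = s → S ∪ univ.image x ∈ E) := by
  by_cases hS : #S = s
  · exact (h.extend_tuple hk hθ hn κ (hS.le.trans hs) (hS ▸ hκ)).mono fun x hx _ => hx
  · exact (Dens.of_forall fun x hx => absurd hx hS).mono_left (by linarith)

lemma Dens.blowup_injective {ι B : Type} [Fintype ι] [DecidableEq ι] [Fintype B] [DecidableEq B]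
    {c : ℝ} {P : (ι → V) → Prop} (hc : 0 ≤ c) (h : Dens c P) (F : Finset V)
    (hn : (Fintype.card (ι × B) : ℝ) * (Fintype.card (ι × B) + #F + 1) ≤
      c ^ (Fintype.card B ^ Fintype.card ι) / 4 * Fintype.card V)
    (hV : 0 < Fintype.card V) :
    Dens (c ^ (Fintype.card B ^ Fintype.card ι) / 4) (fun x : ι × B → V =>
      (∀ g : ι → B, P (fun i => x (i, g i))) ∧ Function.Injective x ∧ ∀ i, x i ∉ F) :=
  Dens.injective_avoid (pow_nonneg hc _) ((h.blowup (B := B) hc).equiv (Equiv.curry ι B V)) F hn hV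

end

section
variable {V : Type} [DecidableEq V] {k ℓ : ℕ} {E : Finset (Finset V)}

lemma image_univ_fin_two (p : Fin 2 → V) : univ.image p = {p 0, p 1} := by
  ext v
  simp [Fin.exists_fin_two, eq_comm]

lemma exists_coloring {J : Type} {f : J → V} (hf : Function.Injective f) (col : J → ℕ)
    {X Y : Finset V} (hav : ∀ j, f j ∉ X ∪ Y) (hXY : Disjoint X Y) :
    ∃ c : V → ℕ, (∀ j, c (f j) = col j) ∧ (∀ v ∈ X, c v = 100) ∧ ∀ v ∈ Y, c v = 101 := by
  refine ⟨Function.extend f col fun v => if v ∈ X then 100 else 101,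
    fun j => hf.extend_apply _ _ _, fun v hv => ?_, fun v hv => ?_⟩
  · rw [Function.extend_apply', if_pos hv]
    rintro ⟨j, rfl⟩
    exact hav j (mem_union_left _ hv)
  · rw [Function.extend_apply', if_neg (disjoint_right.1 hXY hv)]
    rintro ⟨j, rfl⟩
    exact hav j (mem_union_right _ hv)

lemma disjoint_of_color {W : Type} {c : W → ℕ} {A B : Finset W} {p q : ℕ} (hA : ∀ v ∈ A, c v = p)
    (hB : ∀ v ∈ B, c v = q) (hpq : p ≠ q) : Disjoint A B :=
  disjoint_left.2 fun v hv hv' => hpq ((hA v hv).symm.trans (hB v hv'))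

lemma conn_odd_of_coloring (hk : k = 2 * ℓ + 1) (hℓ : 1 ≤ ℓ) (hE : ∀ e ∈ E, #e = k) {c : V → ℕ}
    {X Y G : Finset V} {Q : Fin 2 → Finset V} {z y : Fin 2 → V} {a a' : V}
    (hX : ∀ v ∈ X, c v = 100) (hY : ∀ v ∈ Y, c v = 101) (hG : ∀ v ∈ G, c v = 2)
    (hQ0 : ∀ v ∈ Q 0, c v = 3) (hQ1 : ∀ v ∈ Q 1, c v = 4) 
    (hz0 : ∀ v ∈ ({z 0} : Finset V), c v = 5) (hz1 : ∀ v ∈ ({z 1} : Finset V), c v = 6)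
    (hy0 : ∀ v ∈ ({y 0} : Finset V), c v = 7) (hy1 : ∀ v ∈ ({y 1} : Finset V), c v = 8)
    (ha : ∀ v ∈ ({a} : Finset V), c v = 9) (ha' : ∀ v ∈ ({a'} : Finset V), c v = 10)
    (hXc : #X = ℓ) (hYc : #Y = ℓ) (hGc : #G = ℓ) (hQc : ∀ b, #(Q b) = ℓ - 1)
    (b1 : X ∪ Q 0 ∪ {z 0, a} ∈ E) (b2 : Q 0 ∪ {z 0, y 0} ∪ G ∈ E)
    (b3 : Q 1 ∪ {z 1, y 1} ∪ G ∈ E) (b4 : Y ∪ Q 1 ∪ {y 1, a'} ∈ E) :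
    ∃ I ⊆ Q 0 ∪ Q 1 ∪ G ∪ {z 0, z 1, y 0, y 1, a, a'}, Conn k ℓ E X I Y ∧ #I = 3 * ℓ + 4 := by
  have hl' : 2 * ℓ < k := by omega
  have c1 : #(Q 0 ∪ {z 0}) ≤ ℓ :=
    (card_union_le _ _).trans (by rw [hQc, card_singleton]; omega)
  have c2 : #(Q 1 ∪ {y 1}) ≤ ℓ :=
    (card_union_le _ _).trans (by rw [hQc, card_singleton]; omega)
  have c4 : ∀ b : V, #{b} ≤ k - 2 * ℓ := fun b => by rw [card_singleton]; omega
  have p1 := conn_of_card_le hl' hE hXc.le (c4 a) c1 (by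
    convert b1 using 1; ext v; simp only [mem_union, mem_insert, mem_singleton]; tauto)
  have p2 := conn_of_card_le hl' hE c1 (c4 (y 0)) hGc.le (by
    convert b2 using 1; ext v; simp only [mem_union, mem_insert, mem_singleton]; tauto)
  have p3 := conn_of_card_le hl' hE hGc.le (c4 (z 1)) c2 (by
    convert b3 using 1; ext v; simp only [mem_union, mem_insert, mem_singleton]; tauto)
  have p4 := conn_of_card_le hl' hE c2 (c4 a') hYc.le (by
    convert b4 using 1; ext v; simp only [mem_union, mem_insert, mem_singleton]; tauto)
  have q1 := p1.trans p2 (by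
    simp only [disjoint_union_left, disjoint_union_right]
    and_intros
    all_goals exact disjoint_of_color (by assumption) (by assumption) (by norm_num))
  have q2 := q1.trans p3 (by
    simp only [disjoint_union_left, disjoint_union_right]
    and_intros
    all_goals exact disjoint_of_color (by assumption) (by assumption) (by norm_num))
  have q3 := q2.trans p4 (by
    simp only [disjoint_union_left, disjoint_union_right]
    and_intros
    all_goals exact disjoint_of_color (by assumption) (by assumption) (by norm_num))
  refine ⟨_, ?_, q3, ?_⟩
  · clear * -
    intro v
    simp only [mem_union, mem_insert, mem_singleton]
    tauto
  · have h0 := hQc 0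
    have h1 := hQc 1
    rw [card_union_of_disjoint, card_union_of_disjoint, card_union_of_disjoint,
      card_union_of_disjoint, card_union_of_disjoint, card_union_of_disjoint,
      card_union_of_disjoint, card_union_of_disjoint, hGc, h0, h1]
    · simp only [card_singleton]; omega
    all_goals
      try simp only [disjoint_union_left, disjoint_union_right]
      try and_intros
      all_goals exact disjoint_of_color (by assumption) (by assumption) (by norm_num)

end

section
variable {V : Type} [Fintype V] [DecidableEq V] {k ℓ : ℕ} {θ : ℝ} {E : Finset (Finset V)}

/-- Joining two `ℓ`-sets when `k = 2ℓ + 1`. -/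
lemma PairDense.connect_odd (hℓ : 2 ≤ ℓ) (hθ : 0 < θ) (hθ1 : θ ≤ 1) : ∃ c : ℝ, 0 < c ∧ ∃ m n₀ : ℕ,
    ∀ (V : Type) [Fintype V] [DecidableEq V] (E : Finset (Finset V)), n₀ ≤ Fintype.card V →
      PairDense (2 * ℓ + 1) θ E → ∀ X Y : Finset V, #X = ℓ → #Y = ℓ → Disjoint X Y →
      Rob c m (fun A => ∃ I ⊆ A, Conn (2 * ℓ + 1) ℓ E X I Y ∧ #I = 3 * ℓ + 4) := by
  set k := 2 * ℓ + 1 with hk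
  let ι := ((Fin (ℓ - 1) ⊕ Fin 2) ⊕ Fin 2) ⊕ Fin ℓ
  set c₀ : ℝ := 1 / 4 * θ * θ * (θ / 4) with hc₀
  set c : ℝ := c₀ ^ (Fintype.card (Fin 2) ^ Fintype.card ι) with hc
  have hc₀' : 0 < c₀ := by positivity
  have hc' : 0 < c := pow_pos hc₀' _
  obtain ⟨n₀, hn₀⟩ := exists_nat_ge ((Fintype.card (ι × Fin 2) : ℝ) *
    (Fintype.card (ι × Fin 2) + (2 * ℓ : ℕ) + 1) / (c / 4))
  refine ⟨c / 4, by positivity, Fintype.card (ι × Fin 2), n₀ + 16 * k ^ 2, ?_⟩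
  intro V _ _ E hn h X Y hX hY hXY
  have hk1 : 1 ≤ k ^ 2 := Nat.one_le_pow _ _ (by omega)
  have hV : 0 < Fintype.card V := by omega
  have hnr : (n₀ : ℝ) ≤ Fintype.card V := by exact_mod_cast (by omega)
  have hnk : 16 * (k : ℝ) ^ 2 ≤ Fintype.card V := by exact_mod_cast (by omega)
  have hl1 : ((ℓ - 1 : ℕ) : ℝ) ≤ k - 1 := by
    rw [le_sub_iff_add_le]; exact_mod_cast (by omega)
  have hl0 : (0 : ℝ) ≤ ((ℓ - 1 : ℕ) : ℝ) := Nat.cast_nonneg _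
  have hXYc : #(X ∪ Y) = 2 * ℓ := by rw [card_union_of_disjoint hXY]; omega
  have d1 : Dens (1 / 4) (fun x : Fin (ℓ - 1) → V =>
      True ∧ Function.Injective x ∧ ∀ i, x i ∉ X ∪ Y) := by
    refine Dens.injective_avoid (by norm_num)
      (Dens.of_forall (P := fun _ : Fin (ℓ - 1) → V => True) (by simp)) _ ?_ hV
    rw [hXYc, Fintype.card_fin]
    have : ((2 * ℓ : ℕ) : ℝ) ≤ k := by exact_mod_cast (by omega)
    nlinarith
  have hQ : ∀ x : Fin (ℓ - 1) → V, (True ∧ Function.Injective x ∧ ∀ i, x i ∉ X ∪ Y) →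
      #(univ.image x) = ℓ - 1 ∧ Disjoint X (univ.image x) ∧ Disjoint Y (univ.image x) := by
    rintro x ⟨-, h1, h2⟩
    refine ⟨by rw [card_image_of_injective _ h1, card_univ, Fintype.card_fin], ?_, ?_⟩
    all_goals
      rw [disjoint_right]
      simp only [mem_image, mem_univ, true_and, forall_exists_index, forall_apply_eq_imp_iff]
      intro i
      have := h2 i
      simp only [mem_union, not_or] at this
      tauto
  have d2 := d1.sum (κ := Fin 2) (R' := fun x p => X ∪ univ.image x ∪ univ.image p ∈ E) hθ.le
    fun x hx => h.pair (by
      obtain ⟨h1, h2, -⟩ := hQ x hx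
      rw [card_union_of_disjoint h2]; omega)
  have d3 := d2.sum (κ := Fin 2)
    (R' := fun x p => Y ∪ univ.image (x ∘ Sum.inl) ∪ univ.image p ∈ E) hθ.le
    fun x hx => h.pair (by
      obtain ⟨h1, -, h2⟩ := hQ _ hx.1
      rw [card_union_of_disjoint h2]; omega)
  have d4 := d3.sum (κ := Fin ℓ) (R' := fun x p => #(univ.image (x ∘ Sum.inl ∘ Sum.inl) ∪
    {x (Sum.inl (Sum.inr 0)), x (Sum.inr 0)}) = ℓ + 1 → univ.image (x ∘ Sum.inl ∘ Sum.inl) ∪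
    {x (Sum.inl (Sum.inr 0)), x (Sum.inr 0)} ∪ univ.image p ∈ E) (d := θ / 4) (by positivity)
    fun x _ => h.extend_tuple_of_card (by omega) hθ.le hθ1 (by omega) (Fin ℓ) _ (by omega)
      (by rw [Fintype.card_fin]; omega)
  have d5 := Dens.blowup_injective (B := Fin 2) hc₀'.le d4 (X ∪ Y) (by
    rw [hXYc]
    refine ((div_le_iff₀ (by positivity)).1 (hn₀.trans hnr)).trans_eq ?_
    rw [mul_comm]) hV
  refine (d5.mono ?_).rob
  rintro f ⟨hf, hinj, hav⟩
  let Q (b : Fin 2) : Finset V := univ.image fun t : Fin (ℓ - 1) =>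
    f (Sum.inl (Sum.inl (Sum.inl t)), b)
  let G : Finset V := univ.image fun t : Fin ℓ => f (Sum.inr t, 0)
  let z (b : Fin 2) : V := f (Sum.inl (Sum.inl (Sum.inr 0)), b)
  let a : V := f (Sum.inl (Sum.inl (Sum.inr 1)), 0)
  let y (b : Fin 2) : V := f (Sum.inl (Sum.inr 0), b)
  let a' : V := f (Sum.inl (Sum.inr 1), 0)
  obtain ⟨col, hcol, hcX, hcY⟩ := exists_coloring hinj (fun i => Sum.elim (Sum.elim (Sum.elim
    (fun _ => ![3, 4] i.2) ![![5, 6] i.2, 9]) ![![7, 8] i.2, 10]) (fun _ => 2) i.1) hav hXY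
  have hQc : ∀ b, #(Q b) = ℓ - 1 := by
    intro b
    rw [card_image_of_injective, card_univ, Fintype.card_fin]
    exact fun s t h => Sum.inl_injective (Sum.inl_injective (Sum.inl_injective
      (congrArg Prod.fst (hinj h))))
  have hGc : #G = ℓ := by
    rw [card_image_of_injective, card_univ, Fintype.card_fin]
    exact fun s t h => Sum.inr_injective (congrArg Prod.fst (hinj h))
  have hQcol : ∀ b, ∀ v ∈ Q b, col v = ![3, 4] b := by
    intro b v hv
    obtain ⟨t, -, rfl⟩ := mem_image.1 hv
    exact hcol _
  have hz : ∀ b, col (z b) = ![5, 6] b := fun b => hcol _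
  have hy : ∀ b, col (y b) = ![7, 8] b := fun b => hcol _
  have hca : col a = 9 := hcol _
  have hca' : col a' = 10 := hcol _
  have hcard : ∀ b, #(Q b ∪ {z b, y b}) = ℓ + 1 := by
    intro b
    have h1 : z b ≠ y b := fun h => by
      have := (hz b).symm.trans ((congrArg col h).trans (hy b))
      fin_cases b <;> simp at this
    rw [card_union_of_disjoint, hQc, card_pair h1]
    · omega
    · rw [disjoint_left]
      intro v hv hv'
      have h2 := hQcol b v hv
      have h3 := hz b
      have h4 := hy b
      rw [mem_insert, mem_singleton] at hv'
      rcases hv' with rfl | rfl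
      · rw [h3] at h2; fin_cases b <;> simp at h2
      · rw [h4] at h2; fin_cases b <;> simp at h2
  have b1 := (hf fun _ => 0).1.1.2
  have b2 := (hf fun _ => 0).2 (hcard 0)
  have b3 := (hf (Sum.elim (fun _ => 1) fun _ => 0)).2 (hcard 1)
  have b4 := (hf (Sum.elim (Sum.elim (fun _ => 1) ![1, 0]) fun _ => 0)).1.2
  rw [image_univ_fin_two] at b1 b4
  obtain ⟨I, hI, hI'⟩ := conn_odd_of_coloring (a := a) (a' := a') (Q := Q) (z := z) (y := y)
    (G := G) hk (by omega) h.card_eq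
    hcX hcY (by
      intro v hv
      obtain ⟨t, -, rfl⟩ := mem_image.1 hv
      exact hcol _) (hQcol 0) (hQcol 1) (by simpa using hz 0) (by simpa using hz 1)
    (by simpa using hy 0) (by simpa using hy 1) (by simpa using hca) (by simpa using hca')
    hX hY hGc hQc b1 b2 b3 b4
  refine ⟨I, hI.trans ?_, hI'⟩
  intro v hv
  simp only [mem_union, mem_image, mem_univ, true_and, mem_insert, mem_singleton, Q, G, z, y, a, a'] at hv ⊢
  rcases hv with ((⟨_, rfl⟩ | ⟨_, rfl⟩) | ⟨_, rfl⟩) | (rfl | rfl | rfl | rfl | rfl | rfl) <;>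
    exact ⟨_, rfl⟩

end

/-- Any two disjoint `ℓ`-sets are joined by many `ℓ`-paths with `q` interior vertices. -/
def Joins {V : Type} [Fintype V] [DecidableEq V] (k ℓ : ℕ) (E : Finset (Finset V)) (c : ℝ)
    (m q : ℕ) : Prop :=
  ∀ X Y : Finset V, #X = ℓ → #Y = ℓ → Disjoint X Y →
    Rob c m (fun A => ∃ I ⊆ A, Conn k ℓ E X I Y ∧ #I = q)

section
variable {k ℓ : ℕ} {θ : ℝ}

lemma exists_joins (hk : 3 ≤ k) (hℓ : 1 ≤ ℓ) (hl : 2 * ℓ < k) (hθ : 0 < θ) (hθ1 : θ ≤ 1)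
    (h3 : k = 3 → 7 / 16 ≤ θ) : ∃ c : ℝ, 0 < c ∧ ∃ m q n₀ : ℕ,
    ∀ (V : Type) [Fintype V] [DecidableEq V] (E : Finset (Finset V)), n₀ ≤ Fintype.card V →
      PairDense k θ E → Joins k ℓ E c m q := by
  rcases eq_or_ne k 3 with rfl | hk3
  · obtain rfl : ℓ = 1 := by omega
    refine ⟨1 / 100000, by norm_num, 3, 3, 100000000, fun V _ _ E hn h X Y hX hY hXY => ?_⟩
    obtain ⟨x, rfl⟩ := card_eq_one.1 hX
    obtain ⟨y, rfl⟩ := card_eq_one.1 hY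
    exact h.connect_three (h3 rfl) hn (by simpa using hXY)
  rcases eq_or_ne k (2 * ℓ + 1) with rfl | hk2
  · obtain ⟨c, hc, m, n₀, H⟩ := PairDense.connect_odd (ℓ := ℓ) (by omega) hθ hθ1
    exact ⟨c, hc, m, _, n₀, fun V _ _ E hn h X Y hX hY hXY => H V E hn h X Y hX hY hXY⟩
  · refine ⟨θ / 4, by positivity, k - 2 * ℓ, k - 2 * ℓ, 4 * k ^ 2,
      fun V _ _ E hn h X Y hX hY hXY => ?_⟩
    have hXYc : #(X ∪ Y) = 2 * ℓ := by rw [card_union_of_disjoint hXY]; omega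
    have := h.extend (by omega) hθ.le hn (S := X ∪ Y) (by omega)
    rw [hXYc] at this
    refine this.card_le.mono ?_
    rintro A ⟨hA, hA'⟩
    have hc : Conn k ℓ E X A Y := conn_of_card_le hl h.card_eq hX.le hA' hY.le
      (by rwa [union_right_comm])
    refine ⟨A, Subset.rfl, hc, ?_⟩
    have h1 := h.card_eq _ hA
    have h2 := card_union_le (X ∪ Y) A
    omega

lemma Joins.lengthen {V : Type} [Fintype V] [DecidableEq V] {E : Finset (Finset V)} {c : ℝ}
    {m q : ℕ} (hl : 2 * ℓ < k) (hk : 3 ≤ k) (hθ : 0 < θ) (hθ1 : θ ≤ 1) (h : PairDense k θ E)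
    (hJ : Joins k ℓ E c m q) (hc : 0 < c) (hc1 : c ≤ 1)
    (hn : 16 * ((k : ℝ) + m) ^ 2 ≤ θ * c * Fintype.card V) :
    Joins k ℓ E (θ * c / 16) (k - ℓ + m) (q + (k - ℓ)) := by
  intro X Y hX hY hXY
  have hk' : (3 : ℝ) ≤ k := by exact_mod_cast hk
  have hm : (0 : ℝ) ≤ m := Nat.cast_nonneg _
  have hN0 : (0 : ℝ) ≤ Fintype.card V := Nat.cast_nonneg _
  have hn1 : 16 * ((k : ℝ) + m) ^ 2 ≤ θ * Fintype.card V := hn.trans (by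
    have := mul_le_mul_of_nonneg_left hc1 (mul_nonneg hθ.le hN0)
    nlinarith)
  have hn2 : 16 * ((k : ℝ) + m) ^ 2 ≤ c * Fintype.card V := hn.trans (by
    have := mul_le_mul_of_nonneg_left hθ1 (mul_nonneg hc.le hN0)
    nlinarith)
  have hn3 : 16 * ((k : ℝ) + m) ^ 2 ≤ Fintype.card V := hn1.trans (by nlinarith)
  have hn4 : 4 * k ^ 2 ≤ Fintype.card V := by
    have : 4 * (k : ℝ) ^ 2 ≤ Fintype.card V := by nlinarith
    exact_mod_cast this
  have hV : 0 < Fintype.card V := by nlinarith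
  have hYr : (#Y : ℝ) ≤ k := by exact_mod_cast (by omega)
  have hXr : (#X : ℝ) ≤ k := by exact_mod_cast (by omega)
  have hkl : ((k - ℓ : ℕ) : ℝ) ≤ k := by exact_mod_cast (by omega)
  have hkl0 : (0 : ℝ) ≤ ((k - ℓ : ℕ) : ℝ) := Nat.cast_nonneg _
  have h1 := h.extend (by omega) hθ.le hn4 (S := X) (by omega)
  rw [hX] at h1
  have h2 := h1.avoid Y (by nlinarith) hV
  have key : ∀ A : Finset V, (X ∪ A ∈ E ∧ Disjoint A Y) → #A ≤ k - ℓ →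
      ∃ M Z, M ∪ Z = A ∧ #Z = ℓ ∧ #M = k - 2 * ℓ ∧ Disjoint M Z ∧ Conn k ℓ E X M Z := by
    rintro A ⟨hA, hAY⟩ hAc
    have h3 := h.card_eq _ hA
    have h4 := card_union_le X A
    obtain ⟨Z, hZA, hZ⟩ := exists_subset_card_eq (s := A) (n := ℓ) (by omega)
    have h5 : #(A \ Z) = k - 2 * ℓ := by rw [card_sdiff_of_subset hZA]; omega
    refine ⟨A \ Z, Z, sdiff_union_of_subset hZA, hZ, h5, sdiff_disjoint, ?_⟩
    exact conn_of_card_le hl h.card_eq hX.le h5.le hZ.le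
      (by rwa [union_assoc, sdiff_union_of_subset hZA])
  have h3 := h2.comp (m' := m) (d := c / 2) (P' := fun A A' => #A ≤ k - ℓ ∧
    ∃ M Z, M ∪ Z = A ∧ #M = k - 2 * ℓ ∧ #Z = ℓ ∧ Disjoint M Z ∧ Conn k ℓ E X M Z ∧ Disjoint A Y ∧
      Disjoint A' (X ∪ A) ∧ ∃ I ⊆ A', Conn k ℓ E Z I Y ∧ #I = q) (by positivity) (by
    intro A hA hAc
    obtain ⟨M, Z, rfl, hZ, hM, hMZ, hconn⟩ := key A hA hAc
    have hZY : Disjoint Z Y := (disjoint_union_left.1 hA.2).2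
    have hXA : (#(X ∪ (M ∪ Z)) : ℝ) ≤ k := by
      exact_mod_cast (h.card_eq _ hA.1).le
    refine ((hJ Z Y hZ hY hZY).avoid (X ∪ (M ∪ Z)) (by nlinarith) hV).mono ?_
    rintro A' ⟨h1, h2⟩
    exact ⟨hAc, M, Z, rfl, hM, hZ, hMZ, hconn, hA.2, h2, h1⟩)
  refine (h3.mono ?_).mono_left (by linarith)
  rintro _ ⟨A, A', rfl, -, -, M, Z, rfl, hM, hZ, hMZ, hconn, hAY, hA', I, hI, hconn', hIq⟩
  have hd : Disjoint I (X ∪ (M ∪ Z)) := hA'.mono_left hI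
  refine ⟨M ∪ Z ∪ I, union_subset_union_right hI, hconn.trans hconn' ?_, ?_⟩
  · simp only [disjoint_union_left, disjoint_union_right] at hAY hd ⊢
    exact ⟨⟨hd.1.symm, hd.2.1.symm⟩, hXY, hAY.1⟩
  · rw [card_union_of_disjoint, card_union_of_disjoint hMZ]
    · omega
    · simp only [disjoint_union_left, disjoint_union_right] at hd ⊢
      exact ⟨hd.2.1.symm, hd.2.2.symm⟩

end

section
variable {V : Type} [DecidableEq V] {k ℓ : ℕ} {E : Finset (Finset V)}

/-- A system of paths which can cover either of `A ∪ {u}` and `A ∪ {v}`. -/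
structure Flip (k ℓ : ℕ) (E : Finset (Finset V)) (L : List (Finset V × Finset V)) (A : Finset V)
    (u v : V) : Prop where
  left : Sys k ℓ E L (insert u A)
  right : Sys k ℓ E L (insert v A)

lemma Flip.symm {L : List (Finset V × Finset V)} {A : Finset V} {u v : V}
    (h : Flip k ℓ E L A u v) : Flip k ℓ E L A v u := ⟨h.2, h.1⟩

lemma Flip.trans {L L' : List (Finset V × Finset V)} {A A' : Finset V} {u v w : V}
    (h : Flip k ℓ E L A u w) (h' : Flip k ℓ E L' A' w v)
    (hd : Disjoint (insert u A) (insert w A')) (hd' : Disjoint (insert w A) (insert v A')) :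
    Flip k ℓ E (L ++ L') (insert w (A ∪ A')) u v := by
  constructor
  · convert h.1.append h'.1 hd using 1
    rw [insert_union, union_insert, insert_comm]
  · convert h.2.append h'.2 hd' using 1
    rw [insert_union, union_insert, insert_comm]

lemma flip_of_edges (hl : 2 * ℓ < k) (hℓ : 1 ≤ ℓ) (hE : ∀ e ∈ E, #e = k) {D T R : Finset V}
    {a c p q : V} (hT : #T = k - 1 - ℓ) (hR : #R = k - 1 - ℓ) (hD : #D ≤ ℓ - 1)
    (h1 : D ∪ T ∪ {a, q} ∈ E) (h2 : D ∪ T ∪ {c, p} ∈ E) (h3 : D ∪ {a, c} ∪ R ∈ E)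
    (hRT : Disjoint R T) (hp : p ∉ insert a R) (hq : q ∉ insert c R) (haT : a ∉ T)
    (hcT : c ∉ T) :
    ∃ L, L.length = 1 ∧ Flip k ℓ E L (D ∪ T ∪ R ∪ {a, c}) p q := by
  obtain ⟨X, hXR, hX⟩ := exists_subset_card_eq (s := R) (n := ℓ) (by omega)
  obtain ⟨Y, hYT, hY⟩ := exists_subset_card_eq (s := T) (n := ℓ) (by omega)
  have hM0 : #(R \ X) = k - 1 - 2 * ℓ := by rw [card_sdiff_of_subset hXR]; omega
  have hM1 : #(T \ Y) = k - 1 - 2 * ℓ := by rw [card_sdiff_of_subset hYT]; omega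
  have hc1 : ∀ (S : Finset V) (b : V), #S = k - 1 - 2 * ℓ → #(S ∪ {b}) ≤ k - 2 * ℓ := by
    intro S b h
    exact (card_union_le _ _).trans (by rw [card_singleton]; omega)
  have hc2 : ∀ b : V, #(D ∪ {b}) ≤ ℓ := by
    intro b
    exact (card_union_le _ _).trans (by rw [card_singleton]; omega)
  have hX1 : ∀ v, v ∈ X → v ∈ R := fun v => @hXR v
  have hY1 : ∀ v, v ∈ Y → v ∈ T := fun v => @hYT v
  -- the two states, for either order of the pairs `(a, c)` and `(q, p)`
  have key : ∀ a c q : V, D ∪ T ∪ {a, q} ∈ E → D ∪ {a, c} ∪ R ∈ E → q ∉ insert c R → a ∉ T →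
      c ∉ T → Sys k ℓ E [(X, Y)] (insert q (D ∪ T ∪ R ∪ {a, c})) := by
    intro a c q h1 h3 hq haT hcT
    have p1 : Conn k ℓ E X (R \ X ∪ {c}) (D ∪ {a}) :=
      conn_of_card_le hl hE hX.le (hc1 _ c hM0) (hc2 a) (by
        convert h3 using 1
        ext v
        have := hX1 v
        clear * - this
        simp only [mem_union, mem_sdiff, mem_insert, mem_singleton]
        tauto)
    have p2 : Conn k ℓ E (D ∪ {a}) (T \ Y ∪ {q}) Y :=
      conn_of_card_le hl hE (hc2 a) (hc1 _ q hM1) hY.le (by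
        convert h1 using 1
        ext v
        have := hY1 v
        clear * - this
        simp only [mem_union, mem_sdiff, mem_insert, mem_singleton]
        tauto)
    have hd : Disjoint (X ∪ (R \ X ∪ {c})) (T \ Y ∪ {q} ∪ Y) := by
      rw [disjoint_left]
      intro v hv hv'
      have e1 := hX1 v
      have e2 := hY1 v
      have e3 : v ∈ R → v ∉ T := fun h => disjoint_left.1 hRT h
      simp only [mem_union, mem_sdiff, mem_insert, mem_singleton, not_or] at hv hv' hq
      have hv1 : v ∈ R ∨ v = c := by clear * - hv e1; tauto
      have hv2 : v ∈ T ∨ v = q := by clear * - hv' e2; tauto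
      rcases hv1 with h | rfl
      · rcases hv2 with h' | rfl
        exacts [e3 h h', hq.2 h]
      · rcases hv2 with h' | rfl
        exacts [hcT h', hq.1 rfl]
    have := (p1.trans p2 hd).sys
    convert this using 1
    ext v
    have e1 := hX1 v
    have e2 := hY1 v
    clear * - e1 e2
    simp only [mem_union, mem_sdiff, mem_insert, mem_singleton]
    by_cases x1 : v ∈ X
    · simp [x1, e1 x1]
    · by_cases x2 : v ∈ Y
      · simp [x2, e2 x2]
      · simp only [x1, x2]
        tauto
  refine ⟨[(X, Y)], rfl, ?_, key a c q h1 h3 hq haT hcT⟩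
  have := key c a p h2 (by rwa [pair_comm]) hp hcT haT
  rwa [pair_comm] at this

end

/-- Coordinates for a pair of edges which moves a given vertex. -/
abbrev HalfIdx (k ℓ : ℕ) : Type :=
  (((Fin (ℓ - 1) ⊕ Fin (k - 1 - ℓ)) ⊕ Unit) ⊕ Fin 2) ⊕ Fin (k - 1 - ℓ)

/-- Coordinates for the edges through a given pair. -/
abbrev LinkIdx (k ℓ : ℕ) : Type := (Fin (ℓ - 1) ⊕ Fin (k - 1 - ℓ)) ⊕ Fin (k - 1 - ℓ)

section
variable {V : Type} [DecidableEq V] {k ℓ : ℕ} {E : Finset (Finset V)}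

/-- The first part of a pattern for exchanging `u`. -/
structure HalfPattern (E : Finset (Finset V)) (u : V) (x : HalfIdx k ℓ → V) : Prop where
  left : univ.image (fun i => x (.inl (.inl (.inl (.inl i))))) ∪
    univ.image (fun i => x (.inl (.inl (.inl (.inr i))))) ∪ {x (.inl (.inl (.inr ()))), u} ∈ E
  right : univ.image (fun i => x (.inl (.inl (.inl (.inl i))))) ∪
    univ.image (fun i => x (.inl (.inl (.inl (.inr i))))) ∪
      {x (.inl (.inr 0)), x (.inl (.inr 1))} ∈ E
  link : #(univ.image (fun i => x (.inl (.inl (.inl (.inl i))))) ∪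
      {x (.inl (.inr 0)), x (.inl (.inl (.inr ())))}) = ℓ + 1 →
    univ.image (fun i => x (.inl (.inl (.inl (.inl i))))) ∪
      {x (.inl (.inr 0)), x (.inl (.inl (.inr ())))} ∪ univ.image (fun i => x (.inr i)) ∈ E

/-- The second part of a pattern for exchanging vertices: edges through `q` and `z`. -/
structure LinkPattern (E : Finset (Finset V)) (q z : V) (x : LinkIdx k ℓ → V) : Prop where
  edge : #{q, z} = 2 → univ.image (fun i => x (.inl (.inl i))) ∪
    univ.image (fun i => x (.inl (.inr i))) ∪ {q, z} ∈ E
  link : #(univ.image (fun i => x (.inl (.inl i))) ∪ {q, z}) = ℓ + 1 →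
    univ.image (fun i => x (.inl (.inl i))) ∪ {q, z} ∪ univ.image (fun i => x (.inr i)) ∈ E

lemma exists_flip_of_coloring (hl : 2 * ℓ < k) (hℓ : 1 ≤ ℓ) (hE : ∀ e ∈ E, #e = k) {c : V → ℕ}
    {D T R D' T' R' : Finset V} {a d u q q' z z' : V} {b cu t : ℕ} (hb : 3 ≤ b) (ht : t < 3)
    (ht0 : t ≠ 0) (hcu : b + 11 ≤ cu)
    (hD : ∀ v ∈ D, c v = b) (hT : ∀ v ∈ T, c v = b + 1) (hd : ∀ v ∈ ({d} : Finset V), c v = b + 2)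
    (ha : ∀ v ∈ ({a} : Finset V), c v = b + 3) (hq : ∀ v ∈ ({q} : Finset V), c v = b + 4)
    (hq' : ∀ v ∈ ({q'} : Finset V), c v = b + 5) (hR : ∀ v ∈ R, c v = b + 7)
    (hD' : ∀ v ∈ D', c v = b + 8) (hT' : ∀ v ∈ T', c v = b + 9) (hR' : ∀ v ∈ R', c v = b + 10)
    (hz : ∀ v ∈ ({z} : Finset V), c v = 0) (hz' : ∀ v ∈ ({z'} : Finset V), c v = t)
    (hu : ∀ v ∈ ({u} : Finset V), c v = cu)
    (cD : #D = ℓ - 1) (cT : #T = k - 1 - ℓ) (cR : #R = k - 1 - ℓ)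
    (cD' : #D' = ℓ - 1) (cT' : #T' = k - 1 - ℓ) (cR' : #R' = k - 1 - ℓ)
    (e1 : D ∪ T ∪ {d, u} ∈ E) (e2 : D ∪ T ∪ {a, q} ∈ E)
    (e3 : #(D ∪ {a, d}) = ℓ + 1 → D ∪ {a, d} ∪ R ∈ E)
    (e4 : #{q', z} = 2 → D' ∪ T' ∪ {q', z} ∈ E) (e5 : #{q, z'} = 2 → D' ∪ T' ∪ {q, z'} ∈ E)
    (e6 : #(D' ∪ {q', z'}) = ℓ + 1 → D' ∪ {q', z'} ∪ R' ∈ E) :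
    ∃ L, L.length = 2 ∧ Flip k ℓ E L
      (insert q (D ∪ T ∪ R ∪ {a, d} ∪ (D' ∪ T' ∪ R' ∪ {q', z'}))) u z := by
  have card2 : ∀ {x y : V} {i j : ℕ}, (∀ v ∈ ({x} : Finset V), c v = i) →
      (∀ v ∈ ({y} : Finset V), c v = j) → i ≠ j → #{x, y} = 2 := by
    intro x y i j hx hy hij
    exact card_pair fun h => hij ((hx x (mem_singleton_self x)).symm.trans
      (hy x (by simp [h])))
  have cardD : ∀ {D : Finset V} {x y : V} {h i j : ℕ}, (∀ v ∈ D, c v = h) →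
      (∀ v ∈ ({x} : Finset V), c v = i) → (∀ v ∈ ({y} : Finset V), c v = j) → i ≠ j → h ≠ i →
      h ≠ j → #D = ℓ - 1 → #(D ∪ {x, y}) = ℓ + 1 := by
    intro D x y h i j hD hx hy hij hhi hhj cD
    rw [card_union_of_disjoint, card2 hx hy hij, cD]
    · omega
    · rw [insert_eq, disjoint_union_right]
      exact ⟨disjoint_of_color hD hx hhi, disjoint_of_color hD hy hhj⟩
  have notMem : ∀ {x : V} {S : Finset V} {i j : ℕ}, (∀ v ∈ ({x} : Finset V), c v = i) →
      (∀ v ∈ S, c v = j) → i ≠ j → x ∉ S := fun hx hS hij =>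
    disjoint_singleton_left.1 (disjoint_of_color hx hS hij)
  have notMem2 : ∀ {x y : V} {S : Finset V} {h i j : ℕ}, (∀ v ∈ ({x} : Finset V), c v = i) →
      (∀ v ∈ ({y} : Finset V), c v = h) →
      (∀ v ∈ S, c v = j) → i ≠ h → i ≠ j → x ∉ insert y S := by
    intro x y S h i j hx hy hS h1 h2
    rw [insert_eq, notMem_union]
    exact ⟨notMem hx hy h1, notMem hx hS h2⟩
  obtain ⟨L, hL, hF⟩ := flip_of_edges hl hℓ hE cT cR cD.le e2 e1
    (e3 (cardD hD ha hd (by omega) (by omega) (by omega) cD)) (disjoint_of_color hR hT (by omega))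
    (notMem2 hu ha hR (by omega) (by omega)) (notMem2 hq hd hR (by omega) (by omega))
    (notMem ha hT (by omega)) (notMem hd hT (by omega))
  obtain ⟨L', hL', hF'⟩ := flip_of_edges hl hℓ hE cT' cR' cD'.le (e4 (card2 hq' hz (by omega)))
    (by rw [pair_comm]; exact e5 (card2 hq hz' (by omega)))
    (e6 (cardD hD' hq' hz' (by omega) (by omega) (by omega) cD'))
    (disjoint_of_color hR' hT' (by omega))
    (notMem2 hq hq' hR' (by omega) (by omega)) (notMem2 hz hz' hR' (by omega) (by omega))
    (notMem hq' hT' (by omega)) (notMem hz' hT' (by omega))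
  refine ⟨L ++ L', by rw [List.length_append, hL, hL'], hF.trans hF' ?_ ?_⟩
  all_goals
    simp only [insert_eq, disjoint_union_left, disjoint_union_right]
    and_intros
    all_goals exact disjoint_of_color (by assumption) (by assumption) (by omega)

/-- The colours of the coordinates of a pattern. -/
def halfColor (k ℓ : ℕ) : HalfIdx k ℓ → Fin 3 → ℕ :=
  Sum.elim (Sum.elim (Sum.elim (Sum.elim (fun _ _ => 0) fun _ _ => 1) fun _ _ => 2)
    ![fun _ => 3, fun t => 4 + t]) fun _ _ => 7

/-- The colours of the coordinates of a pattern. -/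
def linkColor (k ℓ : ℕ) : LinkIdx k ℓ → Fin 3 → ℕ :=
  Sum.elim (Sum.elim (fun _ _ => 8) fun _ _ => 9) fun _ _ => 10

lemma exists_flip_of_pattern (hl : 2 * ℓ < k) (hℓ : 1 ≤ ℓ) (hE : ∀ e ∈ E, #e = k) {c : V → ℕ}
    {x : HalfIdx k ℓ → Fin 3 → V} {w : LinkIdx k ℓ → Fin 3 → V} {z : Fin 3 → V} {u : V}
    {b cu : ℕ} {t : Fin 3} (hb : 3 ≤ b) (ht0 : t ≠ 0) (hcu : b + 11 ≤ cu)
    (hx : ∀ g : HalfIdx k ℓ → Fin 3, HalfPattern E u fun i => x i (g i))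
    (hw : ∀ (r s : Fin 3) (g : LinkIdx k ℓ → Fin 3),
      LinkPattern E (x (.inl (.inr 1)) r) (z s) fun i => w i (g i))
    (hxi : Function.Injective fun i => x i 0) (hwi : Function.Injective fun i => w i 0)
    (hu : c u = cu) (hxc : ∀ i s, c (x i s) = b + halfColor k ℓ i s)
    (hwc : ∀ i s, c (w i s) = b + linkColor k ℓ i s) (hzc : ∀ s, c (z s) = s) :
    ∃ L A, L.length = 2 ∧ Flip k ℓ E L A u (z 0) ∧
      ∀ v ∈ A, (c v = t ∨ (b ≤ c v ∧ c v ≤ b + 10)) ∧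
        ((∃ i s, x i s = v) ∨ (∃ i s, w i s = v) ∨ z t = v) := by
  have hcard : ∀ {m : ℕ} {f : Fin m → V}, Function.Injective f → #(univ.image f) = m := by
    intro m f hf
    rw [card_image_of_injective _ hf, card_univ, Fintype.card_fin]
  obtain ⟨L, hL, hF⟩ := exists_flip_of_coloring (c := c) (b := b) (cu := cu) (t := t)
    (D := univ.image fun i => x (.inl (.inl (.inl (.inl i)))) 0)
    (T := univ.image fun i => x (.inl (.inl (.inl (.inr i)))) 0)
    (R := univ.image fun i => x (.inr i) 0)
    (D' := univ.image fun i => w (.inl (.inl i)) 0)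
    (T' := univ.image fun i => w (.inl (.inr i)) 0)
    (R' := univ.image fun i => w (.inr i) 0)
    (a := x (.inl (.inr 0)) 0) (d := x (.inl (.inl (.inr ()))) 0) (u := u)
    (q := x (.inl (.inr 1)) 0) (q' := x (.inl (.inr 1)) 1) (z := z 0) (z' := z t)
    hl hℓ hE hb t.2 (fun h => ht0 (Fin.ext h)) hcu
    (by simpa [halfColor] using fun i => hxc (.inl (.inl (.inl (.inl i)))) 0)
    (by simpa [halfColor] using fun i => hxc (.inl (.inl (.inl (.inr i)))) 0)
    (by simpa [halfColor] using hxc (.inl (.inl (.inr ()))) 0)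
    (by simpa [halfColor] using hxc (.inl (.inr 0)) 0)
    (by simpa [halfColor] using hxc (.inl (.inr 1)) 0)
    (by simpa [halfColor] using hxc (.inl (.inr 1)) 1)
    (by simpa [halfColor] using fun i => hxc (.inr i) 0)
    (by simpa [linkColor] using fun i => hwc (.inl (.inl i)) 0)
    (by simpa [linkColor] using fun i => hwc (.inl (.inr i)) 0)
    (by simpa [linkColor] using fun i => hwc (.inr i) 0)
    (by simpa using hzc 0) (by simpa using hzc t) (by simpa using hu)
    (hcard fun i j h => by simpa using hxi h) (hcard fun i j h => by simpa using hxi h)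
    (hcard fun i j h => by simpa using hxi h) (hcard fun i j h => by simpa using hwi h)
    (hcard fun i j h => by simpa using hwi h) (hcard fun i j h => by simpa using hwi h)
    (hx fun _ => 0).left (hx fun _ => 0).right (hx fun _ => 0).link
    (hw 1 0 fun _ => 0).edge (hw 0 t fun _ => 0).edge (hw 1 t fun _ => 0).link
  refine ⟨L, _, hL, hF, ?_⟩
  intro v hv
  have hxb : ∀ i s, halfColor k ℓ i s ≤ 10 := by
    rintro ((((i | i) | i) | i) | i) s <;> try simp [halfColor]
    fin_cases i <;> simp <;> omega
  have hwb : ∀ i s, linkColor k ℓ i s ≤ 10 := by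
    rintro ((i | i) | i) s <;> simp [linkColor]
  have h1 : (∃ i s, x i s = v) ∨ (∃ i s, w i s = v) ∨ z t = v := by
    simp only [mem_insert, mem_union, mem_image, mem_univ, true_and, mem_singleton] at hv
    rcases hv with rfl | ((((⟨i, rfl⟩ | ⟨i, rfl⟩) | ⟨i, rfl⟩) | rfl | rfl) |
      (((⟨i, rfl⟩ | ⟨i, rfl⟩) | ⟨i, rfl⟩) | rfl | rfl))
    all_goals first
      | exact Or.inl ⟨_, _, rfl⟩
      | exact Or.inr (Or.inl ⟨_, _, rfl⟩)
      | exact Or.inr (Or.inr rfl)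
  refine ⟨?_, h1⟩
  rcases h1 with ⟨i, s, rfl⟩ | ⟨i, s, rfl⟩ | rfl
  · have := hxb i s
    rw [hxc]; omega
  · have := hwb i s
    rw [hwc]; omega
  · exact Or.inl (hzc t)

end

section
variable {V : Type} [Fintype V] [DecidableEq V] {k ℓ : ℕ} {θ : ℝ} {E : Finset (Finset V)}

lemma PairDense.halfPattern_start (h : PairDense k θ E) (hk : 3 ≤ k) (hl : 2 * ℓ < k) (hℓ : 1 ≤ ℓ)
    (hθ : 0 ≤ θ) (hn : 4 * k ^ 2 ≤ Fintype.card V) (u : V) :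
    Dens (θ / 4) (fun x : (Fin (ℓ - 1) ⊕ Fin (k - 1 - ℓ)) ⊕ Unit → V =>
      univ.image (fun i => x (.inl (.inl i))) ∪ univ.image (fun i => x (.inl (.inr i))) ∪
        {x (.inr ()), u} ∈ E ∧ #(univ.image (fun i => x (.inl (.inl i))) ∪
          univ.image (fun i => x (.inl (.inr i)))) = k - 2) := by
  have h1 := h.extend_tuple (by omega) hθ hn ((Fin (ℓ - 1) ⊕ Fin (k - 1 - ℓ)) ⊕ Unit) (S := {u})
    (by rw [card_singleton]; omega)
    (by simp only [Fintype.card_sum, Fintype.card_fin, Fintype.card_unit, card_singleton]; omega)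
  refine h1.mono fun x hx => ?_
  have h2 : univ.image (fun i => x (.inl (.inl i))) ∪ univ.image (fun i => x (.inl (.inr i))) ∪
      {x (.inr ()), u} ∈ E := by
    convert hx using 1
    ext v
    simp only [mem_union, mem_image, mem_univ, true_and, mem_insert, mem_singleton, Sum.exists]
    tauto
  refine ⟨h2, ?_⟩
  have h3 := h.card_eq _ h2
  have h4 := card_union_le (univ.image (fun i => x (.inl (.inl i))) ∪
    univ.image (fun i => x (.inl (.inr i)))) {x (.inr ()), u}
  have h5 := card_union_le (univ.image (fun i => x (.inl (.inl i))))
    (univ.image (fun i => x (.inl (.inr i))))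
  have h6 : #(univ.image (fun i => x (.inl (.inl i)))) ≤ ℓ - 1 := card_image_le.trans (by simp)
  have h7 : #(univ.image (fun i => x (.inl (.inr i)))) ≤ k - 1 - ℓ := card_image_le.trans (by simp)
  have h8 : #{x (.inr ()), u} ≤ 2 := card_le_two
  omega

lemma PairDense.halfPattern (h : PairDense k θ E) (hk : 4 ≤ k) (hl : 2 * ℓ < k) (hℓ : 1 ≤ ℓ)
    (hθ : 0 ≤ θ) (hθ1 : θ ≤ 1) (hn : 4 * k ^ 2 ≤ Fintype.card V) (u : V) :
    Dens (θ / 4 * θ * (θ / 4)) (fun x : HalfIdx k ℓ → V => HalfPattern E u x) := by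
  have h0 := h.halfPattern_start (by omega) hl hℓ hθ hn u
  have hp : ∀ x : (Fin (ℓ - 1) ⊕ Fin (k - 1 - ℓ)) ⊕ Unit → V,
      (univ.image (fun i => x (.inl (.inl i))) ∪ univ.image (fun i => x (.inl (.inr i))) ∪
        {x (.inr ()), u} ∈ E ∧ #(univ.image (fun i => x (.inl (.inl i))) ∪
          univ.image (fun i => x (.inl (.inr i)))) = k - 2) →
      Dens θ (fun p : Fin 2 → V => univ.image (fun i => x (.inl (.inl i))) ∪
      univ.image (fun i => x (.inl (.inr i))) ∪ univ.image p ∈ E) := fun x hx => h.pair hx.2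
  have h1 := Dens.sum h0 hθ hp
  have hp2 : ∀ x : ((Fin (ℓ - 1) ⊕ Fin (k - 1 - ℓ)) ⊕ Unit) ⊕ Fin 2 → V,
      Dens (θ / 4) (fun p : Fin (k - 1 - ℓ) → V =>
      #(univ.image (fun i => x (.inl (.inl (.inl i)))) ∪
        {x (.inr 0), x (.inl (.inr ()))}) = ℓ + 1 → univ.image (fun i => x (.inl (.inl (.inl i)))) ∪
        {x (.inr 0), x (.inl (.inr ()))} ∪ univ.image p ∈ E) := fun x =>
    h.extend_tuple_of_card (by omega) hθ hθ1 hn _ _ (by omega) (by rw [Fintype.card_fin]; omega)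
  have h2 := Dens.sum h1 (by linarith) fun x _ => hp2 x
  refine h2.mono ?_
  rintro x ⟨⟨⟨h3, -⟩, h4⟩, h5⟩
  rw [image_univ_fin_two] at h4
  exact ⟨h3, h4, h5⟩

lemma PairDense.linkPattern (h : PairDense k θ E) (hk : 4 ≤ k) (hl : 2 * ℓ < k) (hℓ : 1 ≤ ℓ)
    (hθ : 0 ≤ θ) (hθ1 : θ ≤ 1) (hn : 4 * k ^ 2 ≤ Fintype.card V) (q z : V) :
    Dens (θ / 4 * (θ / 4)) (fun x : LinkIdx k ℓ → V => LinkPattern E q z x) := by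
  have h1 := h.extend_tuple_of_card (by omega) hθ hθ1 hn (Fin (ℓ - 1) ⊕ Fin (k - 1 - ℓ))
    {q, z} (s := 2) (by omega)
    (by simp only [Fintype.card_sum, Fintype.card_fin]; omega)
  have hp : ∀ x : Fin (ℓ - 1) ⊕ Fin (k - 1 - ℓ) → V,
      Dens (θ / 4) (fun p : Fin (k - 1 - ℓ) → V =>
      #(univ.image (fun i => x (.inl i)) ∪ {q, z}) = ℓ + 1 →
        univ.image (fun i => x (.inl i)) ∪ {q, z} ∪ univ.image p ∈ E) := fun x =>
    h.extend_tuple_of_card (by omega) hθ hθ1 hn _ _ (by omega) (by rw [Fintype.card_fin]; omega)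
  have h2 := Dens.sum h1 (by linarith) fun x _ => hp x
  refine h2.mono ?_
  rintro x ⟨h3, h4⟩
  refine ⟨fun hqz => ?_, h4⟩
  convert h3 hqz using 1
  ext v
  simp only [mem_union, mem_image, mem_univ, true_and, mem_insert, mem_singleton, Sum.exists,
    Function.comp_apply]
  tauto

lemma Dens.fin_one {W : Type} [Fintype W] {c : ℝ} {S : W → Prop} (h : Dens c S) :
    Dens c (fun x : Fin 1 → W => S (x 0)) :=
  h.equiv (Equiv.funUnique (Fin 1) W)

lemma PairDense.halfPattern_three (h : PairDense 3 θ E) (hθ : 7 / 16 ≤ θ)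
    (hn : 36 ≤ Fintype.card V) (u : V) :
    Dens (θ / 4 * (1 / 5 * (3 / 100)) * (3 / 100))
      (fun x : HalfIdx 3 1 → V => HalfPattern E u x) := by
  have h0 := h.halfPattern_start (ℓ := 1) le_rfl (by norm_num) le_rfl (by linarith) (by omega) u
  have hp : ∀ x : (Fin (1 - 1) ⊕ Fin (3 - 1 - 1)) ⊕ Unit → V,
      Dens (1 / 5 * (3 / 100)) (fun p : Fin 2 → V =>
        ({x (.inl (.inr 0)), p 0, p 1} : Finset V) ∈ E ∧
        Dens (3 / 100) fun r => ({x (.inr ()), p 0, r} : Finset V) ∈ E) := fun x => by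
    have h2 := ((h.codegree hθ (x (.inl (.inr 0)))).and (h.codegree hθ (x (.inr ())))).prod
      (P' := fun a q => ({x (.inl (.inr 0)), a, q} : Finset V) ∈ E) (by norm_num)
      fun a ha => ha.1
    refine ((h2.equiv (finTwoArrowEquiv V)).mono ?_).mono_left (by norm_num)
    rintro p ⟨h3, h4⟩
    exact ⟨h4, h3.2⟩
  have h1 := Dens.sum h0 (by norm_num) fun x _ => hp x
  have hq : ∀ x : ((Fin (1 - 1) ⊕ Fin (3 - 1 - 1)) ⊕ Unit) ⊕ Fin 2 → V,
      Dens (3 / 100) (fun r => ({x (.inl (.inr ())), x (.inr 0), r} : Finset V) ∈ E) →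
      Dens (3 / 100) (fun p : Fin (3 - 1 - 1) → V =>
        ({x (.inl (.inr ())), x (.inr 0), p 0} : Finset V) ∈ E) := fun x hx => hx.fin_one
  have h2 := Dens.sum h1 (by norm_num) fun x hx => hq x hx.2.2
  refine h2.mono ?_
  rintro x ⟨⟨⟨h3, -⟩, h4, -⟩, h5⟩
  have e0 : ∀ f : Fin (1 - 1) → V, univ.image f = ∅ := fun f => by simp
  have e1 : ∀ f : Fin (3 - 1 - 1) → V, univ.image f = {f 0} := fun f => by
    simp
  refine ⟨h3, ?_, fun _ => ?_⟩
  · rw [e0, e1, empty_union]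
    exact h4
  · rw [e0, e1, empty_union]
    convert h5 using 1
    ext v
    simp only [mem_union, mem_insert, mem_singleton, Function.comp_apply]
    tauto

lemma PairDense.linkPattern_three (h : PairDense 3 θ E) (hθ : 7 / 16 ≤ θ) (q : V) :
    Dens (3 / 5) (fun z => Dens (3 / 100 * (3 / 100))
      (fun x : LinkIdx 3 1 → V => LinkPattern E q z x)) := by
  refine (h.codegree hθ q).mono fun z hz => ?_
  have h0 : Dens 1 (fun _ : Fin (1 - 1) → V => True) := Dens.of_forall fun _ => trivial
  have hq : Dens (3 / 100) (fun p : Fin (3 - 1 - 1) → V => ({q, z, p 0} : Finset V) ∈ E) :=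
    hz.fin_one
  have h1 := Dens.sum h0 (by norm_num) fun x _ => hq
  have h2 := Dens.sum h1 (by norm_num) fun x _ => hq
  refine (h2.mono ?_).mono_left (by norm_num)
  rintro x ⟨⟨-, h3⟩, h4⟩
  have e0 : ∀ f : Fin (1 - 1) → V, univ.image f = ∅ := fun f => by simp
  have e1 : ∀ f : Fin (3 - 1 - 1) → V, univ.image f = {f 0} := fun f => by
    simp
  refine ⟨fun _ => ?_, fun _ => ?_⟩
  · rw [e0, e1, empty_union]
    convert h3 using 1
    ext v
    simp only [mem_union, mem_insert, mem_singleton, Function.comp_apply]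
    tauto
  · rw [e0, e1, empty_union]
    convert h4 using 1
    ext v
    simp only [mem_union, mem_insert, mem_singleton, Function.comp_apply]
    tauto

end

lemma Dens.rob_of_range {ι V : Type} [Fintype ι] [DecidableEq ι] [Fintype V] [DecidableEq V]
    {c : ℝ} {P : (ι → V) → Prop} {Q : Finset V → Prop} (h : Dens c P)
    (hQ : ∀ f, P f → ∀ S : Finset V, (∀ i, f i ∈ S) → (∀ v ∈ S, ∃ i, f i = v) → Q S) :
    Rob c (Fintype.card ι) Q :=
  Dens.rob (h.mono fun f hf => hQ f hf (univ.image f) (fun i => mem_image_of_mem f (mem_univ i))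
    fun v hv => by simpa using hv)

/-- A positive density of the patterns which are used to exchange vertices. -/
lemma exists_pattern_density {k ℓ : ℕ} {θ : ℝ} (hk : 3 ≤ k) (hℓ : 1 ≤ ℓ) (hl : 2 * ℓ < k)
    (hθ : 0 < θ) (hθ1 : θ ≤ 1) (h3 : k = 3 → 7 / 16 ≤ θ) :
    ∃ c : ℝ, 0 < c ∧ ∀ (V : Type) [Fintype V] [DecidableEq V] (E : Finset (Finset V)),
      4 * k ^ 2 ≤ Fintype.card V → PairDense k θ E →
      (∀ u, Dens c fun x : HalfIdx k ℓ → V => HalfPattern E u x) ∧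
      ∀ q, Dens (3 / 5) fun z => Dens c fun x : LinkIdx k ℓ → V => LinkPattern E q z x := by
  rcases eq_or_lt_of_le hk with rfl | hk4
  · obtain rfl : ℓ = 1 := by omega
    have h3 := h3 rfl
    refine ⟨min (θ / 4 * (1 / 5 * (3 / 100)) * (3 / 100)) (3 / 100 * (3 / 100)),
      by positivity, fun V _ _ E hn h => ⟨fun u => ?_, fun q => ?_⟩⟩
    · exact (h.halfPattern_three h3 hn u).mono_left (min_le_left _ _)
    · exact (h.linkPattern_three h3 q).mono fun z hz => hz.mono_left (min_le_right _ _)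
  · refine ⟨θ / 4 * θ * (θ / 4), by positivity, fun V _ _ E hn h => ⟨fun u => ?_, fun q => ?_⟩⟩
    · exact h.halfPattern hk4 hl hℓ hθ.le hθ1 hn u
    · refine (Dens.of_forall fun z => ?_).mono_left (by norm_num)
      exact (h.linkPattern hk4 hl hℓ hθ.le hθ1 hn q z).mono_left (by nlinarith [mul_pos hθ hθ])

section
variable {V : Type} [Fintype V] [DecidableEq V] {k ℓ : ℕ} {θ : ℝ} {E : Finset (Finset V)}

/-- Coordinates for the exchange of two given vertices. -/
abbrev SwapIdx (k ℓ : ℕ) : Type :=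
  (((HalfIdx k ℓ ⊕ HalfIdx k ℓ) ⊕ Unit) ⊕ LinkIdx k ℓ) ⊕ LinkIdx k ℓ

/-- A pattern for the exchange of `u` and `v`. -/
structure SwapPattern (E : Finset (Finset V)) (u v : V) (x : SwapIdx k ℓ → V) : Prop where
  half : HalfPattern E u fun i => x (.inl (.inl (.inl (.inl i))))
  half' : HalfPattern E v fun i => x (.inl (.inl (.inl (.inr i))))
  link : LinkPattern E (x (.inl (.inl (.inl (.inl (.inl (.inr 1)))))))
    (x (.inl (.inl (.inr ())))) fun i => x (.inl (.inr i))
  link' : LinkPattern E (x (.inl (.inl (.inl (.inr (.inl (.inr 1)))))))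
    (x (.inl (.inl (.inr ())))) fun i => x (.inr i)

set_option synthInstance.maxSize 2000 in
lemma swapPattern_dens {c : ℝ} (hc : 0 < c)
    (hH : ∀ u, Dens c fun x : HalfIdx k ℓ → V => HalfPattern E u x)
    (hL : ∀ q, Dens (3 / 5) fun z => Dens c fun x : LinkIdx k ℓ → V => LinkPattern E q z x)
    (u v : V) : Dens (c * c * (1 / 5) * c * c) (SwapPattern (k := k) (ℓ := ℓ) E u v) := by
  have h1 := Dens.sum (hH u) hc.le fun _ _ => hH v
  have hz : ∀ x : HalfIdx k ℓ ⊕ HalfIdx k ℓ → V, Dens (1 / 5) fun z : Unit → V =>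
      (Dens c fun w : LinkIdx k ℓ → V => LinkPattern E (x (.inl (.inl (.inr 1)))) (z ()) w) ∧
      Dens c fun w : LinkIdx k ℓ → V => LinkPattern E (x (.inr (.inl (.inr 1)))) (z ()) w :=
    fun x => (((hL _).and (hL _)).mono_left (by norm_num)).unit
  have h2 := Dens.sum h1 (by norm_num) fun x _ => hz x
  have h3 := Dens.sum h2 hc.le fun x hx => hx.2.1
  have h4 := Dens.sum h3 hc.le fun x hx => hx.1.2.2
  refine h4.mono ?_
  rintro x ⟨⟨⟨⟨h5, h6⟩, -⟩, h7⟩, h8⟩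
  exact ⟨h5, h6, h7, h8⟩

end

section
variable {V : Type} [DecidableEq V] {k ℓ : ℕ} {E : Finset (Finset V)}

set_option synthInstance.maxSize 2000 in
lemma exists_flip_of_swapPattern (hl : 2 * ℓ < k) (hℓ : 1 ≤ ℓ) (hE : ∀ e ∈ E, #e = k)
    {u v : V} (huv : u ≠ v) {f : SwapIdx k ℓ × Fin 3 → V} (hinj : Function.Injective f)
    (hf : ∀ g : SwapIdx k ℓ → Fin 3, SwapPattern E u v fun i => f (i, g i))
    (hav : ∀ j, f j ∉ ({u, v} : Finset V)) {S : Finset V} (hS : ∀ j, f j ∈ S) (hu : u ∉ S)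
    (hv : v ∉ S) : ∃ L A, A ⊆ S ∧ L.length = 4 ∧ u ∉ A ∧ v ∉ A ∧ Flip k ℓ E L A u v := by
  obtain ⟨c, hc, hcu, hcv⟩ := exists_coloring hinj (fun p => Sum.elim (Sum.elim (Sum.elim
    (Sum.elim (fun i => 10 + halfColor k ℓ i p.2) (fun i => 30 + halfColor k ℓ i p.2))
    (fun _ => (p.2 : ℕ))) (fun i => 10 + linkColor k ℓ i p.2))
    (fun i => 30 + linkColor k ℓ i p.2) p.1) (X := {u}) (Y := {v})
    (by simpa using hav) (by simpa using huv)
  have hcu := hcu u (mem_singleton_self u)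
  have hcv := hcv v (mem_singleton_self v)
  obtain ⟨L₁, A₁, hL₁, hF₁, hA₁⟩ := exists_flip_of_pattern (c := c) (u := u) (b := 10) (cu := 100)
    (t := 1) hl hℓ hE (x := fun i s => f (.inl (.inl (.inl (.inl i))), s))
    (w := fun i s => f (.inl (.inr i), s)) (z := fun s => f (.inl (.inl (.inr ())), s))
    (by norm_num) (by decide) (by norm_num)
    (fun g => (hf (Sum.elim (Sum.elim (Sum.elim (Sum.elim g 0) 0) 0) 0)).half)
    (fun r s g => (hf (Sum.elim (Sum.elim (Sum.elim (Sum.elim (fun _ => r) 0) fun _ => s) g)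
      0)).link)
    (fun i j h => by simpa using hinj h) (fun i j h => by simpa using hinj h) hcu
    (fun i s => hc _) (fun i s => hc _) (fun s => hc _)
  obtain ⟨L₂, A₂, hL₂, hF₂, hA₂⟩ := exists_flip_of_pattern (c := c) (u := v) (b := 30) (cu := 101)
    (t := 2) hl hℓ hE (x := fun i s => f (.inl (.inl (.inl (.inr i))), s))
    (w := fun i s => f (.inr i, s)) (z := fun s => f (.inl (.inl (.inr ())), s))
    (by norm_num) (by decide) (by norm_num)
    (fun g => (hf (Sum.elim (Sum.elim (Sum.elim (Sum.elim 0 g) 0) 0) 0)).half')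
    (fun r s g => (hf (Sum.elim (Sum.elim (Sum.elim (Sum.elim 0 fun _ => r) fun _ => s) 0)
      g)).link')
    (fun i j h => by simpa using hinj h) (fun i j h => by simpa using hinj h) hcv
    (fun i s => hc _) (fun i s => hc _) (fun s => hc _)
  have hc0 : c (f (.inl (.inl (.inr ())), 0)) = 0 := hc _
  have hr₁ : ∀ w ∈ A₁, c w = 1 ∨ (10 ≤ c w ∧ c w ≤ 20) := fun w hw => (hA₁ w hw).1
  have hr₂ : ∀ w ∈ A₂, c w = 2 ∨ (30 ≤ c w ∧ c w ≤ 40) := fun w hw => (hA₂ w hw).1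
  have hsub : A₁ ∪ A₂ ⊆ S := by
    intro w hw
    rcases mem_union.1 hw with hw | hw
    · rcases (hA₁ w hw).2 with ⟨i, s, h⟩ | ⟨i, s, h⟩ | h <;> exact h ▸ hS _
    · rcases (hA₂ w hw).2 with ⟨i, s, h⟩ | ⟨i, s, h⟩ | h <;> exact h ▸ hS _
  have hsub' : insert (f (.inl (.inl (.inr ())), 0)) (A₁ ∪ A₂) ⊆ S := insert_subset (hS _) hsub
  refine ⟨L₁ ++ L₂, insert (f (.inl (.inl (.inr ())), 0)) (A₁ ∪ A₂), hsub', ?_, ?_, ?_, ?_⟩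
  · rw [List.length_append, hL₁, hL₂]
  · exact fun h => hu (hsub' h)
  · exact fun h => hv (hsub' h)
  · refine hF₁.trans hF₂.symm (disjoint_left.2 fun w hw hw' => ?_)
      (disjoint_left.2 fun w hw hw' => ?_)
    · have h1 : c w = 100 ∨ c w = 1 ∨ (10 ≤ c w ∧ c w ≤ 20) :=
        (mem_insert.1 hw).imp (fun h => (congrArg c h).trans hcu) (hr₁ w)
      have h2 : c w = 0 ∨ c w = 2 ∨ (30 ≤ c w ∧ c w ≤ 40) :=
        (mem_insert.1 hw').imp (fun h => (congrArg c h).trans hc0) (hr₂ w)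
      omega
    · have h1 : c w = 0 ∨ c w = 1 ∨ (10 ≤ c w ∧ c w ≤ 20) :=
        (mem_insert.1 hw).imp (fun h => (congrArg c h).trans hc0) (hr₁ w)
      have h2 : c w = 101 ∨ c w = 2 ∨ (30 ≤ c w ∧ c w ≤ 40) :=
        (mem_insert.1 hw').imp (fun h => (congrArg c h).trans hcv) (hr₂ w)
      omega

end

/-- Robustly many systems of paths can exchange two given vertices. -/
def Swaps {V : Type} [Fintype V] [DecidableEq V] (k ℓ : ℕ) (E : Finset (Finset V)) (c : ℝ)
    (m : ℕ) : Prop :=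
  ∀ u v : V, u ≠ v → Rob c m fun B => ∃ L A, A ⊆ B ∧ L.length = 4 ∧ u ∉ A ∧ v ∉ A ∧
    Flip k ℓ E L A u v

set_option synthInstance.maxSize 2000 in
lemma exists_swaps {k ℓ : ℕ} {θ : ℝ} (hk : 3 ≤ k) (hℓ : 1 ≤ ℓ) (hl : 2 * ℓ < k)
    (hθ : 0 < θ) (hθ1 : θ ≤ 1) (h3 : k = 3 → 7 / 16 ≤ θ) :
    ∃ c : ℝ, 0 < c ∧ ∃ m n₀ : ℕ, ∀ (V : Type) [Fintype V] [DecidableEq V] (E : Finset (Finset V)),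
      n₀ ≤ Fintype.card V → PairDense k θ E → Swaps k ℓ E c m := by
  obtain ⟨c₁, hc₁, hpat⟩ := exists_pattern_density hk hℓ hl hθ hθ1 h3
  set c₀ : ℝ := c₁ * c₁ * (1 / 5) * c₁ * c₁ with hc₀
  set c : ℝ := c₀ ^ (Fintype.card (Fin 3) ^ Fintype.card (SwapIdx k ℓ)) with hc
  have hc₀' : 0 < c₀ := by positivity
  have hc' : 0 < c := pow_pos hc₀' _
  obtain ⟨n₀, hn₀⟩ := exists_nat_ge ((Fintype.card (SwapIdx k ℓ × Fin 3) : ℝ) *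
    (Fintype.card (SwapIdx k ℓ × Fin 3) + (2 : ℕ) + 1) / (c / 4))
  refine ⟨c / 4, by linarith, Fintype.card (SwapIdx k ℓ × Fin 3), n₀ + 4 * k ^ 2, ?_⟩
  intro V _ _ E hn h u v huv
  have hk1 : 1 ≤ k ^ 2 := Nat.one_le_pow _ _ (by omega)
  have hV : 0 < Fintype.card V := by omega
  have hnr : (n₀ : ℝ) ≤ Fintype.card V := by exact_mod_cast (by omega)
  obtain ⟨hH, hL⟩ := hpat V E (by omega) h
  have d := Dens.blowup_injective (B := Fin 3) hc₀'.le (swapPattern_dens hc₁ hH hL u v) {u, v} (by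
    rw [card_pair huv]
    refine ((div_le_iff₀ (by linarith)).1 (hn₀.trans hnr)).trans_eq ?_
    rw [mul_comm]) hV
  refine d.rob_of_range fun f ⟨hf, hinj, hav⟩ S hS hS' => ?_
  have hnot : ∀ w ∈ ({u, v} : Finset V), w ∉ S := by
    intro w hw hw'
    obtain ⟨j, h⟩ := hS' w hw'
    exact hav j (h ▸ hw)
  exact exists_flip_of_swapPattern hl hℓ h.card_eq huv hinj hf hav hS (hnot u (by simp))
    (hnot v (by simp))

namespace Rob

lemma exists_avoid {c : ℝ} (hc : 0 < c) (m f : ℕ) : ∃ n₀ : ℕ, ∀ (V : Type) [Fintype V]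
    [DecidableEq V], n₀ ≤ Fintype.card V → ∀ (P : Finset V → Prop) (F : Finset V), #F ≤ f →
      Rob c m P → Rob (c / 2) m fun A => P A ∧ Disjoint A F := by
  obtain ⟨n₀, hn₀⟩ := exists_nat_ge ((m : ℝ) * f / (c / 2))
  refine ⟨n₀ + 1, fun V _ _ hn P F hF h => h.avoid F ?_ (by omega)⟩
  have hnr : (n₀ : ℝ) ≤ Fintype.card V := by exact_mod_cast (by omega)
  have hFr : (#F : ℝ) ≤ f := by exact_mod_cast hF
  have h1 := (div_le_iff₀ (by linarith)).1 (hn₀.trans hnr)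
  nlinarith [mul_le_mul_of_nonneg_left hFr (Nat.cast_nonneg (α := ℝ) m)]

variable {V : Type} [Fintype V] [DecidableEq V] {c d : ℝ} {m m' : ℕ} {P Q : Finset V → Prop}

lemma bind {P' : Finset V → Finset V → Prop} (h : Rob c m P) (hd : 0 ≤ d)
    (h' : ∀ A, P A → #A ≤ m → Rob d m' (P' A)) (hQ : ∀ A A', P A → P' A A' → Q (A ∪ A')) :
    Rob (c * d) (m + m') Q :=
  (h.comp hd h').mono fun _ ⟨A, A', hB, hA, hA'⟩ => hB ▸ hQ A A' hA hA'

end Rob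

/-- A system of paths inside `B` which can cover either of `P` and `Q`. -/
def Exchange {V : Type} [DecidableEq V] (k ℓ : ℕ) (E : Finset (Finset V)) (g : ℕ)
    (P Q B : Finset V) : Prop :=
  ∃ L A, A ⊆ B ∧ L.length = g ∧ Disjoint A (P ∪ Q) ∧ Sys k ℓ E L (P ∪ A) ∧ Sys k ℓ E L (Q ∪ A)

lemma exists_exchange {k ℓ : ℕ} {θ : ℝ} (hk : 3 ≤ k) (hℓ : 1 ≤ ℓ) (hl : 2 * ℓ < k)
    (hθ : 0 < θ) (hθ1 : θ ≤ 1) (h3 : k = 3 → 7 / 16 ≤ θ) (N : ℕ) :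
    ∃ c : ℝ, 0 < c ∧ ∃ m n₀ : ℕ, ∀ (V : Type) [Fintype V] [DecidableEq V] (E : Finset (Finset V)),
      n₀ ≤ Fintype.card V → PairDense k θ E → ∀ P Q : Finset V, #P = N → #Q = N → Disjoint P Q →
        Rob c m (Exchange k ℓ E (4 * N) P Q) := by
  obtain ⟨c₁, hc₁, m₁, n₁, hswap⟩ := exists_swaps hk hℓ hl hθ hθ1 h3
  induction N with
  | zero =>
    refine ⟨1, one_pos, 0, 0, fun V _ _ E _ _ P Q hP hQ _ => ?_⟩
    obtain rfl := card_eq_zero.1 hP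
    obtain rfl := card_eq_zero.1 hQ
    exact Dens.of_forall fun x => ⟨[], ∅, by simp, rfl, by simp, by simpa using Sys.nil,
      by simpa using Sys.nil⟩
  | succ N ih =>
    obtain ⟨c, hc, m, n₀, ih⟩ := ih
    obtain ⟨n₂, hn₂⟩ := Rob.exists_avoid hc m 2
    obtain ⟨n₃, hn₃⟩ := Rob.exists_avoid hc₁ m₁ (m + 2 * N)
    refine ⟨c / 2 * (c₁ / 2), by positivity, m + m₁, n₀ + n₁ + n₂ + n₃, ?_⟩
    intro V _ _ E hn h P' Q' hP' hQ' hd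
    obtain ⟨p, P, hp, rfl, hP⟩ := card_eq_succ.1 hP'
    obtain ⟨q, Q, hq, rfl, hQ⟩ := card_eq_succ.1 hQ'
    simp only [disjoint_insert_left, disjoint_insert_right, mem_insert, not_or] at hd
    have h1 := hn₂ V (by omega) _ {p, q} card_le_two
      (ih V E (by omega) h P Q hP hQ hd.2.2)
    refine h1.bind (by positivity) (fun A hA hAm => hn₃ V (by omega) _ (A ∪ (P ∪ Q)) ?_
      (hswap V E (by omega) h p q (Ne.symm hd.1.1))) ?_
    · have := card_union_le A (P ∪ Q)
      have := card_union_le P Q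
      omega
    · rintro B B' ⟨⟨L, A, hAB, hL, hA, hs, hs'⟩, hB⟩ ⟨⟨L', A', hAB', hL', hpA', hqA', hs₂⟩, hB'⟩
      have e : ∀ p : V, ∀ P : Finset V, insert p P ∪ (A ∪ A') = (P ∪ A) ∪ insert p A' := by
        intro p P
        ext v
        simp only [mem_union, mem_insert]
        tauto
      have hAA' : Disjoint A A' := (disjoint_of_subset_right hAB
        (disjoint_of_subset_left hAB' hB' |>.mono_right subset_union_left)).symm
      have hA'P : Disjoint (P ∪ Q) A' := ((disjoint_of_subset_left hAB' hB').mono_right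
        subset_union_right).symm
      have hpq : Disjoint A {p, q} := disjoint_of_subset_left hAB hB
      simp only [disjoint_insert_right, disjoint_singleton_right] at hpq
      simp only [disjoint_union_left, disjoint_union_right] at hA hA'P
      refine ⟨L ++ L', A ∪ A', union_subset_union hAB hAB', ?_, ?_, ?_, ?_⟩
      · rw [List.length_append, hL, hL']; omega
      · simp only [disjoint_union_left, disjoint_union_right, disjoint_insert_right, mem_union,
          not_or]
        exact ⟨⟨⟨hpq.1, hpA'⟩, hA.1, hA'P.1.symm⟩, ⟨hpq.2, hqA'⟩, hA.2, hA'P.2.symm⟩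
      · rw [e]
        refine hs.append hs₂.left ?_
        simp only [disjoint_union_left, disjoint_insert_right, mem_union, not_or]
        exact ⟨⟨hp, hpq.1⟩, hA'P.1, hAA'⟩
      · rw [e]
        refine hs'.append hs₂.right ?_
        simp only [disjoint_union_left, disjoint_insert_right, mem_union, not_or]
        exact ⟨⟨hq, hpq.2⟩, hA'P.2, hAA'⟩

/-- A system of paths inside `B` which can absorb the set `T`. -/
def Absorbs {V : Type} [DecidableEq V] (k ℓ : ℕ) (E : Finset (Finset V)) (g : ℕ)
    (T B : Finset V) : Prop :=
  ∃ L A, A ⊆ B ∧ L.length = g ∧ Disjoint A T ∧ Sys k ℓ E L A ∧ Sys k ℓ E L (A ∪ T)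

lemma Exchange.absorbs {V : Type} [DecidableEq V] {k ℓ g : ℕ} {E : Finset (Finset V)}
    {X I I' Y T B C : Finset V} (h : Exchange k ℓ E g I' (I ∪ T) B) (hC : Conn k ℓ E X I Y)
    (hC' : Conn k ℓ E X I' Y) (hT : Disjoint (X ∪ I ∪ Y) T) (hII' : Disjoint I' I)
    (hIT' : Disjoint I' T) (hB : X ∪ I ∪ Y ∪ I' ⊆ C) (hd : Disjoint B (C ∪ T)) :
    Absorbs k ℓ E (g + 1) T (C ∪ B) := by
  obtain ⟨L, D, hDA, hL, hD, hs, hs'⟩ := h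
  have d1 := hC.disjoint
  have d2 := hC'.disjoint
  have h6 := hd.mono hDA (union_subset_union hB subset_rfl)
  simp only [disjoint_union_left, disjoint_union_right] at hT h6
  obtain ⟨⟨⟨⟨h1, h2⟩, h3⟩, h4⟩, h5⟩ := h6
  refine ⟨(X, Y) :: L, X ∪ I ∪ Y ∪ (I' ∪ D), ?_, by simp [hL], ?_, ?_, ?_⟩
  · rw [← union_assoc]
    exact union_subset_union hB hDA
  · simp only [disjoint_union_left]
    exact ⟨hT, hIT', h5⟩
  · refine .cons hC hs ?_
    simp only [disjoint_union_left, disjoint_union_right]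
    exact ⟨⟨⟨d2.1, hII'.symm⟩, d2.2.2.symm⟩, ⟨h1.symm, h2.symm⟩, h3.symm⟩
  · have e : X ∪ I ∪ Y ∪ (I' ∪ D) ∪ T = X ∪ I' ∪ Y ∪ (I ∪ T ∪ D) := by
      ext v
      simp only [mem_union]
      tauto
    rw [e]
    refine .cons hC' hs' ?_
    simp only [disjoint_union_left, disjoint_union_right]
    exact ⟨⟨⟨⟨d1.1, hII'⟩, d1.2.2.symm⟩, ⟨hT.1.1, hIT'⟩, hT.2⟩, ⟨h1.symm, h4.symm⟩, h3.symm⟩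

lemma exists_joins_pair {k ℓ : ℕ} {θ : ℝ} (hk : 3 ≤ k) (hℓ : 1 ≤ ℓ) (hl : 2 * ℓ < k)
    (hθ : 0 < θ) (hθ1 : θ ≤ 1) (h3 : k = 3 → 7 / 16 ≤ θ) :
    ∃ c : ℝ, 0 < c ∧ ∃ m m' q n₀ : ℕ, ∀ (V : Type) [Fintype V] [DecidableEq V]
      (E : Finset (Finset V)), n₀ ≤ Fintype.card V → PairDense k θ E →
        Joins k ℓ E c m q ∧ Joins k ℓ E c m' (q + (k - ℓ)) := by
  obtain ⟨c, hc, m, q, n₀, h⟩ := exists_joins hk hℓ hl hθ hθ1 h3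
  have hc' : 0 < min c 1 := by positivity
  obtain ⟨n₁, hn₁⟩ := exists_nat_ge (16 * ((k : ℝ) + m) ^ 2 / (θ * min c 1))
  refine ⟨θ * min c 1 / 16, by positivity, m, k - ℓ + m, q, n₀ + n₁,
    fun V _ _ E hn hE => ?_⟩
  have h1 : Joins k ℓ E (min c 1) m q := fun X Y hX hY hXY =>
    (h V E (by omega) hE X Y hX hY hXY).mono_left (min_le_left _ _)
  have hnr : (n₁ : ℝ) ≤ Fintype.card V := by exact_mod_cast (by omega)
  refine ⟨fun X Y hX hY hXY => (h1 X Y hX hY hXY).mono_left ?_,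
    h1.lengthen hl hk hθ hθ1 hE hc' (min_le_right _ _) ?_⟩
  · nlinarith
  · have := (div_le_iff₀ (by positivity)).1 (hn₁.trans hnr)
    linarith

lemma exists_absorbs {k ℓ : ℕ} {θ : ℝ} (hk : 3 ≤ k) (hℓ : 1 ≤ ℓ) (hl : 2 * ℓ < k)
    (hθ : 0 < θ) (hθ1 : θ ≤ 1) (h3 : k = 3 → 7 / 16 ≤ θ) :
    ∃ c : ℝ, 0 < c ∧ ∃ m g n₀ : ℕ, ∀ (V : Type) [Fintype V] [DecidableEq V]
      (E : Finset (Finset V)), n₀ ≤ Fintype.card V → PairDense k θ E → ∀ T : Finset V,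
        #T = k - ℓ → Rob c m (Absorbs k ℓ E g T) := by
  obtain ⟨c, hc, m, m', q, n₀, hJ⟩ := exists_joins_pair hk hℓ hl hθ hθ1 h3
  obtain ⟨d, hd, s, n₁, hX⟩ := exists_exchange hk hℓ hl hθ hθ1 h3 (q + (k - ℓ))
  obtain ⟨n₂, hn₂⟩ := Rob.exists_avoid (c := 1 / 2) (by norm_num) (2 * ℓ) (k - ℓ)
  obtain ⟨n₃, hn₃⟩ := Rob.exists_avoid hc m (2 * ℓ + (k - ℓ))
  obtain ⟨n₄, hn₄⟩ := Rob.exists_avoid hc m' (2 * ℓ + m + (k - ℓ))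
  obtain ⟨n₅, hn₅⟩ := Rob.exists_avoid hd s (2 * ℓ + m + m' + (k - ℓ))
  refine ⟨1 / 2 / 2 * (c / 2) * (c / 2) * (d / 2), by positivity, 2 * ℓ + m + m' + s,
    4 * (q + (k - ℓ)) + 1, n₀ + n₁ + n₂ + n₃ + n₄ + n₅ + 2 * (2 * ℓ) ^ 2 + 1, ?_⟩
  intro V _ _ E hn h T hT
  have hn' : 2 * ((2 * ℓ : ℕ) : ℝ) ^ 2 ≤ Fintype.card V := by exact_mod_cast (by omega)
  obtain ⟨hJ, hJ'⟩ := hJ V E (by omega) h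
  have h1 := hn₂ V (by omega) _ T hT.le (Rob.free (by linarith) (by omega))
  have h2 : Rob (1 / 2 / 2 * (c / 2)) (2 * ℓ + m) (fun B => ∃ X I Y, X ∪ I ∪ Y ⊆ B ∧
      Conn k ℓ E X I Y ∧ #I = q ∧ Disjoint (X ∪ I ∪ Y) T) := by
    refine h1.bind (P' := fun A A' => ∃ X I Y, X ∪ Y ⊆ A ∧ I ⊆ A' ∧ Conn k ℓ E X I Y ∧ #I = q ∧
      Disjoint (X ∪ I ∪ Y) T) (by positivity) (fun A hA _ => ?_) ?_
    · obtain ⟨X, hXA, hX⟩ := exists_subset_card_eq (s := A) (n := ℓ) (by omega)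
      have hY : #(A \ X) = ℓ := by rw [card_sdiff_of_subset hXA]; omega
      refine (hn₃ V (by omega) _ (A ∪ T) ((card_union_le _ _).trans (by omega))
        (hJ X (A \ X) hX hY disjoint_sdiff)).mono ?_
      rintro A' ⟨⟨I, hI, hC, hq⟩, hA'⟩
      refine ⟨X, I, A \ X, union_subset hXA sdiff_subset, hI, hC, hq, ?_⟩
      rw [disjoint_union_left, disjoint_union_left]
      exact ⟨⟨hA.2.mono_left hXA, hA'.mono hI subset_union_right⟩,
        hA.2.mono_left sdiff_subset⟩
    · rintro A A' - ⟨X, I, Y, hXY, hI, hC⟩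
      refine ⟨X, I, Y, ?_, hC⟩
      grind
  have h3 : Rob (1 / 2 / 2 * (c / 2) * (c / 2)) (2 * ℓ + m + m') (fun B => ∃ X I Y I',
      X ∪ I ∪ Y ∪ I' ⊆ B ∧ Conn k ℓ E X I Y ∧ #I = q ∧ Disjoint (X ∪ I ∪ Y) T ∧
      Conn k ℓ E X I' Y ∧ #I' = q + (k - ℓ) ∧ Disjoint I' I ∧ Disjoint I' T) := by
    refine h2.bind (P' := fun A A' => ∃ X I Y I', X ∪ I ∪ Y ⊆ A ∧ I' ⊆ A' ∧ Conn k ℓ E X I Y ∧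
      #I = q ∧ Disjoint (X ∪ I ∪ Y) T ∧ Conn k ℓ E X I' Y ∧ #I' = q + (k - ℓ) ∧ Disjoint I' I ∧
      Disjoint I' T) (by positivity) ?_ ?_
    · rintro A ⟨X, I, Y, hA, hC, hI, hT'⟩ hAm
      refine (hn₄ V (by omega) _ (A ∪ T) ((card_union_le _ _).trans (by omega))
        (hJ' X Y hC.card_left hC.card_right hC.disjoint.2.1)).mono ?_
      rintro A' ⟨⟨I', hI', hC', hq⟩, hA'⟩
      have hIA : I ⊆ A := by grind
      exact ⟨X, I, Y, I', hA, hI', hC, hI, hT', hC', hq,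
        hA'.mono hI' (hIA.trans subset_union_left), hA'.mono hI' subset_union_right⟩
    · rintro A A' - ⟨X, I, Y, I', hXY, hI, hC⟩
      refine ⟨X, I, Y, I', ?_, hC⟩
      exact union_subset_union hXY hI
  refine h3.bind (P' := fun A A' => ∃ X I Y I', X ∪ I ∪ Y ∪ I' ⊆ A ∧ Conn k ℓ E X I Y ∧ #I = q ∧
      Disjoint (X ∪ I ∪ Y) T ∧ Conn k ℓ E X I' Y ∧ #I' = q + (k - ℓ) ∧ Disjoint I' I ∧
      Disjoint I' T ∧ Exchange k ℓ E (4 * (q + (k - ℓ))) I' (I ∪ T) A' ∧ Disjoint A' (A ∪ T))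
      (by positivity) ?_ ?_
  · rintro A ⟨X, I, Y, I', hA, hC, hI, hT', hC', hI', hII', hIT'⟩ hAm
    refine (hn₅ V (by omega) _ (A ∪ T) ((card_union_le _ _).trans (by omega))
        (hX V E (by omega) h I' (I ∪ T) hI' ?_ ?_)).mono ?_
    · rw [card_union_of_disjoint, hI, hT]
      simp only [disjoint_union_left] at hT'
      exact hT'.1.2
    · rw [disjoint_union_right]
      exact ⟨hII', hIT'⟩
    · rintro A' ⟨h4, h5⟩
      exact ⟨X, I, Y, I', hA, hC, hI, hT', hC', hI', hII', hIT', h4, h5⟩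
  · rintro A A' - ⟨X, I, Y, I', hA, hC, hI, hT', hC', hI', hII', hIT', h4, h5⟩
    exact h4.absorbs hC hC' hT' hII' hIT' hA h5

section
variable {ι Ω : Type} [Fintype ι] [DecidableEq ι] [Fintype Ω]

/-- Resampling one coordinate. -/
lemma sum_sum_update (i : ι) (g : (ι → Ω) → ℝ) :
    ∑ f, ∑ a, g (Function.update f i a) = Fintype.card Ω * ∑ f, g f := by
  have h1 : ∑ p : (ι → Ω) × Ω, g (Function.update p.1 i p.2) = ∑ p : (ι → Ω) × Ω, g p.1 := by
    refine sum_nbij' (fun p => (Function.update p.1 i p.2, p.1 i))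
      (fun p => (Function.update p.1 i p.2, p.1 i)) (by simp) (by simp) ?_ ?_ (by simp)
    all_goals
      rintro ⟨f, a⟩ -
      simp
  rw [Fintype.sum_prod_type, Fintype.sum_prod_type] at h1
  rw [h1, mul_sum]
  simp

/-- A random selection of elements, with few conflicts, which meets every one of many dense
sets often. -/
lemma exists_sparse_family {τ : Type} [Fintype τ] [Nonempty Ω] {c κ : ℝ} {s : ℕ} (hc : 0 < c)
    (hs : 0 < s) (C : Ω → Ω → Prop) (hrefl : ∀ ω, C ω ω)
    [DecidableRel C] (hκ : ∀ ω, (#{ω' | C ω ω'} : ℝ) ≤ κ * Fintype.card Ω) (hsκ : s * κ ≤ c / 16)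
    (A : τ → Ω → Prop) [∀ t, DecidablePred (A t)] (hA : ∀ t, Dens c (A t))
    (hτ : Fintype.card τ * Real.exp (- (c * s / 4)) < 1 / 2) :
    ∃ F : Finset Ω, #F ≤ s ∧ (∀ ω ∈ F, ∀ ω' ∈ F, ω ≠ ω' → ¬ C ω ω') ∧
      ∀ t, c * s / 8 ≤ #{ω ∈ F | A t ω} := by
  classical
  set N : ℝ := (Fintype.card Ω : ℝ) with hN
  have hN0 : 0 < N := Nat.cast_pos.2 Fintype.card_pos
  have hs' : (0 : ℝ) < s := by exact_mod_cast hs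
  let X (t : τ) (f : Fin s → Ω) : ℕ := #{i | A t (f i)}
  let K (f : Fin s → Ω) : ℕ := #{p : Fin s × Fin s | p.1 ≠ p.2 ∧ C (f p.1) (f p.2)}
  have hX : ∀ t, ∑ f, (1 / 2 : ℝ) ^ X t f ≤ N ^ s * Real.exp (- (c * s / 2)) := by
    intro t
    have h1 : ∀ f, (1 / 2 : ℝ) ^ X t f = ∏ i, if A t (f i) then (1 / 2 : ℝ) else 1 := by
      intro f
      rw [prod_ite, prod_const, prod_const_one, mul_one]
    simp only [h1]
    rw [← Fintype.sum_pow (fun ω => if A t ω then (1 / 2 : ℝ) else 1)]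
    have h2 : ∑ ω, (if A t ω then (1 / 2 : ℝ) else 1) ≤ N * Real.exp (-(c / 2)) := by
      have h3 : ∑ ω, (if A t ω then (1 / 2 : ℝ) else 1) = N - 1 / 2 * #{ω | A t ω} := by
        have : ∀ ω, (if A t ω then (1 / 2 : ℝ) else 1) = 1 - 1 / 2 * if A t ω then 1 else 0 := by
          intro ω
          split_ifs <;> norm_num
        simp only [this]
        rw [sum_sub_distrib, ← mul_sum, sum_boole]
        simp [hN]
      have h4 := dens_iff.1 (hA t)
      have h5 := Real.add_one_le_exp (-(c / 2))
      rw [h3]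
      nlinarith
    calc _ ≤ (N * Real.exp (-(c / 2))) ^ s :=
          pow_le_pow_left₀ (sum_nonneg fun ω _ => by split_ifs <;> norm_num) h2 s
      _ = _ := by
          rw [mul_pow, ← Real.exp_nat_mul]
          congr 2
          ring
  have hK : ∑ f, (K f : ℝ) ≤ s ^ 2 * κ * N ^ s := by
    have h1 : ∀ f, (K f : ℝ) = ∑ p : Fin s × Fin s, if p.1 ≠ p.2 ∧ C (f p.1) (f p.2) then 1 else 0 :=
      fun f => by rw [sum_boole]
    simp only [h1]
    rw [sum_comm]
    have h2 : ∀ p : Fin s × Fin s, ∑ f : Fin s → Ω,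
        (if p.1 ≠ p.2 ∧ C (f p.1) (f p.2) then (1 : ℝ) else 0) ≤ κ * N ^ s := by
      rintro ⟨i, j⟩
      have hκ0 : 0 ≤ κ := by
        obtain ⟨ω⟩ := ‹Nonempty Ω›
        by_contra h
        have := hκ ω
        have h3 : (0 : ℝ) ≤ #{ω' | C ω ω'} := Nat.cast_nonneg _
        nlinarith
      by_cases hij : i = j
      · simp only [hij, ne_eq, not_true_eq_false, false_and, if_false, sum_const_zero]
        positivity
      · have h3 := sum_sum_update (Ω := Ω) j
          (fun f : Fin s → Ω => if i ≠ j ∧ C (f i) (f j) then (1 : ℝ) else 0)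
        have h4 : ∀ f : Fin s → Ω, ∑ a, (if i ≠ j ∧ C (Function.update f j a i)
            (Function.update f j a j) then (1 : ℝ) else 0) ≤ κ * N := by
          intro f
          rw [sum_boole]
          simpa [hij] using hκ (f i)
        have h5 := (sum_le_sum fun f (_ : f ∈ univ) => h4 f)
        rw [h3, sum_const, card_univ, Fintype.card_fun, Fintype.card_fin, nsmul_eq_mul] at h5
        push_cast at h5
        rw [← hN] at h5
        have h6 : N * ∑ f : Fin s → Ω, (if i ≠ j ∧ C (f i) (f j) then (1 : ℝ) else 0) ≤
            N * (κ * N ^ s) := by linarith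
        exact le_of_mul_le_mul_left h6 hN0
    refine (sum_le_sum fun p _ => h2 p).trans_eq ?_
    simp only [sum_const, card_univ, Fintype.card_prod, Fintype.card_fin, nsmul_eq_mul]
    push_cast
    ring
  have hW : ∃ f : Fin s → Ω, ∑ t, Real.exp (c * s / 4) * (1 / 2 : ℝ) ^ X t f + K f * (8 / (c * s))
      < 1 := by
    by_contra! h
    have h1 := sum_le_sum fun f (_ : f ∈ univ) => h f
    rw [sum_const, card_univ, Fintype.card_fun, Fintype.card_fin, sum_add_distrib, sum_comm,
      ← sum_mul, nsmul_eq_mul, mul_one] at h1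
    simp only [← mul_sum] at h1
    push_cast at h1
    rw [← hN] at h1
    have hNs : 0 < N ^ s := by positivity
    have h2 : ∑ t, Real.exp (c * s / 4) * ∑ f, (1 / 2 : ℝ) ^ X t f ≤
        Fintype.card τ * Real.exp (-(c * s / 4)) * N ^ s := by
      have : ∀ t ∈ (univ : Finset τ), Real.exp (c * s / 4) * ∑ f, (1 / 2 : ℝ) ^ X t f ≤
          Real.exp (-(c * s / 4)) * N ^ s := by
        intro t _
        refine (mul_le_mul_of_nonneg_left (hX t) (Real.exp_pos _).le).trans_eq ?_
        rw [mul_left_comm, ← Real.exp_add, mul_comm]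
        congr 2
        ring
      refine (sum_le_sum this).trans_eq ?_
      rw [sum_const, card_univ, nsmul_eq_mul, mul_assoc]
    have h3 : (∑ f, (K f : ℝ)) * (8 / (c * s)) ≤ 1 / 2 * N ^ s := by
      refine (mul_le_mul_of_nonneg_right hK (by positivity)).trans ?_
      have : (s : ℝ) ^ 2 * κ * N ^ s * (8 / (c * s)) = (s * κ) * (8 / c) * N ^ s := by
        field_simp
      rw [this]
      refine mul_le_mul_of_nonneg_right ?_ hNs.le
      calc s * κ * (8 / c) ≤ c / 16 * (8 / c) := by gcongr
        _ = 1 / 2 := by field_simp; norm_num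
    have h4 := mul_lt_mul_of_pos_right hτ hNs
    rw [← mul_sum] at h2
    linarith
  obtain ⟨f, hf⟩ := hW
  have hKf : (K f : ℝ) ≤ c * s / 8 := by
    have h1 : (K f : ℝ) * (8 / (c * s)) ≤ 1 := by
      have : 0 ≤ ∑ t, Real.exp (c * s / 4) * (1 / 2 : ℝ) ^ X t f :=
        sum_nonneg fun t _ => by positivity
      linarith
    rw [mul_div_assoc', div_le_one (by positivity)] at h1
    linarith
  have hXf : ∀ t, c * s / 4 ≤ X t f := by
    intro t
    have h1 : Real.exp (c * s / 4) * (1 / 2 : ℝ) ^ X t f ≤ 1 := by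
      have h2 := single_le_sum (f := fun t => Real.exp (c * s / 4) * (1 / 2 : ℝ) ^ X t f)
        (fun t _ => by positivity) (mem_univ t)
      have h3 : 0 ≤ (K f : ℝ) * (8 / (c * s)) := by positivity
      linarith
    have h2 : (1 / 2 : ℝ) ^ X t f = (2 ^ X t f)⁻¹ := by rw [one_div, inv_pow]
    rw [h2, ← div_eq_mul_inv, div_le_one (by positivity)] at h1
    have h3 : (2 : ℝ) ^ X t f ≤ Real.exp (X t f) := by
      have := Real.add_one_le_exp (1 : ℝ)
      calc (2 : ℝ) ^ X t f ≤ (Real.exp 1) ^ X t f := by gcongr; linarith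
        _ = _ := by rw [← Real.exp_nat_mul, mul_one]
    exact Real.exp_le_exp.1 (h1.trans h3)
  let I : Finset (Fin s) := {i | ∀ j, i ≠ j → ¬ C (f i) (f j)}
  have hI : #Iᶜ ≤ K f := by
    have h1 : Iᶜ ⊆ image Prod.fst {p : Fin s × Fin s | p.1 ≠ p.2 ∧ C (f p.1) (f p.2)} := by
      intro i hi
      simp only [I, mem_compl, mem_filter, mem_univ, true_and, not_forall, not_not] at hi
      obtain ⟨j, hj, h⟩ := hi
      exact mem_image.2 ⟨(i, j), by simp [hj, h], rfl⟩
    exact (card_le_card h1).trans card_image_le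
  have hinj : Set.InjOn f I := by
    intro i hi j _ hij
    by_contra hne
    refine (mem_filter.1 hi).2 j hne ?_
    rw [hij]
    exact hrefl _
  refine ⟨I.image f, card_image_le.trans ((card_le_univ _).trans (by simp)), ?_, fun t => ?_⟩
  · intro ω hω ω' hω' hne
    obtain ⟨i, hi, rfl⟩ := mem_image.1 hω
    obtain ⟨j, -, rfl⟩ := mem_image.1 hω'
    exact (mem_filter.1 hi).2 j fun h => hne (h ▸ rfl)
  · have h1 : #{ω ∈ I.image f | A t ω} = #{i ∈ I | A t (f i)} := by
      rw [filter_image, card_image_of_injOn]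
      exact hinj.mono (coe_subset.2 (filter_subset _ _))
    have h2 : X t f ≤ #{i ∈ I | A t (f i)} + #Iᶜ := by
      refine (card_le_card (t := {i ∈ I | A t (f i)} ∪ Iᶜ) ?_).trans (card_union_le _ _)
      intro i
      simp only [mem_filter, mem_univ, true_and, mem_union, mem_compl]
      tauto
    have h3 : (X t f : ℝ) ≤ #{i ∈ I | A t (f i)} + K f := by exact_mod_cast h2.trans (by omega)
    rw [h1]
    have := hXf t
    linarith

end

lemma eventually_pow_mul_exp_lt (j : ℕ) {b : ℝ} (hb : 0 < b) :
    ∃ n₀ : ℕ, ∀ n : ℕ, n₀ ≤ n → (n : ℝ) ^ j * Real.exp (-(b * n)) < 1 / 2 := by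
  have h1 := (tendsto_rpow_mul_exp_neg_mul_atTop_nhds_zero j b hb).comp
    tendsto_natCast_atTop_atTop
  have h2 := h1.eventually (gt_mem_nhds (show (0 : ℝ) < 1 / 2 by norm_num))
  obtain ⟨n₀, hn₀⟩ := Filter.eventually_atTop.1 h2
  refine ⟨n₀, fun n hn => ?_⟩
  have := hn₀ n hn
  simpa [Real.rpow_natCast] using this

/-- Passing from an existential quantifier over a finite type to an additional coordinate. -/
lemma Dens.choice {S Ω : Type} [Fintype S] [Nonempty S] [Fintype Ω] {c : ℝ} {P : S → Ω → Prop}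
    (h : Dens c fun ω => ∃ s, P s ω) :
    Dens (c / Fintype.card S) fun p : S × Ω => P p.1 p.2 := by
  classical
  rw [dens_iff] at h ⊢
  have hS : (0 : ℝ) < Fintype.card S := Nat.cast_pos.2 Fintype.card_pos
  rw [Fintype.card_prod, Nat.cast_mul, ← mul_assoc, div_mul_cancel₀ _ hS.ne']
  refine h.trans ?_
  have h1 : ({ω | ∃ s, P s ω} : Finset Ω) ⊆ image Prod.snd {p : S × Ω | P p.1 p.2} := by
    intro ω hω
    obtain ⟨s, hs⟩ := (mem_filter.1 hω).2
    exact mem_image.2 ⟨(s, ω), by simpa using hs, rfl⟩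
  exact_mod_cast (card_le_card h1).trans card_image_le

lemma card_not_disjoint_le {V : Type} [Fintype V] [DecidableEq V] (m : ℕ) (F : Finset V) :
    Fintype.card V * #{x : Fin m → V | ¬ Disjoint F (univ.image x)} ≤
      m * (#F * Fintype.card (Fin m → V)) := by
  have h1 : ({x : Fin m → V | ¬ Disjoint F (univ.image x)} : Finset (Fin m → V)) ⊆
      univ.biUnion fun i => {x | x i ∈ F} := by
    intro x hx
    obtain ⟨v, hv, hv'⟩ := not_disjoint_iff.1 (mem_filter.1 hx).2
    obtain ⟨i, -, rfl⟩ := mem_image.1 hv'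
    exact mem_biUnion.2 ⟨i, mem_univ _, by simpa using hv⟩
  calc _ ≤ Fintype.card V * ∑ i : Fin m, #{x : Fin m → V | x i ∈ F} :=
        Nat.mul_le_mul_left _ ((card_le_card h1).trans card_biUnion_le)
    _ = ∑ i : Fin m, Fintype.card V * #{x : Fin m → V | x i ∈ F} := mul_sum _ _ _
    _ ≤ ∑ _i : Fin m, #F * Fintype.card (Fin m → V) :=
        sum_le_sum fun i _ => card_filter_apply_mem i F
    _ = _ := by simp

/-- Many pairwise disjoint tuples, which meet every one of polynomially many dense sets of
tuples often. -/
lemma exists_disjoint_family {S : Type} [Fintype S] [Nonempty S] (j : ℕ) {m : ℕ} (hm : 0 < m)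
    {c β : ℝ} (hc : 0 < c) (hβ : 0 < β) (hβc : β * m ^ 2 ≤ c / 16) :
    ∃ n₀ : ℕ, ∀ (V : Type) [Fintype V] [DecidableEq V], n₀ ≤ Fintype.card V →
      ∀ (τ : Type) [Fintype τ], Fintype.card τ ≤ Fintype.card V ^ j →
      ∀ A : τ → S × (Fin m → V) → Prop, (∀ t, Dens c (A t)) →
        ∃ F : Finset (S × (Fin m → V)), (#F : ℝ) ≤ β * Fintype.card V ∧
          (∀ ω ∈ F, ∀ ω' ∈ F, ω ≠ ω' → Disjoint (univ.image ω.2) (univ.image ω'.2)) ∧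
          ∀ t, ∃ G ⊆ F, (∀ ω ∈ G, A t ω) ∧ c * β / 16 * Fintype.card V ≤ #G := by
  classical
  obtain ⟨n₁, hn₁⟩ := eventually_pow_mul_exp_lt j (b := c * β / 8) (by positivity)
  obtain ⟨n₂, hn₂⟩ := exists_nat_ge (2 / β)
  refine ⟨n₁ + n₂ + 1, fun V _ _ hn τ _ hτ A hA => ?_⟩
  set n : ℝ := (Fintype.card V : ℝ) with hnd
  have hn0 : 0 < n := by rw [hnd]; exact_mod_cast (by omega)
  have : Nonempty V := Fintype.card_pos_iff.1 (by omega)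
  have h2 : 2 ≤ n * β := (div_le_iff₀ hβ).1 (hn₂.trans (by rw [hnd]; exact_mod_cast (by omega)))
  set s := ⌊β * n⌋₊ with hs
  have hs1 : (s : ℝ) ≤ β * n := Nat.floor_le (by positivity)
  have hs2 : β * n - 1 < s := Nat.sub_one_lt_floor _
  have hs3 : β * n / 2 ≤ s := by linarith
  obtain ⟨F, hF, hd, hG⟩ := exists_sparse_family (Ω := S × (Fin m → V)) (τ := τ) (s := s) (c := c)
    (κ := m ^ 2 / n) hc (by
      have : (0 : ℝ) < s := by nlinarith
      exact_mod_cast this)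
    (fun ω ω' => ¬ Disjoint (univ.image ω.2) (univ.image ω'.2)) (fun ω => by
      have : Nonempty (Fin m) := ⟨⟨0, hm⟩⟩
      simpa using univ_nonempty.ne_empty) (fun ω => by
      have h3 := card_not_disjoint_le m (univ.image ω.2)
      have h4 : #(univ.image ω.2) ≤ m := card_image_le.trans (by simp)
      have h5 : ({ω' : S × (Fin m → V) | ¬ Disjoint (univ.image ω.2) (univ.image ω'.2)} :
          Finset _) = univ ×ˢ ({x | ¬ Disjoint (univ.image ω.2) (univ.image x)} : Finset _) := by
        ext
        simp
      have h6 : Fintype.card V * #{x : Fin m → V | ¬ Disjoint (univ.image ω.2) (univ.image x)} ≤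
          m ^ 2 * Fintype.card (Fin m → V) :=
        h3.trans ((Nat.mul_le_mul_left _ (Nat.mul_le_mul_right _ h4)).trans_eq (by ring))
      have h7 : n * (#{x : Fin m → V | ¬ Disjoint (univ.image ω.2) (univ.image x)} : ℝ) ≤
          m ^ 2 * Fintype.card (Fin m → V) := by rw [hnd]; exact_mod_cast h6
      rw [h5, card_product, card_univ, Fintype.card_prod, div_mul_eq_mul_div, le_div_iff₀ hn0]
      push_cast at h7 ⊢
      nlinarith [Nat.cast_nonneg (α := ℝ) (Fintype.card S)])
    (by
      rw [mul_div_assoc', div_le_iff₀ hn0]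
      nlinarith [sq_nonneg (m : ℝ)]) A hA (by
      refine lt_of_le_of_lt ?_ (hn₁ (Fintype.card V) (by omega))
      have h3 : (Fintype.card τ : ℝ) ≤ n ^ j := by rw [hnd]; exact_mod_cast hτ
      gcongr
      rw [← hnd]
      nlinarith)
  refine ⟨F, (Nat.cast_le.2 hF).trans hs1, fun ω hω ω' hω' hne => not_not.1 (hd ω hω ω' hω' hne),
    fun t => ⟨F.filter (A t), filter_subset _ _, fun ω hω => (mem_filter.1 hω).2, ?_⟩⟩
  refine le_trans ?_ (hG t)
  nlinarith

lemma card_coe_powersetCard_le {V : Type} [Fintype V] (r : ℕ) :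
    Fintype.card (powersetCard r (univ : Finset V)) ≤ Fintype.card V ^ r := by
  rw [Fintype.card_coe, card_powersetCard, card_univ]
  have := Nat.choose_le_pow_div (α := ℝ) r (Fintype.card V)
  have h1 : (1 : ℝ) ≤ r.factorial := by exact_mod_cast Nat.factorial_pos r
  have h2 : ((Fintype.card V).choose r : ℝ) ≤ (Fintype.card V : ℝ) ^ r :=
    this.trans (div_le_self (by positivity) h1)
  exact_mod_cast h2

lemma Rob.succ {V : Type} [Fintype V] [DecidableEq V] {c : ℝ} {m : ℕ} {P : Finset V → Prop}
    (h : Rob c m P) (hP : ∀ A B, A ⊆ B → P A → P B) : Rob c (m + 1) P := by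
  have := h.bind (P' := fun _ _ => True) (m' := 1) (Q := P) zero_le_one
    (fun _ _ _ => Dens.of_forall fun _ => trivial) fun A A' hA _ => hP _ _ subset_union_left hA
  rwa [mul_one] at this

lemma Joins.flex_univ {V : Type} [Fintype V] [DecidableEq V] {k ℓ m q N : ℕ}
    {E : Finset (Finset V)} {c : ℝ} (hc : 0 < c) (hV : 0 < Fintype.card V)
    (hN : (m : ℝ) * N ≤ c / 2 * Fintype.card V) (h : Joins k ℓ E c m q) :
    Flex k ℓ E univ m N := by
  intro X Y F hX hY hXY hF
  have h1 := (h X Y hX hY hXY).avoid F (le_trans (by gcongr) hN) hV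
  obtain ⟨A, ⟨⟨I, hI, hC, -⟩, hAF⟩, hm⟩ := h1.exists_set (by positivity) hV
  exact ⟨I, subset_univ _, hC, hAF.mono_left hI, (card_le_card hI).trans hm⟩

/-- A small reservoir of connecting vertices. -/
lemma exists_reservoir {k ℓ : ℕ} {θ : ℝ} (hk : 3 ≤ k) (hℓ : 1 ≤ ℓ) (hl : 2 * ℓ < k)
    (hθ : 0 < θ) (hθ1 : θ ≤ 1) (h3 : k = 3 → 7 / 16 ≤ θ) :
    ∃ c : ℝ, 0 < c ∧ ∃ m : ℕ, ∀ β : ℝ, 0 < β → β ≤ c → ∃ n₀ : ℕ,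
      ∀ (V : Type) [Fintype V] [DecidableEq V] (E : Finset (Finset V)), n₀ ≤ Fintype.card V →
      PairDense k θ E → ∀ P : Finset V, (#P : ℝ) ≤ c * Fintype.card V → ∀ N : ℕ,
      N ≤ c * β * Fintype.card V →
        ∃ R, Disjoint R P ∧ (#R : ℝ) ≤ β * Fintype.card V ∧ Flex k ℓ E R m N := by
  obtain ⟨c, hc, m, q, n₁, hJ⟩ := exists_joins hk hℓ hl hθ hθ1 h3
  have hm : (0 : ℝ) < (m + 1 : ℕ) := by positivity
  refine ⟨min (c / 2 / (m + 1 : ℕ)) (min (c / 2 / 16 / (m + 1 : ℕ)) (c / 2 / 16 / (m + 1 : ℕ) / 2)),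
    by positivity, m + 1, fun β hβ hβc => ?_⟩
  have hβc1 := (le_div_iff₀ hm).1 (hβc.trans ((min_le_right _ _).trans (min_le_left _ _)))
  obtain ⟨n₂, hn₂⟩ := exists_disjoint_family (S := Unit) (ℓ + ℓ) (m := m + 1) (Nat.succ_pos m)
    (c := c / 2) (β := β / (m + 1 : ℕ)) (by positivity) (by positivity) (by
      rw [div_mul_eq_mul_div, sq, ← mul_assoc, mul_div_assoc, div_self hm.ne', mul_one]
      exact hβc1)
  refine ⟨n₁ + n₂ + 1, fun V _ _ E hn h P hP N hN => ?_⟩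
  have hn0 : (0 : ℝ) < Fintype.card V := by exact_mod_cast (by omega)
  have hJ := hJ V E (by omega) h
  have hP1 : ((m + 1 : ℕ) : ℝ) * #P ≤ c / 2 * Fintype.card V := by
    have := hP.trans (mul_le_mul_of_nonneg_right (min_le_left _ _) hn0.le)
    rw [div_mul_eq_mul_div, le_div_iff₀ hm] at this
    linarith
  have hA : ∀ X Y : Finset V, #X = ℓ → #Y = ℓ → Disjoint X Y →
      Dens (c / 2) fun ω : Unit × (Fin (m + 1) → V) =>
        (∃ I ⊆ univ.image ω.2, Conn k ℓ E X I Y) ∧ Disjoint (univ.image ω.2) P := by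
    intro X Y hX hY hXY
    have h1 : Rob c (m + 1) fun A => ∃ I ⊆ A, Conn k ℓ E X I Y :=
      ((hJ X Y hX hY hXY).mono fun A ⟨I, hI, hC, _⟩ => ⟨I, hI, hC⟩).succ
        fun A B hAB ⟨I, hI, hC⟩ => ⟨I, hI.trans hAB, hC⟩
    exact (h1.avoid P hP1 (by omega)).equiv (Equiv.punitProd _)
  let τ : Type := {p : powersetCard ℓ (univ : Finset V) × powersetCard ℓ (univ : Finset V) //
    Disjoint p.1.1 p.2.1}
  have hτ : Fintype.card τ ≤ Fintype.card V ^ (ℓ + ℓ) := by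
    refine (Fintype.card_subtype_le _).trans ?_
    rw [Fintype.card_prod, pow_add]
    exact Nat.mul_le_mul (card_coe_powersetCard_le ℓ) (card_coe_powersetCard_le ℓ)
  obtain ⟨F, hF, hd, hG⟩ := hn₂ V (by omega) τ hτ
    (fun t ω => (∃ I ⊆ univ.image ω.2, Conn k ℓ E t.1.1.1 I t.1.2.1) ∧
      Disjoint (univ.image ω.2) P)
    (fun t => hA _ _ (mem_powersetCard.1 t.1.1.2).2 (mem_powersetCard.1 t.1.2.2).2 t.2)
  refine ⟨{ω ∈ F | Disjoint (univ.image ω.2) P}.biUnion fun ω => univ.image ω.2, ?_, ?_, ?_⟩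
  · rw [disjoint_biUnion_left]
    exact fun ω hω => (mem_filter.1 hω).2
  · have h1 : #({ω ∈ F | Disjoint (univ.image ω.2) P}.biUnion fun ω => univ.image ω.2) ≤
        #F * (m + 1) := by
      refine (card_biUnion_le_card_mul _ _ (m + 1) fun ω _ => card_image_le.trans (by simp)).trans ?_
      exact Nat.mul_le_mul_right _ (card_filter_le _ _)
    have h2 : (_ : ℝ) ≤ _ := Nat.cast_le.2 h1
    refine h2.trans ?_
    rw [Nat.cast_mul]
    rwa [div_mul_eq_mul_div, le_div_iff₀ hm] at hF
  · intro X Y F' hX hY hXY hF'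
    obtain ⟨G, hGF, hGA, hGc⟩ := hG ⟨(⟨X, mem_powersetCard.2 ⟨subset_univ _, hX⟩⟩,
      ⟨Y, mem_powersetCard.2 ⟨subset_univ _, hY⟩⟩), hXY⟩
    by_contra! hcon
    have h1 : ∀ ω ∈ G, ∃ v ∈ F', v ∈ univ.image ω.2 := by
      intro ω hω
      obtain ⟨⟨I, hI, hC⟩, hP⟩ := hGA ω hω
      by_contra! h2
      have h3 : Disjoint (univ.image ω.2) F' := disjoint_right.2 h2
      refine absurd ((card_le_card hI).trans (card_image_le.trans (by simp)))
        (hcon I (hI.trans ?_) hC (h3.mono_left hI)).not_ge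
      exact subset_biUnion_of_mem (fun ω : Unit × (Fin (m + 1) → V) => univ.image ω.2)
        (mem_filter.2 ⟨hGF hω, hP⟩)
    have : Nonempty V := Fintype.card_pos_iff.1 (by omega)
    choose! f hf hf' using h1
    have h2 : #G ≤ #F' := by
      refine card_le_card_of_injOn f hf fun ω hω ω' hω' he => ?_
      by_contra hne
      exact disjoint_left.1 (hd ω (hGF hω) ω' (hGF hω') hne) (hf' ω hω) (he ▸ hf' ω' hω')
    have h3 : (#G : ℝ) ≤ N := by exact_mod_cast h2.trans hF'
    have h4 := h3.trans hN
    have h5 : min (c / 2 / (m + 1 : ℕ))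
        (min (c / 2 / 16 / (m + 1 : ℕ)) (c / 2 / 16 / (m + 1 : ℕ) / 2)) * β * Fintype.card V ≤
        c / 2 / 16 / (m + 1 : ℕ) / 2 * β * Fintype.card V := by
      gcongr
      exact (min_le_right _ _).trans (min_le_right _ _)
    have h6 : 0 < c / 2 / 16 / (m + 1 : ℕ) * β * Fintype.card V := by positivity
    have h7 : c / 2 * (β / (m + 1 : ℕ)) / 16 * Fintype.card V =
        c / 2 / 16 / (m + 1 : ℕ) * β * Fintype.card V := by ring
    linarith

section
variable {V Ω : Type} [DecidableEq V] [DecidableEq Ω] {k ℓ r N : ℕ} {E : Finset (Finset V)}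

/-- Distributing a set among the members of a family of absorbing systems. -/
lemma exists_absorbing_assignment (F : Finset Ω) (L : Ω → List (Finset V × Finset V))
    (A : Ω → Finset V) (hS : ∀ ω ∈ F, Sys k ℓ E (L ω) (A ω))
    (hG : ∀ T : Finset V, #T = r → ∃ G ⊆ F, N ≤ #G ∧ ∀ ω ∈ G, Sys k ℓ E (L ω) (A ω ∪ T)) :
    ∀ t ≤ N, ∀ U : Finset V, #U = t * r → ∃ (a : Ω → Finset V) (D : Finset Ω), D ⊆ F ∧ #D ≤ t ∧
      (∀ ω ∈ F, Sys k ℓ E (L ω) (A ω ∪ a ω)) ∧ (∀ ω, a ω ⊆ U) ∧ (∀ ω, ω ∉ D → a ω = ∅) ∧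
      (∀ ω ω', ω ≠ ω' → Disjoint (a ω) (a ω')) ∧ D.biUnion a = U
  | 0, _, U, hU => by
    obtain rfl : U = ∅ := card_eq_zero.1 (by simpa using hU)
    exact ⟨fun _ => ∅, ∅, by simp, by simp, by simpa using hS, by simp, by simp, by simp, by simp⟩
  | t + 1, ht, U, hU => by
    obtain ⟨T, hTU, hT⟩ := exists_subset_card_eq (s := U) (n := r) (by rw [hU]; nlinarith)
    obtain ⟨a, D, hDF, hDt, hs, haU, haD, had, hU'⟩ := exists_absorbing_assignment F L A hS hG t
      (by omega) (U \ T) (by rw [card_sdiff_of_subset hTU, hU, hT, Nat.succ_mul]; omega)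
    obtain ⟨G, hGF, hGN, hG'⟩ := hG T hT
    obtain ⟨ω₀, hω₀⟩ : (G \ D).Nonempty := by
      rw [← card_pos]
      have := le_card_sdiff D G
      omega
    rw [mem_sdiff] at hω₀
    have hTa : ∀ ω, Disjoint T (a ω) := fun ω => disjoint_sdiff.mono_right (haU ω)
    refine ⟨Function.update a ω₀ T, insert ω₀ D, insert_subset (hGF hω₀.1) hDF,
      (card_insert_le _ _).trans (by omega), fun ω hω => ?_, fun ω => ?_, fun ω hω => ?_,
      fun ω ω' hne => ?_, ?_⟩
    · rcases eq_or_ne ω ω₀ with rfl | h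
      · simpa using hG' ω hω₀.1
      · simpa [h] using hs ω hω
    · rcases eq_or_ne ω ω₀ with rfl | h
      · simpa using hTU
      · simpa [h] using (haU ω).trans sdiff_subset
    · rw [mem_insert, not_or] at hω
      simpa [hω.1] using haD ω hω.2
    · rcases eq_or_ne ω ω₀ with rfl | h
      · simpa [hne.symm] using hTa ω'
      · rcases eq_or_ne ω' ω₀ with rfl | h'
        · simpa [h] using (hTa ω).symm
        · simpa [h, h'] using had ω ω' hne
    · rw [biUnion_insert, Function.update_self]
      have : D.biUnion (Function.update a ω₀ T) = D.biUnion a := by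
        refine biUnion_congr rfl fun ω hω => Function.update_of_ne ?_ _ _
        rintro rfl
        exact hω₀.2 hω
      rw [this, hU', union_sdiff_of_subset hTU]

end

section
variable {V : Type} [DecidableEq V] {k ℓ g M : ℕ} {E : Finset (Finset V)}

/-- Descriptions of systems of `g` pairs in terms of `M` slots. -/
abbrev Shape (g M : ℕ) : Type := (Fin g → Finset (Fin M) × Finset (Fin M)) × Finset (Fin M)

/-- The pairs of ends described by a shape and a tuple of vertices. -/
def shapeEnds (ω : Shape g M × (Fin M → V)) : List (Finset V × Finset V) :=
  List.ofFn fun i => ((ω.1.1 i).1.image ω.2, (ω.1.1 i).2.image ω.2)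

/-- The vertex set described by a shape and a tuple of vertices. -/
def shapeSet (ω : Shape g M × (Fin M → V)) : Finset V := ω.1.2.image ω.2

lemma shapeSet_subset (ω : Shape g M × (Fin M → V)) : shapeSet ω ⊆ univ.image ω.2 :=
  image_subset_image (subset_univ _)

lemma Sys.exists_shape {L : List (Finset V × Finset V)} {A : Finset V} (h : Sys k ℓ E L A)
    (hL : L.length = g) (x : Fin M → V) (hA : A ⊆ univ.image x) :
    ∃ s : Shape g M, shapeEnds (s, x) = L ∧ shapeSet (s, x) = A := by
  subst hL
  have h1 : ∀ B : Finset V, B ⊆ A → ({i | x i ∈ B} : Finset (Fin M)).image x = B := by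
    intro B hB
    ext v
    simp only [mem_image, mem_filter, mem_univ, true_and]
    refine ⟨?_, fun hv => ?_⟩
    · rintro ⟨i, hi, rfl⟩
      exact hi
    · obtain ⟨i, -, rfl⟩ := mem_image.1 (hA (hB hv))
      exact ⟨i, hv, rfl⟩
  refine ⟨(fun i => (({j | x j ∈ (L.get i).1} : Finset (Fin M)),
    ({j | x j ∈ (L.get i).2} : Finset (Fin M))), ({j | x j ∈ A} : Finset (Fin M))), ?_,
    h1 A subset_rfl⟩
  have h2 : ∀ i, (({j | x j ∈ (L.get i).1} : Finset (Fin M)).image x,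
      ({j | x j ∈ (L.get i).2} : Finset (Fin M)).image x) = L.get i := by
    intro i
    have := h.mem (List.get_mem L i)
    rw [h1 _ this.2.2.1, h1 _ this.2.2.2.1]
  simp only [shapeEnds, h2, List.ofFn_get]

end

/-- There is a short path which can absorb every small set of vertices. -/
lemma exists_absorbing_path {k ℓ : ℕ} {θ : ℝ} (hk : 3 ≤ k) (hℓ : 1 ≤ ℓ) (hl : 2 * ℓ < k)
    (hθ : 0 < θ) (hθ1 : θ ≤ 1) (h3 : k = 3 → 7 / 16 ≤ θ) :
    ∃ c : ℝ, 0 < c ∧ ∀ β : ℝ, 0 < β → β ≤ c → ∃ n₀ : ℕ,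
      ∀ (V : Type) [Fintype V] [DecidableEq V] (E : Finset (Finset V)), n₀ ≤ Fintype.card V →
      PairDense k θ E → ∃ X Y P : Finset V, (#P : ℝ) ≤ β * Fintype.card V ∧
        ∀ U : Finset V, Disjoint U P → (k - ℓ) ∣ #U → #U ≤ c * β * Fintype.card V →
          ∃ I, Conn k ℓ E X I Y ∧ X ∪ I ∪ Y = P ∪ U := by
  classical
  obtain ⟨cJ, hcJ, mJ, q, n₁, hJ⟩ := exists_joins hk hℓ hl hθ hθ1 h3
  obtain ⟨cA, hcA, m, g, n₂, hA⟩ := exists_absorbs hk hℓ hl hθ hθ1 h3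
  set M := m + 1 with hM
  have hM0 : (0 : ℝ) < M := by positivity
  set K : ℕ := M + mJ * g with hK
  have hK1 : (1 : ℝ) ≤ K := by exact_mod_cast (by omega)
  set c₁ : ℝ := cA / Fintype.card (Shape g M) with hc₁
  have hc₁0 : 0 < c₁ := div_pos hcA (Nat.cast_pos.2 Fintype.card_pos)
  refine ⟨min (cJ / 2 / (mJ + 1)) (min (c₁ / 16 / M ^ 2) (c₁ / 16 / K)), by positivity,
    fun β hβ hβc => ?_⟩
  have hβ1 := (le_div_iff₀ (by positivity)).1 (hβc.trans (min_le_left _ _))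
  have hβ2 := (le_div_iff₀ (by positivity)).1
    (hβc.trans ((min_le_right _ _).trans (min_le_left _ _)))
  have hβK : β / K ≤ β := div_le_self hβ.le hK1
  obtain ⟨n₃, hn₃⟩ := exists_disjoint_family (S := Shape g M) (k - ℓ) (m := M) (Nat.succ_pos m)
    (c := c₁) (β := β / K) hc₁0 (by positivity) (by nlinarith [sq_nonneg (M : ℝ)])
  refine ⟨n₁ + n₂ + n₃ + k + 1, fun V _ _ E hn h => ?_⟩
  have hn0 : (0 : ℝ) < Fintype.card V := by exact_mod_cast (by omega)
  have hJ := hJ V E (by omega) h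
  let Good (T : Finset V) (ω : Shape g M × (Fin M → V)) : Prop :=
    Sys k ℓ E (shapeEnds ω) (shapeSet ω) ∧ Sys k ℓ E (shapeEnds ω) (shapeSet ω ∪ T)
  have hGood : ∀ T : powersetCard (k - ℓ) (univ : Finset V), Dens c₁ (Good T) := by
    intro T
    have h1 : Rob cA M (Absorbs k ℓ E g T) :=
      (hA V E (by omega) h T (mem_powersetCard.1 T.2).2).succ
        fun B B' hBB ⟨L, A, hAB, hL⟩ => ⟨L, A, hAB.trans hBB, hL⟩
    refine Dens.choice (P := fun s x => Good T (s, x)) (Dens.mono h1 ?_)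
    rintro x ⟨L, A, hAx, hL, -, hs, hs'⟩
    obtain ⟨s, h4, h5⟩ := hs.exists_shape hL x hAx
    exact ⟨s, by rw [h4, h5]; exact hs, by rw [h4, h5]; exact hs'⟩
  obtain ⟨F₀, hF₀, hd, hG⟩ := hn₃ V (by omega) _ (card_coe_powersetCard_le _)
    (fun T => Good T) hGood
  set F := F₀.filter fun ω => Sys k ℓ E (shapeEnds ω) (shapeSet ω) with hF
  have hFc : (#F : ℝ) ≤ β / K * Fintype.card V :=
    le_trans (by exact_mod_cast card_filter_le _ _) hF₀
  have hS : ∀ ω ∈ F, Sys k ℓ E (shapeEnds ω) (shapeSet ω) := fun ω hω => (mem_filter.1 hω).2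
  have hd' : ∀ ω ∈ F, ∀ ω' ∈ F, ω ≠ ω' → Disjoint (shapeSet ω) (shapeSet ω') :=
    fun ω hω ω' hω' hne => (hd ω (mem_filter.1 hω).1 ω' (mem_filter.1 hω').1 hne).mono
      (shapeSet_subset ω) (shapeSet_subset ω')
  have hG' : ∀ T : Finset V, #T = k - ℓ → ∃ G ⊆ F, ⌈c₁ * (β / K) / 16 * Fintype.card V⌉₊ ≤ #G ∧
      ∀ ω ∈ G, Sys k ℓ E (shapeEnds ω) (shapeSet ω ∪ T) := by
    intro T hT
    obtain ⟨G, hGF, h1, h2⟩ := hG ⟨T, mem_powersetCard.2 ⟨subset_univ _, hT⟩⟩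
    exact ⟨G, fun ω hω => mem_filter.2 ⟨hGF hω, (h1 ω hω).1⟩, Nat.ceil_le.2 h2,
      fun ω hω => (h1 ω hω).2⟩
  have hlen : (F.toList.flatMap shapeEnds).length = #F * g := by
    rw [List.length_flatMap]
    simp [shapeEnds]
  have hne : F.toList.flatMap shapeEnds ≠ [] := by
    obtain ⟨T, -, hT⟩ := exists_subset_card_eq (s := (univ : Finset V)) (n := k - ℓ)
      (by rw [card_univ]; omega)
    obtain ⟨G, hGF, h1, h2⟩ := hG' T hT
    obtain ⟨ω, hω⟩ : G.Nonempty := by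
      rw [← card_pos]
      exact (Nat.ceil_pos.2 (by positivity)).trans_le h1
    intro h0
    have h4 := List.flatMap_eq_nil_iff.1 h0 ω (mem_toList.2 (hGF hω))
    have h5 := h2 ω hω
    rw [h4] at h5
    generalize hB : shapeSet ω ∪ T = B at h5
    cases h5
    rw [union_eq_empty] at hB
    rw [hB.2, card_empty] at hT
    omega
  have hsys := Sys.flatMap shapeEnds shapeSet F.toList F.nodup_toList
    (by simpa using hS) (by simpa using hd')
  rw [toList_toFinset] at hsys
  have hcard : #(F.biUnion shapeSet) ≤ #F * M :=
    card_biUnion_le_card_mul _ _ M fun ω _ =>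
      (card_le_card (shapeSet_subset ω)).trans (card_image_le.trans (by simp))
  have hKF : (#F * K : ℝ) ≤ β * Fintype.card V := by
    rwa [div_mul_eq_mul_div, le_div_iff₀ (by positivity)] at hFc
  have hflex : Flex k ℓ E univ mJ ⌊β * Fintype.card V⌋₊ :=
    hJ.flex_univ hcJ (by omega) (by
      have := Nat.floor_le (a := β * Fintype.card V) (by positivity)
      have h4 := mul_le_mul_of_nonneg_left this (Nat.cast_nonneg (α := ℝ) mJ)
      nlinarith)
  obtain ⟨J, -, hJL, hJd, hJc⟩ := hflex.exists_links _ _ (F.biUnion shapeSet) hne hsys (by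
    refine Nat.le_floor (le_trans ?_ hKF)
    rw [hlen]
    exact_mod_cast (by rw [hK]; nlinarith))
  obtain ⟨hne', I₀, hI₀⟩ := hsys.exists_conn hJL hJd.symm
  refine ⟨((F.toList.flatMap shapeEnds).head hne').1, ((F.toList.flatMap shapeEnds).getLast hne').2,
    F.biUnion shapeSet ∪ J, ?_, fun U hU hdvd hUc => ?_⟩
  · refine le_trans ?_ hKF
    rw [hlen] at hJc
    have := card_union_le (F.biUnion shapeSet) J
    exact_mod_cast (by rw [hK]; nlinarith)
  · rw [disjoint_union_right] at hU
    obtain ⟨t, ht⟩ := hdvd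
    have htU : t ≤ #U := by rw [ht]; nlinarith [show 1 ≤ k - ℓ by omega]
    obtain ⟨a, D, hDF, -, hs, haU, -, had, hU'⟩ := exists_absorbing_assignment F shapeEnds
      shapeSet hS hG' t (by
        have h1 : (t : ℝ) ≤ #U := by exact_mod_cast htU
        have h2 : min (cJ / 2 / (mJ + 1)) (min (c₁ / 16 / M ^ 2) (c₁ / 16 / K)) * β *
            Fintype.card V ≤ c₁ / 16 / K * β * Fintype.card V := by
          gcongr
          exact (min_le_right _ _).trans (min_le_right _ _)
        have h3 : c₁ * (β / K) / 16 * Fintype.card V = c₁ / 16 / K * β * Fintype.card V := by ring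
        exact_mod_cast (h1.trans (hUc.trans (h2.trans_eq h3.symm))).trans (Nat.le_ceil _))
      U (by rw [ht, mul_comm])
    have hsU := Sys.flatMap shapeEnds (fun ω => shapeSet ω ∪ a ω) F.toList F.nodup_toList
      (by simpa using hs) (by
        intro ω hω ω' hω' hne
        rw [mem_toList] at hω hω'
        have h1 := disjoint_biUnion_right _ _ _ |>.1 hU.1
        simp only [disjoint_union_left, disjoint_union_right]
        exact ⟨⟨hd' ω hω ω' hω' hne, (h1 ω' hω').mono_left (haU ω)⟩,
          ((h1 ω hω).mono_left (haU ω')).symm, had ω ω' hne⟩)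
    have hFa : F.biUnion (fun ω => shapeSet ω ∪ a ω) = F.biUnion shapeSet ∪ U := by
      rw [biUnion_union]
      congr 1
      refine subset_antisymm (biUnion_subset.2 fun ω _ => haU ω) ?_
      conv_lhs => rw [← hU']
      exact biUnion_subset_biUnion_of_subset_left _ hDF
    rw [toList_toFinset, hFa] at hsU
    obtain ⟨_, I, hI, hI'⟩ := hsU.exists_conn hJL (by
      rw [disjoint_union_left]
      exact ⟨hJd.symm, hU.2⟩)
    exact ⟨I, hI, by rw [hI']; exact union_right_comm _ _ _⟩

lemma pair_count_bound {p a σ n : ℝ} (hσ' : σ ≤ 1 / 4) (hn : 0 ≤ n)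
    (hap : a ≤ p) (ha0 : 0 ≤ a) (hpn : p ≤ n) (h : p + a ≤ 2 * σ * n) :
    p ^ 2 + 2 * (a * (n - p)) ≤ (2 * σ - σ ^ 2) * n ^ 2 := by
  rcases le_total p (σ * n) with hp | hp
  · have h1 : a * (n - p) ≤ p * (n - p) := by nlinarith
    nlinarith [mul_nonneg (sub_nonneg.2 hp) (by nlinarith : 0 ≤ 2 * n - p - σ * n)]
  · have h1 : a * (n - p) ≤ (2 * σ * n - p) * (n - p) := by nlinarith
    have h2 : p ≤ 2 * σ * n := by linarith
    have h3 : (p - σ * n) * (p - 2 * σ * n) ≤ 0 := by nlinarith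
    have h4 : 0 ≤ (p - σ * n) * (n * (2 - 5 * σ)) :=
      mul_nonneg (by linarith) (mul_nonneg hn (by linarith))
    nlinarith

/-- Few pairs have a large sum. -/
lemma card_le_add_le {U : Type} [Fintype U] (z : U → ℕ) {τ : ℕ} {σ : ℝ}
    (hσ' : σ ≤ 1 / 4) (hz : (∑ u, (z u : ℝ)) ≤ σ * τ * Fintype.card U) (hτ : 0 < τ) :
    (#{p : U × U | τ ≤ z p.1 + z p.2} : ℝ) ≤ (2 * σ - σ ^ 2) * (Fintype.card U : ℝ) ^ 2 := by
  classical
  let g (t : ℕ) : ℕ := #{u | t ≤ z u}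
  have hg : ∑ t ∈ range τ, g (t + 1) ≤ ∑ u, z u := by
    simp only [g, card_filter]
    rw [sum_comm]
    refine sum_le_sum fun u _ => ?_
    rw [← card_filter]
    calc _ ≤ #(range (z u)) := card_le_card fun t ht => by
          simp only [mem_filter, mem_range] at ht ⊢
          omega
      _ = _ := card_range _
  have hg' : (∑ t ∈ range τ, (g (t + 1) : ℝ)) ≤ σ * τ * Fintype.card U :=
    le_trans (by exact_mod_cast hg) hz
  obtain ⟨t, ht, hgt⟩ : ∃ t ∈ range τ, (g (t + 1) + g (τ - 1 - t + 1) : ℝ) ≤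
      2 * σ * Fintype.card U := by
    refine exists_le_of_sum_le (nonempty_range_iff.2 hτ.ne') ?_
    rw [sum_add_distrib, sum_range_reflect (fun t => (g (t + 1) : ℝ)), sum_const, card_range,
      nsmul_eq_mul]
    linarith
  rw [mem_range] at ht
  have key : ∀ s t, s ≤ t → s + t = τ + 1 → (g s + g t : ℝ) ≤ 2 * σ * Fintype.card U →
      (#{p : U × U | τ ≤ z p.1 + z p.2} : ℝ) ≤ (2 * σ - σ ^ 2) * (Fintype.card U : ℝ) ^ 2 := by
    intro s t hst hs h
    have hmono : g t ≤ g s := card_le_card fun u hu => by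
      simp only [mem_filter, mem_univ, true_and] at hu ⊢
      omega
    let S : Finset U := {u | s ≤ z u}
    let A : Finset U := {u | t ≤ z u}
    have hsub : ({p : U × U | τ ≤ z p.1 + z p.2} : Finset (U × U)) ⊆
        S ×ˢ S ∪ (A ×ˢ Sᶜ ∪ Sᶜ ×ˢ A) := by
      rintro ⟨u, v⟩ huv
      simp only [mem_filter, mem_univ, true_and, mem_union, mem_product, mem_compl, S, A] at huv ⊢
      omega
    have h1 := (card_le_card hsub).trans
      ((card_union_le _ _).trans (Nat.add_le_add_left (card_union_le _ _) _))
    simp only [card_product, card_compl] at h1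
    have hSn : #S ≤ Fintype.card U := card_le_univ _
    have h2 : (#{p : U × U | τ ≤ z p.1 + z p.2} : ℝ) ≤
        (g s : ℝ) ^ 2 + 2 * ((g t : ℝ) * (Fintype.card U - g s)) := by
      have h3 : (_ : ℝ) ≤ _ := Nat.cast_le.2 h1
      push_cast [Nat.cast_sub hSn] at h3
      change _ ≤ (g s : ℝ) * g s + ((g t : ℝ) * (Fintype.card U - g s) +
        (Fintype.card U - g s) * g t) at h3
      nlinarith
    exact h2.trans (pair_count_bound hσ' (Nat.cast_nonneg _) (by exact_mod_cast hmono)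
      (Nat.cast_nonneg _) (by exact_mod_cast hSn) h)
  rcases le_total (t + 1) (τ - 1 - t + 1) with h | h
  · exact key _ _ h (by omega) hgt
  · exact key _ _ h (by omega) (by linarith)

section
variable {U O : Type} [Fintype U]

/-- The total weight received by a vertex. -/
def load {ι : Type} (wt : O → U → ℕ) (F : ι → O) (I : Finset ι) (v : U) : ℕ :=
  ∑ t ∈ I, wt (F t) v

/-- Removing a few members of a family of weights makes all loads bounded. -/
lemma exists_bounded_load {ι : Type} [DecidableEq ι] (wt : O → U → ℕ) (F : ι → O) (b : ℕ) :
    ∀ (N : ℕ) (I : Finset ι), ∑ v, (load wt F I v - b) ≤ N →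
      ∃ I' ⊆ I, #I ≤ #I' + N ∧ ∀ v, load wt F I' v ≤ b
  | 0, I, h => by
    refine ⟨I, Subset.rfl, by omega, fun v => ?_⟩
    have := sum_eq_zero_iff.1 (Nat.le_zero.1 h) v (mem_univ v)
    omega
  | N + 1, I, h => by
    by_cases hI : ∀ v, load wt F I v ≤ b
    · exact ⟨I, Subset.rfl, by omega, hI⟩
    push Not at hI
    obtain ⟨v, hv⟩ := hI
    obtain ⟨t, ht, htv⟩ : ∃ t ∈ I, wt (F t) v ≠ 0 := by
      by_contra! h0
      rw [load, sum_eq_zero h0] at hv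
      omega
    have hle : ∀ w, load wt F I w = load wt F (I.erase t) w + wt (F t) w := fun w =>
      (sum_erase_add _ _ ht).symm
    obtain ⟨I', hI', hc, hb⟩ := exists_bounded_load wt F b N (I.erase t) (by
      have : ∑ w, (load wt F (I.erase t) w - b) < ∑ w, (load wt F I w - b) := by
        refine sum_lt_sum (fun w _ => ?_) ⟨v, mem_univ v, ?_⟩
        · have := hle w
          omega
        · have := hle v
          omega
      omega)
    refine ⟨I', hI'.trans (erase_subset _ _), ?_, hb⟩
    have := card_erase_add_one ht
    omega

/-- The weights of a family minimising the sum of the squares of the loads cannot be lighter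
than average. -/
lemma exists_min_load [Fintype O] [Nonempty O] (wt : O → U → ℕ) {R : ℕ} (hwt : ∀ o v, wt o v ≤ 2)
    (hR : ∀ o, ∑ v, wt o v = R) (T : ℕ) : ∃ F : Fin T → O, ∀ o,
      ∑ v, (load wt F univ v : ℝ) ^ 2 ≤ T * (∑ v, (wt o v : ℝ) * load wt F univ v + 2 * R) := by
  classical
  obtain ⟨F, -, hF⟩ := exists_min_image (univ : Finset (Fin T → O))
    (fun F => ∑ v, (load wt F univ v : ℝ) ^ 2) univ_nonempty
  refine ⟨F, fun o => ?_⟩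
  have h1 : ∀ t, ∑ v, (wt (F t) v : ℝ) * load wt F univ v ≤
      ∑ v, (wt o v : ℝ) * load wt F univ v + 2 * R := by
    intro t
    have h2 : ∀ v, (load wt (Function.update F t o) univ v : ℝ) =
        load wt F univ v + (wt o v - wt (F t) v) := by
      intro v
      rw [load, load, ← sum_erase_add _ _ (mem_univ t),
        ← sum_erase_add (s := univ) (a := t) (f := fun i => wt (F i) v) (mem_univ t),
        Function.update_self]
      rw [sum_congr rfl fun i hi => by rw [Function.update_of_ne (ne_of_mem_erase hi)]]
      push_cast
      ring
    have h3 := hF (Function.update F t o) (mem_univ _)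
    simp only [h2, add_sq] at h3
    have h4 : ∑ v, ((wt o v : ℝ) - wt (F t) v) ^ 2 ≤ ∑ v, 2 * ((wt o v : ℝ) + wt (F t) v) := by
      refine sum_le_sum fun v _ => ?_
      have h5 : (wt o v : ℝ) ≤ 2 := by exact_mod_cast hwt o v
      have h6 : (wt (F t) v : ℝ) ≤ 2 := by exact_mod_cast hwt (F t) v
      have h7 : (0 : ℝ) ≤ wt o v := Nat.cast_nonneg _
      have h8 : (0 : ℝ) ≤ wt (F t) v := Nat.cast_nonneg _
      nlinarith
    have h9 : ∀ o, ∑ v, (wt o v : ℝ) = R := fun o => by exact_mod_cast hR o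
    rw [← mul_sum, sum_add_distrib, h9, h9] at h4
    have h10 : ∑ v, 2 * (load wt F univ v : ℝ) * (wt o v - wt (F t) v) =
        2 * (∑ v, (wt o v : ℝ) * load wt F univ v - ∑ v, (wt (F t) v : ℝ) * load wt F univ v) := by
      rw [← sum_sub_distrib, mul_sum]
      exact sum_congr rfl fun v _ => by ring
    rw [sum_add_distrib, sum_add_distrib, h10] at h3
    linarith
  have h2 := sum_le_sum fun t (_ : t ∈ univ) => h1 t
  rw [sum_const, card_univ, Fintype.card_fin, nsmul_eq_mul, sum_comm] at h2
  refine le_trans (le_of_eq ?_) h2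
  refine sum_congr rfl fun v _ => ?_
  rw [← sum_mul, sq]
  congr 1
  exact Nat.cast_sum _ _

end

/-- Against any vector `x` there is a weight which is not much heavier than average. -/
lemma exists_light_weight {U O : Type} [Fintype U] (wt : O → U → ℕ) {R q : ℕ} {η : ℝ}
    (hR4 : 4 ≤ R) (hη : 0 < η) (hη' : η ≤ 1 / 2) (hnpos : 0 < Fintype.card U)
    (H : ∀ Λ : Finset U, η * Fintype.card U ≤ #Λ → ∃ P : Finset (U × U),
      (2 * (1 / (R : ℝ)) - (1 / (R : ℝ)) ^ 2) * (Fintype.card U : ℝ) ^ 2 < #P ∧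
      ∀ p ∈ P, ∃ o, ∀ (y : U → ℕ) (l : ℕ), (∀ w ∈ Λ, y w ≤ l) →
        ∑ v, wt o v * y v ≤ y p.1 + y p.2 + (R - 2) * l)
    (x : U → ℕ) (hxr : ∑ v, (x v : ℝ) = Fintype.card U * (R * q)) :
    ∃ o, (∑ v, (wt o v : ℝ) * x v) ≤ R * (R * q * (1 + 2 * η)) := by
  classical
  set n := Fintype.card U with hn
  have hR0 : (4 : ℝ) ≤ R := by exact_mod_cast hR4
  have hn0 : (0 : ℝ) ≤ n := Nat.cast_nonneg _
  have hex : ∃ l, η * n ≤ #{v | x v ≤ l} := by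
    refine ⟨∑ v, x v, ?_⟩
    rw [filter_true_of_mem fun v _ => single_le_sum (fun _ _ => Nat.zero_le _) (mem_univ v),
      card_univ, ← hn]
    nlinarith
  obtain ⟨l, hl, hlow⟩ : ∃ l, η * n ≤ #{v | x v ≤ l} ∧ (#{v | x v < l} : ℝ) ≤ η * n := by
    refine ⟨Nat.find hex, Nat.find_spec hex, ?_⟩
    rcases Nat.eq_zero_or_pos (Nat.find hex) with h | h
    · simp only [h, Nat.not_lt_zero, filter_false, card_empty, Nat.cast_zero]
      positivity
    · have h1 := Nat.find_min hex (m := Nat.find hex - 1) (by omega)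
      push Not at h1
      refine le_trans (Nat.cast_le.2 (card_le_card fun v hv => ?_)) h1.le
      simp only [mem_filter, mem_univ, true_and] at hv ⊢
      omega
  let z : U → ℕ := fun v => x v - l
  have hz : ∑ v, (z v : ℝ) ≤ n * (R * q) - l * ((1 - η) * n) := by
    have h1 : ∀ v, (z v : ℝ) ≤ x v - l + (if x v < l then (l : ℝ) else 0) := by
      intro v
      split_ifs with h
      · have : z v = 0 := by simp only [z]; omega
        rw [this]
        simp
      · simp only [z]
        rw [Nat.cast_sub (by omega)]
        simp
    refine (sum_le_sum fun v _ => h1 v).trans ?_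
    rw [sum_add_distrib, sum_sub_distrib, hxr, sum_const, card_univ, ← hn, ← sum_filter,
      sum_const, nsmul_eq_mul, nsmul_eq_mul]
    nlinarith [mul_le_mul_of_nonneg_right hlow (Nat.cast_nonneg (α := ℝ) l)]
  have hnpos' : (0 : ℝ) < n := by exact_mod_cast hnpos
  set ζ : ℝ := (∑ v, (z v : ℝ)) / n with hζ
  have hζn : ∑ v, (z v : ℝ) = ζ * n := by rw [hζ]; field_simp
  have hζ0 : 0 ≤ ζ := by positivity
  have hζl : ζ + (1 - η) * l ≤ R * q := by
    have : (ζ + (1 - η) * l) * n ≤ (R * q) * n := by rw [hζn] at hz; linarith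
    exact le_of_mul_le_mul_right this hnpos'
  obtain ⟨P, hP, hPo⟩ := H {v | x v ≤ l} hl
  have hτ := Nat.lt_floor_add_one ((R : ℝ) * ζ)
  have hfew := card_le_add_le z (τ := ⌊(R : ℝ) * ζ⌋₊ + 1) (σ := 1 / R)
    (by rw [div_le_div_iff₀] <;> linarith) (by
      rw [hζn, ← hn]
      refine mul_le_mul_of_nonneg_right ?_ hn0
      rw [one_div, inv_mul_eq_div, le_div_iff₀ (by linarith)]
      push_cast
      linarith) (Nat.succ_pos _)
  obtain ⟨⟨u, v⟩, hp, huv⟩ : ∃ p ∈ P, z p.1 + z p.2 < ⌊(R : ℝ) * ζ⌋₊ + 1 := by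
    by_contra! h0
    have : #P ≤ #{p : U × U | ⌊(R : ℝ) * ζ⌋₊ + 1 ≤ z p.1 + z p.2} := card_le_card fun p hp => by
      simpa using h0 p hp
    have : (#P : ℝ) ≤ _ := Nat.cast_le.2 this
    linarith
  have huv' : (z u + z v : ℝ) ≤ R * ζ := by
    have : z u + z v ≤ ⌊(R : ℝ) * ζ⌋₊ := Nat.lt_succ_iff.1 huv
    calc (z u + z v : ℝ) ≤ ⌊(R : ℝ) * ζ⌋₊ := by exact_mod_cast this
      _ ≤ _ := Nat.floor_le (by positivity)
  obtain ⟨o, ho⟩ := hPo _ hp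
  have h1 := ho x l fun w hw => by simpa using hw
  refine ⟨o, ?_⟩
  have h3 : ∑ v, wt o v * x v ≤ z u + z v + R * l := by
    have h4 : R * l = (R - 2) * l + 2 * l := by
      rw [← add_mul]
      congr 1
      omega
    simp only [z] at *
    omega
  have h5 : ∑ v, (wt o v : ℝ) * x v ≤ z u + z v + R * l := by exact_mod_cast h3
  have h6 : (l : ℝ) ≤ 2 * (R * q) := by nlinarith [Nat.cast_nonneg (α := ℝ) l]
  have h7 : ζ + l ≤ R * q * (1 + 2 * η) := by nlinarith
  nlinarith

/-- If every large set `Λ` of vertices supports, for many pairs `(u, v)`, a weight which is the sum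
of `u`, `v` and weights in `Λ`, then there is a family of weights with almost perfectly balanced
loads. -/
lemma exists_balanced_family {U O : Type} [Fintype U] [DecidableEq U] [Fintype O] [Nonempty O]
    (wt : O → U → ℕ) {R q : ℕ} {η κ : ℝ} (hR4 : 4 ≤ R) (hwt : ∀ o v, wt o v ≤ 2)
    (hR : ∀ o, ∑ v, wt o v = R) (hη : 0 < η) (hη' : η ≤ 1 / 2) (hκ : 0 ≤ κ) (hκ' : 3 * η ≤ κ ^ 2)
    (hq : 2 ≤ η * q)
    (H : ∀ Λ : Finset U, η * Fintype.card U ≤ #Λ → ∃ P : Finset (U × U),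
      (2 * (1 / (R : ℝ)) - (1 / (R : ℝ)) ^ 2) * (Fintype.card U : ℝ) ^ 2 < #P ∧
      ∀ p ∈ P, ∃ o, ∀ (y : U → ℕ) (l : ℕ), (∀ w ∈ Λ, y w ≤ l) →
        ∑ v, wt o v * y v ≤ y p.1 + y p.2 + (R - 2) * l) :
    ∃ (F : Fin (Fintype.card U * q) → O) (I : Finset (Fin (Fintype.card U * q))),
      (1 - κ * R) * (Fintype.card U * q : ℝ) ≤ #I ∧ ∀ v, load wt F I v ≤ R * q := by
  classical
  set n := Fintype.card U with hn
  obtain ⟨F, hF⟩ := exists_min_load wt hwt hR (n * q)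
  let x := load wt F univ
  have hx : ∑ v, x v = R * (n * q) := by
    simp only [x, load]
    rw [sum_comm, sum_congr rfl fun t _ => hR (F t), sum_const, card_univ, Fintype.card_fin,
      smul_eq_mul, mul_comm]
  have hxr : ∑ v, (x v : ℝ) = n * (R * q) := by
    have : (_ : ℝ) = _ := congrArg (Nat.cast : ℕ → ℝ) hx
    push_cast at this
    linarith
  have hR0 : (4 : ℝ) ≤ R := by exact_mod_cast hR4
  have hn0 : (0 : ℝ) ≤ n := Nat.cast_nonneg _
  rcases Nat.eq_zero_or_pos n with hn00 | hnpos
  · refine ⟨F, ∅, ?_, fun v => ?_⟩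
    · rw [hn00]; simp
    · simp [load]
  obtain ⟨o, h2⟩ := exists_light_weight wt hR4 hη hη' hnpos H x hxr
  have h3 := hF o
  change ∑ v, (x v : ℝ) ^ 2 ≤ (n * q : ℕ) * (∑ v, (wt o v : ℝ) * x v + 2 * R) at h3
  obtain ⟨a, ha⟩ : ∃ a : ℝ, a = R * q := ⟨_, rfl⟩
  rw [← ha] at h2 hxr
  have hq0 : (0 : ℝ) ≤ q := Nat.cast_nonneg _
  have ha0 : 0 ≤ a := by rw [ha]; positivity
  have ha2 : 2 ≤ η * a := by
    refine hq.trans (mul_le_mul_of_nonneg_left ?_ hη.le)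
    rw [ha]
    exact le_mul_of_one_le_left hq0 (by linarith only [hR0])
  have h4 : ∑ v, ((x v : ℝ) - a) ^ 2 ≤ n * (κ * a) ^ 2 := by
    have h5 : ∑ v, ((x v : ℝ) - a) ^ 2 = ∑ v, (x v : ℝ) ^ 2 - 2 * a * ∑ v, (x v : ℝ) + n * a ^ 2 := by
      simp only [sub_sq, sum_add_distrib, sum_sub_distrib]
      rw [sum_const, card_univ, ← hn, nsmul_eq_mul, mul_sum]
      congr 2
      exact sum_congr rfl fun v _ => by ring
    have h6 : ∑ v, (x v : ℝ) ^ 2 ≤ n * (a * (a * (1 + 2 * η) + 2)) := by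
      refine h3.trans ?_
      push_cast
      calc (n * q : ℝ) * (∑ v, (wt o v : ℝ) * x v + 2 * R)
          ≤ (n * q : ℝ) * (R * (a * (1 + 2 * η)) + 2 * R) := by gcongr
        _ = _ := by rw [ha]; ring
    rw [h5, hxr]
    have h7 : a * (a * (1 + 2 * η) + 2) ≤ a ^ 2 + (κ * a) ^ 2 := by
      have h8 : 3 * η * a ^ 2 ≤ κ ^ 2 * a ^ 2 := mul_le_mul_of_nonneg_right hκ' (sq_nonneg a)
      nlinarith
    nlinarith [mul_le_mul_of_nonneg_left h7 hn0]
  have h5 : ∑ v, |(x v : ℝ) - a| ≤ n * (κ * a) := by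
    refine le_of_sq_le_sq ?_ (by positivity)
    have := sq_sum_le_card_mul_sum_sq (s := univ) (f := fun v => |(x v : ℝ) - a|)
    simp only [sq_abs, card_univ, ← hn] at this
    nlinarith
  obtain ⟨I, -, hI, hb⟩ := exists_bounded_load wt F (R * q) (∑ v, (x v - R * q)) univ le_rfl
  refine ⟨F, I, ?_, hb⟩
  rw [card_univ, Fintype.card_fin] at hI
  have h6 : ((∑ v, (x v - R * q) : ℕ) : ℝ) ≤ n * (κ * a) := by
    refine le_trans ?_ h5
    push_cast
    refine sum_le_sum fun v _ => ?_
    rcases le_total (x v) (R * q) with h | h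
    · rw [Nat.sub_eq_zero_of_le h]
      simp
    · rw [Nat.cast_sub h]
      push_cast
      rw [ha]
      exact le_abs_self _
  have h7 : ((n * q : ℕ) : ℝ) ≤ _ := Nat.cast_le.2 hI
  push_cast at h7 h6
  have h8 : (n : ℝ) * (κ * a) = κ * R * (n * q) := by rw [ha]; ring
  linarith

section
variable {ι Ω : Type} [Fintype ι] [DecidableEq ι] [Fintype Ω]

lemma sum_mul_eq_zero_of_update {p q : ι} {Y Y' : (ι → Ω) → ℝ}
    (hY : ∀ ω, ∑ a, ∑ b, Y (Function.update (Function.update ω p a) q b) = 0)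
    (hp : ∀ ω a, Y' (Function.update ω p a) = Y' ω)
    (hq : ∀ ω a, Y' (Function.update ω q a) = Y' ω) : ∑ ω, Y ω * Y' ω = 0 := by
  rcases isEmpty_or_nonempty (ι → Ω) with hΩ | ⟨⟨ω₀⟩⟩
  · simp
  have h1 := sum_sum_update p fun ω => ∑ b, Y (Function.update ω q b) * Y' (Function.update ω q b)
  rw [sum_sum_update q fun ω => Y ω * Y' ω] at h1
  have h2 : ∀ ω, ∑ a, ∑ b, Y (Function.update (Function.update ω p a) q b) *
      Y' (Function.update (Function.update ω p a) q b) = 0 := by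
    intro ω
    simp only [hp, hq, ← sum_mul, hY, zero_mul]
  rw [sum_congr rfl fun ω _ => h2 ω, sum_const_zero] at h1
  have : Nonempty Ω := ⟨ω₀ p⟩
  have hN : (Fintype.card Ω : ℝ) ≠ 0 := Nat.cast_ne_zero.2 Fintype.card_ne_zero
  rcases mul_eq_zero.1 h1.symm with h | h
  · exact absurd h hN
  · exact (mul_eq_zero.1 h).resolve_left hN

/-- The second moment of a sum of random variables indexed by pairs, uncorrelated for disjoint
pairs. -/
lemma sum_sq_sum_le (D : Finset (ι × ι)) (Y : ι × ι → (ι → Ω) → ℝ) (hY : ∀ d ω, |Y d ω| ≤ 1)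
    (h0 : ∀ d ∈ D, ∀ d' ∈ D, d.1 ≠ d'.1 → d.1 ≠ d'.2 → d.2 ≠ d'.1 → d.2 ≠ d'.2 →
      ∑ ω, Y d ω * Y d' ω = 0) :
    ∑ ω, (∑ d ∈ D, Y d ω) ^ 2 ≤ 4 * (Fintype.card ι : ℝ) ^ 3 * Fintype.card (ι → Ω) := by
  classical
  let Q : Finset ((ι × ι) × (ι × ι)) := (D ×ˢ D).filter fun x =>
    x.1.1 = x.2.1 ∨ x.1.1 = x.2.2 ∨ x.1.2 = x.2.1 ∨ x.1.2 = x.2.2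
  have hQ : #Q ≤ 4 * Fintype.card ι ^ 3 := by
    have hs : Q ⊆ (univ : Finset (ι × ι × ι)).image (fun t => ((t.1, t.2.1), (t.1, t.2.2))) ∪
        ((univ : Finset (ι × ι × ι)).image (fun t => ((t.1, t.2.1), (t.2.2, t.1))) ∪
        ((univ : Finset (ι × ι × ι)).image (fun t => ((t.2.1, t.1), (t.1, t.2.2))) ∪
        (univ : Finset (ι × ι × ι)).image (fun t => ((t.2.1, t.1), (t.2.2, t.1))))) := by
      rintro ⟨⟨a, b⟩, c, d⟩ hx
      simp only [Q, mem_filter, mem_product] at hx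
      simp only [mem_union, mem_image, mem_univ, true_and, Prod.mk.injEq, Prod.exists]
      rcases hx.2 with h | h | h | h
      · exact Or.inl ⟨a, b, d, by simp [h]⟩
      · exact Or.inr (Or.inl ⟨a, b, c, by simp [h]⟩)
      · exact Or.inr (Or.inr (Or.inl ⟨b, a, d, by simp [h]⟩))
      · exact Or.inr (Or.inr (Or.inr ⟨b, a, c, by simp [h]⟩))
    have hc : #(univ : Finset (ι × ι × ι)) = Fintype.card ι ^ 3 := by
      rw [card_univ, Fintype.card_prod, Fintype.card_prod]
      ring
    have h1 := card_le_card hs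
    have hi : ∀ g : ι × ι × ι → (ι × ι) × (ι × ι), #(univ.image g) ≤ Fintype.card ι ^ 3 :=
      fun g => card_image_le.trans hc.le
    have h2 := (card_union_le _ _).trans (add_le_add (hi fun t => ((t.1, t.2.1), (t.1, t.2.2)))
      ((card_union_le _ _).trans (add_le_add (hi fun t => ((t.1, t.2.1), (t.2.2, t.1)))
      ((card_union_le _ _).trans (add_le_add (hi fun t => ((t.2.1, t.1), (t.1, t.2.2)))
        (hi fun t => ((t.2.1, t.1), (t.2.2, t.1))))))))
    omega
  have h1 : ∑ ω, (∑ d ∈ D, Y d ω) ^ 2 = ∑ x ∈ D ×ˢ D, ∑ ω, Y x.1 ω * Y x.2 ω := by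
    rw [sum_comm]
    refine sum_congr rfl fun ω _ => ?_
    rw [sq, sum_mul_sum, sum_product]
  have h2 : ∑ x ∈ D ×ˢ D, ∑ ω, Y x.1 ω * Y x.2 ω = ∑ x ∈ Q, ∑ ω, Y x.1 ω * Y x.2 ω := by
    refine (sum_subset (filter_subset _ _) fun x hx hxQ => ?_).symm
    have hx' := mem_product.1 hx
    have : ¬ (x.1.1 = x.2.1 ∨ x.1.1 = x.2.2 ∨ x.1.2 = x.2.1 ∨ x.1.2 = x.2.2) := fun h =>
      hxQ (mem_filter.2 ⟨hx, h⟩)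
    push Not at this
    exact h0 _ hx'.1 _ hx'.2 this.1 this.2.1 this.2.2.1 this.2.2.2
  rw [h1, h2]
  have h3 : ∀ x ∈ Q, ∑ ω, Y x.1 ω * Y x.2 ω ≤ Fintype.card (ι → Ω) := by
    intro x _
    rw [← nsmul_one (Fintype.card (ι → Ω)), ← card_univ]
    refine sum_le_card_nsmul _ _ _ fun ω _ => (le_abs_self _).trans ?_
    rw [abs_mul]
    exact mul_le_one₀ (hY _ _) (abs_nonneg _) (hY _ _)
  refine (sum_le_card_nsmul _ _ _ h3).trans ?_
  rw [nsmul_eq_mul]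
  refine mul_le_mul_of_nonneg_right ?_ (Nat.cast_nonneg _)
  exact_mod_cast hQ

/-- Concentration of a sum over pairs of coordinates of a random function. -/
lemma dens_sum_pairs {f : (ι → Ω) → Ω → Ω → ℝ} (hf0 : ∀ ω a b, 0 ≤ f ω a b)
    (hf1 : ∀ ω a b, f ω a b ≤ 1) {J : Finset ι}
    (hJ : ∀ ω p a, p ∉ J → f (Function.update ω p a) = f ω) {δ : ℝ} (hδ : 0 < δ)
    (hι : 0 < Fintype.card ι) (hΩ : 0 < Fintype.card Ω) :
    Dens (1 - 4 / (δ ^ 2 * Fintype.card ι)) fun ω : ι → Ω =>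
      (#{d : ι × ι | d.1 ≠ d.2 ∧ d.1 ∉ J ∧ d.2 ∉ J} : ℝ) *
        ((∑ a, ∑ b, f ω a b) / (Fintype.card Ω : ℝ) ^ 2) - δ * (Fintype.card ι : ℝ) ^ 2 ≤
      ∑ d : ι × ι with d.1 ≠ d.2 ∧ d.1 ∉ J ∧ d.2 ∉ J, f ω (ω d.1) (ω d.2) := by
  classical
  set D : Finset (ι × ι) := {d | d.1 ≠ d.2 ∧ d.1 ∉ J ∧ d.2 ∉ J} with hD
  set N : ℝ := ((Fintype.card Ω : ℕ) : ℝ) with hN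
  set s : ℝ := ((Fintype.card ι : ℕ) : ℝ) with hs
  have hN0 : 0 < N := Nat.cast_pos.2 hΩ
  have hs0 : 0 < s := Nat.cast_pos.2 hι
  let μ : (ι → Ω) → ℝ := fun ω => (∑ a, ∑ b, f ω a b) / N ^ 2
  have hμ : ∀ ω p a, p ∉ J → μ (Function.update ω p a) = μ ω := fun ω p a hp => by
    simp only [μ, hJ ω p a hp]
  have hμ0 : ∀ ω, 0 ≤ μ ω := fun ω =>
    div_nonneg (sum_nonneg fun a _ => sum_nonneg fun b _ => hf0 ω a b) (sq_nonneg N)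
  have hμ1 : ∀ ω, μ ω ≤ 1 := fun ω => by
    rw [div_le_one (by positivity)]
    calc ∑ a, ∑ b, f ω a b ≤ ∑ _a : Ω, ∑ _b : Ω, (1 : ℝ) :=
          sum_le_sum fun a _ => sum_le_sum fun b _ => hf1 ω a b
      _ = N ^ 2 := by simp [hN, sq]
  let Y : ι × ι → (ι → Ω) → ℝ := fun d ω => f ω (ω d.1) (ω d.2) - μ ω
  have hsq := sum_sq_sum_le D Y (fun d ω => by
      rw [abs_le]
      constructor <;> linarith [hf0 ω (ω d.1) (ω d.2), hf1 ω (ω d.1) (ω d.2), hμ0 ω, hμ1 ω])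
    (by
      intro d hd d' hd' h1 h2 h3 h4
      simp only [hD, mem_filter, mem_univ, true_and] at hd hd'
      refine sum_mul_eq_zero_of_update (p := d.1) (q := d.2) (fun ω => ?_) (fun ω a => ?_)
        (fun ω a => ?_)
      · simp only [Y, hJ _ _ _ hd.2.1, hJ _ _ _ hd.2.2, hμ _ _ _ hd.2.1, hμ _ _ _ hd.2.2,
          Function.update_self, Function.update_of_ne hd.1, sum_sub_distrib]
        simp only [sum_const, card_univ, nsmul_eq_mul, ← hN, μ]
        field_simp
        ring
      · simp only [Y, hJ _ _ _ hd.2.1, hμ _ _ _ hd.2.1, Function.update_of_ne h1.symm,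
          Function.update_of_ne h2.symm]
      · simp only [Y, hJ _ _ _ hd.2.2, hμ _ _ _ hd.2.2, Function.update_of_ne h3.symm,
          Function.update_of_ne h4.symm])
  have hbad : (#{ω : ι → Ω | ∑ d ∈ D, Y d ω < - (δ * s ^ 2)} : ℝ) ≤
      4 / (δ ^ 2 * s) * Fintype.card (ι → Ω) := by
    have h1 : (#{ω : ι → Ω | ∑ d ∈ D, Y d ω < - (δ * s ^ 2)} : ℝ) * (δ * s ^ 2) ^ 2 ≤
        4 * s ^ 3 * Fintype.card (ι → Ω) := by
      refine le_trans ?_ hsq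
      rw [← nsmul_eq_mul]
      refine le_trans (card_nsmul_le_sum _ (fun ω => (∑ d ∈ D, Y d ω) ^ 2) _ fun ω hω => ?_)
        (sum_le_sum_of_subset_of_nonneg (subset_univ _) fun _ _ _ => sq_nonneg _)
      have := (mem_filter.1 hω).2
      nlinarith [show 0 < δ * s ^ 2 by positivity]
    rw [div_mul_eq_mul_div, le_div_iff₀ (by positivity)]
    have h2 : 0 < s ^ 3 := by positivity
    refine le_of_mul_le_mul_right ?_ h2
    linarith
  refine ((Dens.of_forall fun _ => trivial).and_not hbad).mono fun ω hω => ?_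
  have h1 := not_lt.1 hω.2
  have h2 : ∑ d ∈ D, Y d ω = ∑ d ∈ D, f ω (ω d.1) (ω d.2) - #D * μ ω := by
    simp only [Y, sum_sub_distrib, sum_const, nsmul_eq_mul]
  change #D * μ ω - δ * s ^ 2 ≤ _
  linarith

/-- If `P` holds for most `ω` at every `p`, then for most `ω` it holds at most `p`. -/
lemma Dens.swap {ι Ω : Type} [Fintype ι] [Fintype Ω] {P : Ω → ι → Prop} {a b : ℝ} (hb : b < 1)
    (hι : 0 < Fintype.card ι) (h : ∀ p, Dens a fun ω => P ω p) :
    Dens ((a - b) / (1 - b)) fun ω => Dens b (P ω) := by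
  classical
  simp only [dens_iff] at h ⊢
  set N : ℝ := ((Fintype.card Ω : ℕ) : ℝ)
  set s : ℝ := ((Fintype.card ι : ℕ) : ℝ)
  have hs : 0 < s := Nat.cast_pos.2 hι
  have h1 : s * (a * N) ≤ ∑ p, (#{ω | P ω p} : ℝ) := by
    rw [← nsmul_eq_mul, ← card_univ]
    exact card_nsmul_le_sum _ _ _ fun p _ => h p
  have h2 : ∑ p, (#{ω | P ω p} : ℝ) = ∑ ω, (#{p | P ω p} : ℝ) := by
    simp only [card_filter, Nat.cast_sum]
    exact sum_comm
  let G : Finset Ω := {ω | b * s ≤ #{p | P ω p}}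
  have h3 : ∀ ω, (#{p | P ω p} : ℝ) ≤ b * s + (if ω ∈ G then (1 - b) * s else 0) := by
    intro ω
    split_ifs with hω
    · have : (#{p | P ω p} : ℝ) ≤ s := Nat.cast_le.2 (card_le_univ _)
      linarith
    · have : ¬ b * s ≤ #{p | P ω p} := fun h => hω (mem_filter.2 ⟨mem_univ _, h⟩)
      linarith
  have h4 := sum_le_sum fun ω (_ : ω ∈ univ) => h3 ω
  rw [← h2, sum_add_distrib, sum_const, card_univ, nsmul_eq_mul, sum_ite_mem, univ_inter,
    sum_const, nsmul_eq_mul] at h4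
  change _ ≤ (#G : ℝ)
  rw [div_mul_eq_mul_div, div_le_iff₀ (by linarith)]
  refine le_of_mul_le_mul_right ?_ hs
  linarith

end

lemma card_filter_prodProdProdComm {A M : Type} [Fintype A] [Fintype M]
    (Q : (A × M) → (A × M) → Prop) [∀ x y, Decidable (Q x y)] :
    #{x : (A × M) × (A × M) | Q x.1 x.2} =
      ∑ d : A × A, #{ij : M × M | Q (d.1, ij.1) (d.2, ij.2)} := by
  simp only [card_filter]
  rw [← Equiv.sum_comp (Equiv.prodProdProdComm A A M M), Fintype.sum_prod_type]
  rfl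

/-- The blow-up of a map of index sets. -/
def lift {ι A M : Type} (ω : ι → A) : ι × M → A × M := Prod.map ω id

lemma lift_injective {ι A M : Type} {ω : ι → A} (h : Function.Injective ω) :
    Function.Injective (lift ω : ι × M → A × M) := h.prodMap Function.injective_id

lemma le_card_pairs {ι : Type} [Fintype ι] [DecidableEq ι] {J : Finset ι} {r : ℕ} (hJ : #J ≤ r) :
    (Fintype.card ι : ℝ) ^ 2 - (2 * r + 1) * Fintype.card ι ≤
      #{d : ι × ι | d.1 ≠ d.2 ∧ d.1 ∉ J ∧ d.2 ∉ J} := by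
  classical
  have h : (univ : Finset (ι × ι)) ⊆
      ({d | d.1 ≠ d.2 ∧ d.1 ∉ J ∧ d.2 ∉ J} : Finset (ι × ι)) ∪
        (univ.diag ∪ (J ×ˢ univ ∪ univ ×ˢ J)) := by
    rintro ⟨p, q⟩ -
    simp only [mem_union, mem_filter, mem_univ, true_and, mem_diag, mem_product, and_true]
    tauto
  have h1 := (card_le_card h).trans ((card_union_le _ _).trans (Nat.add_le_add_left
    ((card_union_le _ _).trans (Nat.add_le_add_left (card_union_le _ _) _)) _))
  simp only [diag_card, card_product, card_univ, Fintype.card_prod] at h1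
  have h2 : (_ : ℝ) ≤ _ := Nat.cast_le.2 h1
  push_cast at h2
  have h3 : (#J : ℝ) * Fintype.card ι ≤ r * Fintype.card ι := by gcongr
  nlinarith

lemma dens_injective_fst {ι M κ : Type} [Fintype ι] [DecidableEq ι] [Fintype M] [Fintype κ] [DecidableEq κ]
    {d : ℝ}
    (hd : (Fintype.card κ : ℝ) ^ 2 ≤ d * Fintype.card ι) (hι : 0 < Fintype.card ι) :
    Dens (1 - d) fun σ : κ → ι × M => Function.Injective fun i => (σ i).1 := by
  have h1 : Dens (1 - d) fun x : κ → ι => True ∧ Function.Injective x :=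
    (Dens.of_forall fun _ => trivial).injective_of_le hd hι
  have h2 := h1.prod (P' := fun _ (_ : κ → M) => True) zero_le_one
    fun _ _ => Dens.of_forall fun _ => trivial
  rw [mul_one] at h2
  exact (h2.equiv (Equiv.arrowProdEquivProdArrow κ (fun _ => ι) (fun _ => M))).mono
    fun σ hσ => hσ.1.2

section
variable {ι A M : Type} [Fintype ι] [DecidableEq ι] [Fintype A] [DecidableEq A] [Fintype M]
  [DecidableEq M] {k : ℕ} {θ : ℝ} {E : Finset (Finset (A × M))}

/-- In a random sample, a given set has almost as large a degree as in the whole. -/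
lemma PairDense.dens_sample_degree (h : PairDense k θ E) (hθ : 0 ≤ θ) (hθ1 : θ ≤ 1) {δ : ℝ}
    (hδ : 0 < δ) (hA : 0 < Fintype.card A) (hM : 0 < Fintype.card M) (hι : 0 < Fintype.card ι)
    (hkι : 2 * k + 1 ≤ δ * Fintype.card ι) {S : Finset (ι × M)} (hS : #S = k - 2) :
    Dens (1 - 4 / (δ ^ 2 * Fintype.card ι)) fun ω : ι → A => Function.Injective ω →
      (θ - 2 * δ) * (Fintype.card (ι × M) : ℝ) ^ 2 ≤
        #{p : (ι × M) × (ι × M) | (p.1.1 ≠ p.2.1 ∧ p.1.1 ∉ S.image Prod.fst ∧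
          p.2.1 ∉ S.image Prod.fst) ∧
          insert (lift ω p.1) (insert (lift ω p.2) (S.image (lift ω))) ∈ E} := by
  set J := S.image Prod.fst with hJ
  have hM' : (0 : ℝ) < Fintype.card M := Nat.cast_pos.2 hM
  have hA' : (0 : ℝ) < Fintype.card A := Nat.cast_pos.2 hA
  have hι' : (0 : ℝ) < Fintype.card ι := Nat.cast_pos.2 hι
  let f : (ι → A) → A → A → ℝ := fun ω a b =>
    (#{ij : M × M | insert (a, ij.1) (insert (b, ij.2) (S.image (lift ω))) ∈ E} : ℝ) /
      (Fintype.card M : ℝ) ^ 2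
  have hf := dens_sum_pairs (f := f) (fun ω a b => by positivity) (fun ω a b => by
      rw [div_le_one (by positivity), sq, ← Nat.cast_mul, ← Fintype.card_prod]
      exact Nat.cast_le.2 (card_le_univ _)) (J := J) (fun ω p a hp => by
      have : S.image (lift (Function.update ω p a)) = S.image (lift ω) :=
        image_congr fun x hx => by
          have : x.1 ≠ p := fun hxp => hp (hxp ▸ mem_image_of_mem _ hx)
          simp [lift, Prod.map, this]
      simp only [f, this]) hδ hι hA
  refine hf.mono fun ω hω hinj => ?_
  have h1 : θ ≤ (∑ a, ∑ b, f ω a b) / (Fintype.card A : ℝ) ^ 2 := by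
    have h2 := h.dens (S.image (lift ω)) (by
      rw [card_image_of_injective _ (lift_injective hinj), hS])
    rw [dens_iff, card_filter_prodProdProdComm
      (fun x y => insert x (insert y (S.image (lift ω))) ∈ E)] at h2
    rw [le_div_iff₀ (by positivity)]
    simp only [f, ← sum_div]
    rw [le_div_iff₀ (by positivity)]
    simp only [Fintype.card_prod, Nat.cast_mul, Nat.cast_sum, Fintype.sum_prod_type] at h2
    refine le_trans (le_of_eq ?_) h2
    ring
  have h2 : ∑ d : ι × ι with d.1 ≠ d.2 ∧ d.1 ∉ J ∧ d.2 ∉ J, f ω (ω d.1) (ω d.2) =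
      (#{p : (ι × M) × (ι × M) | (p.1.1 ≠ p.2.1 ∧ p.1.1 ∉ J ∧ p.2.1 ∉ J) ∧
        insert (lift ω p.1) (insert (lift ω p.2) (S.image (lift ω))) ∈ E} : ℝ) /
        (Fintype.card M : ℝ) ^ 2 := by
    rw [card_filter_prodProdProdComm (A := ι) (M := M) (fun x y => (x.1 ≠ y.1 ∧ x.1 ∉ J ∧ y.1 ∉ J) ∧
      insert (lift ω x) (insert (lift ω y) (S.image (lift ω))) ∈ E), Nat.cast_sum, sum_div,
      sum_filter]
    refine sum_congr rfl fun d _ => ?_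
    split_ifs with hd
    · rw [filter_congr fun x _ => and_iff_right hd]
      rfl
    · simp only [hd, false_and, filter_false, card_empty, Nat.cast_zero, zero_div]
  have h3 := le_card_pairs (J := J) (r := k) (card_image_le.trans (hS.le.trans (Nat.sub_le _ _)))
  rw [h2, le_div_iff₀ (by positivity)] at hω
  refine le_trans ?_ hω
  rw [Fintype.card_prod, Nat.cast_mul, mul_pow, ← mul_assoc]
  refine mul_le_mul_of_nonneg_right ?_ (sq_nonneg _)
  have h4 := mul_le_mul h3 h1 hθ (Nat.cast_nonneg _)
  have h5 : (2 * k + 1) * (Fintype.card ι : ℝ) ≤ δ * Fintype.card ι ^ 2 := by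
    rw [sq, ← mul_assoc]
    gcongr
  have h6 : (2 * k + 1) * (Fintype.card ι : ℝ) * θ ≤ δ * Fintype.card ι ^ 2 * 1 :=
    mul_le_mul h5 hθ1 hθ (by positivity)
  linarith

/-- The hypergraph on a sample, without the edges using two vertices of the same fibre. -/
def sampled (E : Finset (Finset (A × M))) (ω : ι → A) : Finset (Finset (ι × M)) :=
  univ.filter fun e => #(e.image Prod.fst) = #e ∧ e.image (lift ω) ∈ E

/-- Every large set of vertices contains a `(k-2)`-set of large degree. -/
def Rich {U : Type} [Fintype U] [DecidableEq U] (k : ℕ) (c η : ℝ) (G : Finset (Finset U)) : Prop :=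
  ∀ Λ : Finset U, η * Fintype.card U ≤ #Λ → ∃ S ⊆ Λ, #S = k - 2 ∧
    c * (Fintype.card U : ℝ) ^ 2 ≤ #{p : U × U | insert p.1 (insert p.2 S) ∈ G}

lemma dens_forall_mem {κ U : Type} [Fintype κ] [DecidableEq κ] [Fintype U] {Λ : Finset U} {η : ℝ}
    (hη : 0 ≤ η) (hΛ : η * Fintype.card U ≤ #Λ) :
    Dens (η ^ Fintype.card κ) fun σ : κ → U => ∀ i, σ i ∈ Λ := by
  classical
  rw [dens_iff]
  have : ({σ : κ → U | ∀ i, σ i ∈ Λ} : Finset (κ → U)) = Fintype.piFinset fun _ => Λ := by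
    ext σ
    simp
  rw [this, Fintype.card_piFinset, prod_const, card_univ, Fintype.card_fun, Nat.cast_pow, Nat.cast_pow, ← mul_pow]
  exact pow_le_pow_left₀ (by positivity) hΛ _

/-- Random samples of a pair-dense hypergraph are rich. -/
lemma PairDense.dens_rich (h : PairDense k θ E) (hθ : 0 ≤ θ) (hθ1 : θ ≤ 1) {δ η ν : ℝ}
    (hδ : 0 < δ) (hη : 0 < η) (hA : 0 < Fintype.card A) (hM : 0 < Fintype.card M)
    (hι : 0 < Fintype.card ι) (hkι : 2 * k + 1 ≤ δ * Fintype.card ι)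
    (hkι' : (k : ℝ) ^ 2 ≤ η ^ (k - 2) / 4 * Fintype.card ι)
    (hν : 16 / (δ ^ 2 * Fintype.card ι) ≤ ν * η ^ (k - 2))
    (hιA : (Fintype.card ι : ℝ) ^ 2 ≤ ν * Fintype.card A) :
    Dens (1 - 2 * ν) fun ω : ι → A => Function.Injective ω ∧
      Rich k (θ - 2 * δ) η (sampled E ω) := by
  have hι' : (0 : ℝ) < Fintype.card ι := Nat.cast_pos.2 hι
  set ξ : ℝ := η ^ (k - 2) / 4 with hξ
  have hξ0 : 0 < ξ := by positivity
  have h1 : ∀ σ : Fin (k - 2) → ι × M, Dens (1 - 4 / (δ ^ 2 * Fintype.card ι)) fun ω : ι → A =>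
      (Function.Injective fun i => (σ i).1) → Function.Injective ω →
      (θ - 2 * δ) * (Fintype.card (ι × M) : ℝ) ^ 2 ≤
        #{p : (ι × M) × (ι × M) | insert p.1 (insert p.2 (univ.image σ)) ∈ sampled E ω} := by
    intro σ
    by_cases hσ : Function.Injective fun i => (σ i).1
    · have hσ' : Function.Injective σ := fun i j hij => hσ (congrArg Prod.fst hij)
      have hS : #(univ.image σ) = k - 2 := by
        rw [card_image_of_injective _ hσ', card_univ, Fintype.card_fin]
      refine (h.dens_sample_degree hθ hθ1 hδ hA hM hι hkι hS).mono fun ω hω _ hinj => ?_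
      refine (hω hinj).trans (Nat.cast_le.2 (card_le_card fun p hp => ?_))
      simp only [mem_filter, mem_univ, true_and] at hp ⊢
      obtain ⟨⟨hp1, hp2, hp3⟩, hp4⟩ := hp
      refine mem_filter.2 ⟨mem_univ _, ?_, ?_⟩
      · rw [image_insert, image_insert, card_insert_of_notMem, card_insert_of_notMem hp3,
          card_insert_of_notMem, card_insert_of_notMem, image_image]
        · rw [hS]
          change #(univ.image fun i => (σ i).1) + 1 + 1 = _
          rw [card_image_of_injective _ hσ, card_univ, Fintype.card_fin]
        · exact fun h' => hp3 (mem_image_of_mem _ h')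
        · rw [mem_insert]
          rintro (h' | h')
          · exact hp1 (congrArg Prod.fst h')
          · exact hp2 (mem_image_of_mem _ h')
        · rw [mem_insert]
          rintro (h' | h')
          · exact hp1 h'
          · exact hp2 h'
      · rwa [image_insert, image_insert]
    · exact ((Dens.of_forall fun _ => trivial).mono_left (c := 1) (by
        have : 0 ≤ 4 / (δ ^ 2 * (Fintype.card ι : ℝ)) := by positivity
        linarith)).mono fun ω _ h' => absurd h' hσ
  have hU : 0 < Fintype.card (Fin (k - 2) → ι × M) := by
    have : Nonempty (ι × M) := Fintype.card_pos_iff.1 (by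
      rw [Fintype.card_prod]
      positivity)
    exact Fintype.card_pos
  have h2 := Dens.swap (b := 1 - ξ) (by linarith) hU h1
  have h3 : Dens (1 - ν) fun ω : ι → A => True ∧ Function.Injective ω :=
    (Dens.of_forall fun _ => trivial).injective_of_le hιA hA
  refine ((h2.and h3).mono_left ?_).mono ?_
  · have : 4 / (δ ^ 2 * (Fintype.card ι : ℝ)) ≤ ν * ξ := by
      have h4 : 16 / (δ ^ 2 * (Fintype.card ι : ℝ)) = 4 * (4 / (δ ^ 2 * (Fintype.card ι : ℝ))) := by
        ring
      rw [h4] at hν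
      rw [hξ]
      linarith
    have h5 : 1 - ν ≤ (1 - 4 / (δ ^ 2 * (Fintype.card ι : ℝ)) - (1 - ξ)) / (1 - (1 - ξ)) := by
      rw [le_div_iff₀ (by linarith)]
      linarith
    linarith
  rintro ω ⟨hω, -, hinj⟩
  refine ⟨hinj, fun Λ hΛ => ?_⟩
  have h4 := dens_forall_mem (κ := Fin (k - 2)) hη.le hΛ
  rw [Fintype.card_fin] at h4
  have h5 : Dens (1 - ξ) fun σ : Fin (k - 2) → ι × M => Function.Injective fun i => (σ i).1 :=
    dens_injective_fst (by
      rw [Fintype.card_fin]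
      refine le_trans ?_ hkι'
      gcongr
      exact_mod_cast Nat.sub_le k 2) hι
  have : Nonempty (Fin (k - 2) → ι × M) := Fintype.card_pos_iff.1 hU
  obtain ⟨σ, ⟨hσ1, hσ2⟩, hσ3⟩ := ((h4.and h5).and hω).exists_mem (by
    have : η ^ (k - 2) = 4 * ξ := by rw [hξ]; ring
    linarith)
  refine ⟨univ.image σ, fun x hx => ?_, ?_, hσ3 hσ2 hinj⟩
  · obtain ⟨i, -, rfl⟩ := mem_image.1 hx
    exact hσ1 i
  · rw [card_image_of_injective _ fun i j hij => hσ2 (congrArg Prod.fst hij), card_univ,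
      Fintype.card_fin]

end

section
variable {U : Type} [Fintype U] [DecidableEq U] {k ℓ : ℕ} {G : Finset (Finset U)}

/-- The edges of `G` with a partition into a first end, a middle, and a last end. -/
def orientedEdges (k ℓ : ℕ) (G : Finset (Finset U)) : Finset (Finset U × Finset U × Finset U) :=
  univ.filter fun o => (#o.1 = ℓ ∧ #o.2.1 = k - 2 * ℓ ∧ #o.2.2 = ℓ) ∧
    (Disjoint o.1 o.2.1 ∧ Disjoint o.1 o.2.2 ∧ Disjoint o.2.1 o.2.2) ∧ o.1 ∪ o.2.1 ∪ o.2.2 ∈ G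

/-- Vertices of the middle of an oriented edge have weight two, those of the ends weight one. -/
def edgeWeight (o : Finset U × Finset U × Finset U) (v : U) : ℕ :=
  (if v ∈ o.1 then 1 else 0) + (if v ∈ o.2.1 then 2 else 0) + (if v ∈ o.2.2 then 1 else 0)

lemma sum_edgeWeight_mul (o : Finset U × Finset U × Finset U) (y : U → ℕ) :
    ∑ v, edgeWeight o v * y v = ∑ v ∈ o.1, y v + 2 * ∑ v ∈ o.2.1, y v + ∑ v ∈ o.2.2, y v := by
  simp only [edgeWeight, add_mul, ite_mul, one_mul, zero_mul, sum_add_distrib, sum_ite_mem,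
    univ_inter, mul_sum]

lemma edgeWeight_le_two {o : Finset U × Finset U × Finset U} (ho : o ∈ orientedEdges k ℓ G)
    (v : U) : edgeWeight o v ≤ 2 := by
  obtain ⟨-, -, ⟨h1, h2, h3⟩, -⟩ := mem_filter.1 ho
  rw [disjoint_left] at h1 h2 h3
  have h1 := @h1 v
  have h2 := @h2 v
  have h3 := @h3 v
  unfold edgeWeight
  split_ifs <;> first | omega | (exfalso; tauto)

lemma sum_edgeWeight {o : Finset U × Finset U × Finset U} (hl : 2 * ℓ < k)
    (ho : o ∈ orientedEdges k ℓ G) : ∑ v, edgeWeight o v = 2 * (k - ℓ) := by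
  obtain ⟨-, ⟨h1, h2, h3⟩, -⟩ := mem_filter.1 ho
  have h := sum_edgeWeight_mul o fun _ => 1
  simp only [mul_one, sum_const, smul_eq_mul, h1, h2, h3] at h
  omega

/-- A pair and a `(k-2)`-set forming an edge yield an oriented edge with the pair in its ends. -/
lemma exists_orientedEdge (hℓ : 1 ≤ ℓ) (hl : 2 * ℓ < k) (hG : ∀ e ∈ G, #e = k) {S : Finset U}
    (hS : #S = k - 2) {u v : U} (he : insert u (insert v S) ∈ G) :
    ∃ o ∈ orientedEdges k ℓ G, ∀ (y : U → ℕ) (l : ℕ), (∀ w ∈ S, y w ≤ l) →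
      ∑ w, edgeWeight o w * y w ≤ y u + y v + (2 * (k - ℓ) - 2) * l := by
  obtain ⟨X, hX, hXc⟩ := exists_subset_card_eq (show ℓ - 1 ≤ #S by omega)
  obtain ⟨M, hM, hMc⟩ := exists_subset_card_eq (s := S \ X) (n := k - 2 * ℓ) (by
    rw [card_sdiff_of_subset hX]
    omega)
  have hYc : #((S \ X) \ M) = ℓ - 1 := by
    rw [card_sdiff_of_subset hM, card_sdiff_of_subset hX]
    omega
  have hu : insert u X ∪ M ∪ insert v ((S \ X) \ M) = insert u (insert v S) := by
    ext w
    have h1 := @hX w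
    have h2 := @hM w
    simp only [mem_union, mem_insert, mem_sdiff] at *
    tauto
  have hins : ∀ (w : U) (T : Finset U), #(insert w T) ≤ #T + 1 := fun w T => card_insert_le w T
  have hc := conn_of_card_le hl hG (X := insert u X) (M := M) (Y := insert v ((S \ X) \ M))
    ((hins _ _).trans (by omega)) hMc.le ((hins _ _).trans (by omega)) (hu ▸ he)
  refine ⟨(insert u X, M, insert v ((S \ X) \ M)), mem_filter.2 ⟨mem_univ _,
    ⟨hc.card_left, hMc, hc.card_right⟩, hc.disjoint, hu ▸ he⟩, fun y l hy => ?_⟩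
  rw [sum_edgeWeight_mul]
  have h1 : ∀ (w : U) (T : Finset U), T ⊆ S → ∑ a ∈ insert w T, y a ≤ y w + #T * l := by
    intro w T hT
    have h2 : ∑ a ∈ T, y a ≤ #T * l := sum_le_card_nsmul _ _ _ fun a ha => hy a (hT ha)
    by_cases hw : w ∈ T
    · rw [insert_eq_of_mem hw]
      omega
    · rw [sum_insert hw]
      omega
  have h2 := h1 u X hX
  have h3 := h1 v ((S \ X) \ M) (sdiff_subset.trans sdiff_subset)
  have h4 : ∑ a ∈ M, y a ≤ #M * l :=
    sum_le_card_nsmul _ _ _ fun a ha => hy a (sdiff_subset (hM ha))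
  rw [hXc] at h2
  rw [hYc] at h3
  rw [hMc] at h4
  have h5 : 2 * (k - ℓ) - 2 = (ℓ - 1) + 2 * (k - 2 * ℓ) + (ℓ - 1) := by omega
  rw [h5]
  simp only
  linarith

/-- A rich hypergraph has a nearly perfect fractional family of oriented edges. -/
lemma Rich.exists_family {c η κ : ℝ} {q : ℕ} (hℓ : 1 ≤ ℓ) (hl : 2 * ℓ < k)
    (hG : ∀ e ∈ G, #e = k) (h : Rich k c η G)
    (hc : 2 * (1 / (2 * (k - ℓ) : ℕ) : ℝ) - (1 / (2 * (k - ℓ) : ℕ) : ℝ) ^ 2 < c)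
    (hU : 0 < Fintype.card U) (hη : 0 < η) (hη' : η ≤ 1 / 2) (hκ : 0 ≤ κ) (hκ' : 3 * η ≤ κ ^ 2)
    (hq : 2 ≤ η * q) :
    ∃ (F : Fin (Fintype.card U * q) → Finset U × Finset U × Finset U)
      (I : Finset (Fin (Fintype.card U * q))), (∀ t, F t ∈ orientedEdges k ℓ G) ∧
      (1 - κ * (2 * (k - ℓ) : ℕ)) * (Fintype.card U * q : ℝ) ≤ #I ∧
      ∀ v, load edgeWeight F I v ≤ 2 * (k - ℓ) * q := by
  have hU' : (0 : ℝ) < Fintype.card U := Nat.cast_pos.2 hU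
  have H : ∀ Λ : Finset U, η * Fintype.card U ≤ #Λ → ∃ P : Finset (U × U),
      (2 * (1 / (2 * (k - ℓ) : ℕ) : ℝ) - (1 / (2 * (k - ℓ) : ℕ) : ℝ) ^ 2) *
        (Fintype.card U : ℝ) ^ 2 < #P ∧ ∀ p ∈ P, ∃ o : orientedEdges k ℓ G,
        ∀ (y : U → ℕ) (l : ℕ), (∀ w ∈ Λ, y w ≤ l) → ∑ v, edgeWeight o.1 v * y v ≤
          y p.1 + y p.2 + (2 * (k - ℓ) - 2) * l := by
    intro Λ hΛ
    obtain ⟨S, hSΛ, hS, hP⟩ := h Λ hΛ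
    refine ⟨univ.filter fun p => insert p.1 (insert p.2 S) ∈ G,
      lt_of_lt_of_le (mul_lt_mul_of_pos_right hc (by positivity)) hP, fun p hp => ?_⟩
    obtain ⟨o, ho, h1⟩ := exists_orientedEdge hℓ hl hG hS (mem_filter.1 hp).2
    exact ⟨⟨o, ho⟩, fun y l hy => h1 y l fun w hw => hy w (hSΛ hw)⟩
  have : Nonempty (orientedEdges k ℓ G) := by
    obtain ⟨P, hP, h1⟩ := H univ (by
      rw [card_univ]
      nlinarith)
    have h2 : (0 : ℝ) ≤ 2 * (1 / (2 * (k - ℓ) : ℕ) : ℝ) - (1 / (2 * (k - ℓ) : ℕ) : ℝ) ^ 2 := by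
      have h3 : (1 / (2 * (k - ℓ) : ℕ) : ℝ) ≤ 1 := by
        rw [div_le_one (Nat.cast_pos.2 (by omega))]
        exact_mod_cast (by omega)
      have h4 : (0 : ℝ) ≤ (1 / (2 * (k - ℓ) : ℕ) : ℝ) := by positivity
      nlinarith
    obtain ⟨p, hp⟩ := card_pos.1 (Nat.cast_pos.1 (lt_of_le_of_lt (by positivity) hP))
    exact ⟨(h1 p hp).choose⟩
  obtain ⟨F, I, hI, hF⟩ := exists_balanced_family
    (fun o : orientedEdges k ℓ G => edgeWeight o.1) (by omega) (fun o v => edgeWeight_le_two o.2 v)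
    (fun o => sum_edgeWeight hl o.2) hη hη' hκ hκ' hq H
  exact ⟨fun t => (F t).1, I, fun t => (F t).2, hI, hF⟩

end

/-- The edges of a sample have the right size. -/
lemma PairDense.card_sampled {ι A M : Type} [Fintype ι] [DecidableEq ι] [Fintype A]
    [DecidableEq A] [Fintype M] [DecidableEq M] {k : ℕ} {θ : ℝ} {E : Finset (Finset (A × M))}
    (h : PairDense k θ E) {ω : ι → A} (hω : Function.Injective ω) {e : Finset (ι × M)}
    (he : e ∈ sampled E ω) : #e = k := by
  rw [← h.card_eq _ (mem_filter.1 he).2.2, card_image_of_injective _ (lift_injective hω)]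

section
variable {U V : Type} [DecidableEq U] [DecidableEq V] {k ℓ : ℕ} {E : Finset (Finset V)}

lemma Conn.card_trans {X Y Z I J : Finset V} (h₁ : Conn k ℓ E X I Y) (h₂ : Conn k ℓ E Y J Z)
    (hd : Disjoint (X ∪ I) (J ∪ Z)) : #(I ∪ Y ∪ J) = #I + ℓ + #J := by
  have h3 : Disjoint (I ∪ Y) J := disjoint_union_left.2
    ⟨hd.mono subset_union_right subset_union_left, h₂.disjoint.1⟩
  rw [card_union_of_disjoint h3, card_union_of_disjoint h₁.disjoint.2.2, h₁.card_right]

/-- Copies of an oriented edge, with doubled middle, can be strung together. -/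
lemma exists_long_conn (hl : 2 * ℓ < k) (hE : ∀ e ∈ E, #e = k) {X M Y : Finset U}
    (hX : #X ≤ ℓ) (hM : #M ≤ k - 2 * ℓ) (hY : #Y ≤ ℓ) {T : Fin 2 → Finset U}
    (hT : X ∪ M ∪ Y ⊆ T 0) (hT' : M ⊆ T 1) {h : ℕ} {z : ℕ → Fin 2 → U → V}
    (hz : ∀ a ≤ h, ∀ a' ≤ h, ∀ c c' v v', z a c v = z a' c' v' → v ∈ T c → v' ∈ T c' →
      a = a' ∧ c = c')
    (h₁ : ∀ a ≤ h, X.image (z a 0) ∪ M.image (z a 0) ∪ Y.image (z a 0) ∈ E)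
    (h₂ : ∀ a < h, Y.image (z a 0) ∪ M.image (z a 1) ∪ X.image (z (a + 1) 0) ∈ E) :
    ∀ b, 1 ≤ b → b ≤ h → ∃ I, Conn k ℓ E (X.image (z 0 0)) I (X.image (z b 0)) ∧
      #I + ℓ = 2 * b * (k - ℓ) ∧
      ∀ w ∈ X.image (z 0 0) ∪ I, ∃ a < b, ∃ c, ∃ v ∈ T c, w = z a c v := by
  have hX0 : X ⊆ T 0 := (subset_union_left.trans subset_union_left).trans hT
  have hM0 : M ⊆ T 0 := (subset_union_right.trans subset_union_left).trans hT
  have hY0 : Y ⊆ T 0 := subset_union_right.trans hT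
  have hd : ∀ a ≤ h, ∀ a' ≤ h, ∀ c c', (a, c) ≠ (a', c') → ∀ Q ⊆ T c, ∀ Q' ⊆ T c',
      Disjoint (Q.image (z a c)) (Q'.image (z a' c')) := by
    intro a ha a' ha' c c' hne Q hQ Q' hQ'
    rw [disjoint_left]
    intro w hw hw'
    obtain ⟨v, hv, rfl⟩ := mem_image.1 hw
    obtain ⟨v', hv', hvv⟩ := mem_image.1 hw'
    obtain ⟨rfl, rfl⟩ := hz _ ha _ ha' _ _ _ _ hvv.symm (hQ hv) (hQ' hv')
    exact hne rfl
  have step : ∀ a < h, ∃ J, Conn k ℓ E (X.image (z a 0)) J (X.image (z (a + 1) 0)) ∧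
      #J + ℓ = 2 * (k - ℓ) ∧
      ∀ w ∈ X.image (z a 0) ∪ J, ∃ c, ∃ v ∈ T c, w = z a c v := by
    intro a ha
    have c1 := conn_of_card_le hl hE (card_image_le.trans hX) (card_image_le.trans hM)
      (card_image_le.trans hY) (h₁ a ha.le)
    have c2 := conn_of_card_le hl hE (card_image_le.trans hY) (card_image_le.trans hM)
      (card_image_le.trans hX) (h₂ a ha)
    have hdis : Disjoint (X.image (z a 0) ∪ M.image (z a 0))
        (M.image (z a 1) ∪ X.image (z (a + 1) 0)) := by
      have e1 : (a, (0 : Fin 2)) ≠ (a, 1) := by simp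
      have e2 : (a, (0 : Fin 2)) ≠ (a + 1, 0) := by simp
      simp only [disjoint_union_left, disjoint_union_right]
      exact ⟨⟨hd a ha.le a ha.le 0 1 e1 X hX0 M hT', hd a ha.le a ha.le 0 1 e1 M hM0 M hT'⟩,
        ⟨hd a ha.le (a + 1) ha 0 0 e2 X hX0 X hX0, hd a ha.le (a + 1) ha 0 0 e2 M hM0 X hX0⟩⟩
    refine ⟨_, Conn.trans c1 c2 hdis, ?_, ?_⟩
    · have e1 := hE _ (h₁ a ha.le)
      have e2 := hE _ (h₂ a ha)
      rw [card_union_of_disjoint (disjoint_union_left.2 c1.disjoint.2),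
        card_union_of_disjoint c1.disjoint.1, c1.card_left, c1.card_right] at e1
      rw [card_union_of_disjoint (disjoint_union_left.2 c2.disjoint.2),
        card_union_of_disjoint c2.disjoint.1, c2.card_left, c2.card_right] at e2
      rw [c1.card_trans c2 hdis]
      omega
    · intro w hw
      simp only [mem_union, mem_image] at hw
      obtain ⟨v, hv, rfl⟩ | (⟨v, hv, rfl⟩ | ⟨v, hv, rfl⟩) | ⟨v, hv, rfl⟩ := hw
      exacts [⟨0, v, hX0 hv, rfl⟩, ⟨0, v, hM0 hv, rfl⟩, ⟨0, v, hY0 hv, rfl⟩, ⟨1, v, hT' hv, rfl⟩]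
  intro b hb
  induction b, hb using Nat.le_induction with
  | base =>
    intro hh
    obtain ⟨J, h3, h4, h5⟩ := step 0 hh
    exact ⟨J, h3, by simpa using h4, fun w hw => ⟨0, Nat.one_pos, h5 w hw⟩⟩
  | succ b hb ih =>
    intro hh
    obtain ⟨I, h3, h4, h5⟩ := ih (by omega)
    obtain ⟨J, h6, h7, h8⟩ := step b hh
    have hdis : Disjoint (X.image (z 0 0) ∪ I) (J ∪ X.image (z (b + 1) 0)) := by
      rw [disjoint_left]
      intro w hw hw'
      obtain ⟨a, ha, c, v, hv, rfl⟩ := h5 w hw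
      rcases mem_union.1 hw' with hw' | hw'
      · obtain ⟨c', v', hv', h9⟩ := h8 _ (mem_union_right _ hw')
        have := (hz a (by omega) b (by omega) _ _ _ _ h9 hv hv').1
        omega
      · obtain ⟨v', hv', h9⟩ := mem_image.1 hw'
        have := (hz (b + 1) hh a (by omega) _ _ _ _ h9 (hX0 hv') hv).1
        omega
    refine ⟨_, Conn.trans h3 h6 hdis, ?_, ?_⟩
    · rw [h3.card_trans h6 hdis]
      have : 2 * (b + 1) * (k - ℓ) = 2 * b * (k - ℓ) + 2 * (k - ℓ) := by ring
      omega
    · intro w hw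
      by_cases h9 : w ∈ X.image (z 0 0) ∪ I
      · obtain ⟨a, ha, h10⟩ := h5 w h9
        exact ⟨a, by omega, h10⟩
      · exact ⟨b, by omega, h8 w (by
          simp only [mem_union] at hw h9 ⊢
          tauto)⟩

end

/-- Bounded loads allow to assign private slots to the members of a family. -/
lemma exists_slots {U O N : Type} [LinearOrder N] [Fintype N] (wt : O → U → ℕ) (F : N → O)
    (I : Finset N) {n : ℕ} (hn : 0 < n) (h : ∀ v, load wt F I v ≤ n) :
    ∃ slot : U → N → ℕ → Fin n, ∀ v, ∀ t ∈ I, ∀ t' ∈ I, ∀ c < wt (F t) v, ∀ c' < wt (F t') v,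
      slot v t c = slot v t' c' → t = t' ∧ c = c' := by
  classical
  let p : U → N → ℕ := fun v t => load wt F (I.filter (· < t)) v
  have hp : ∀ v, ∀ t ∈ I, ∀ J : Finset N, t ∉ J → I.filter (· < t) ⊆ J → p v t + wt (F t) v ≤
      load wt F (insert t J) v := by
    intro v t ht J hJ hIJ
    unfold load
    rw [sum_insert hJ, add_comm]
    exact Nat.add_le_add_left (sum_le_sum_of_subset hIJ) _
  have hlt : ∀ v, ∀ t ∈ I, ∀ c < wt (F t) v, p v t + c < n := by
    intro v t ht c hc
    have h1 := hp v t ht (I.erase t) (notMem_erase t I) fun a ha => by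
      rw [mem_filter] at ha
      exact mem_erase.2 ⟨ha.2.ne, ha.1⟩
    rw [insert_erase ht] at h1
    have := h v
    omega
  have hmono : ∀ v, ∀ t ∈ I, ∀ t' ∈ I, t < t' → p v t + wt (F t) v ≤ p v t' := by
    intro v t ht t' ht' htt
    refine (hp v t ht (I.filter (· < t)) (by simp) subset_rfl).trans
      (sum_le_sum_of_subset (insert_subset (mem_filter.2 ⟨ht, htt⟩) fun a ha => ?_))
    rw [mem_filter] at ha ⊢
    exact ⟨ha.1, ha.2.trans htt⟩
  refine ⟨fun v t c => if hlt : p v t + c < n then ⟨p v t + c, hlt⟩ else ⟨0, hn⟩, ?_⟩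
  intro v t ht t' ht' c hc c' hc' heq
  simp only [dif_pos (hlt v t ht c hc), dif_pos (hlt v t' ht' c' hc'), Fin.mk.injEq] at heq
  rcases lt_trichotomy t t' with htt | rfl | htt
  · have := hmono v t ht t' ht' htt
    omega
  · exact ⟨rfl, by omega⟩
  · have := hmono v t' ht' t ht htt
    omega

section
variable {ι A M B : Type} [Fintype ι] [DecidableEq ι] [DecidableEq A] [Fintype M]
  [DecidableEq M] {k ℓ : ℕ} {E : Finset (Finset (A × M))} {G : Finset (Finset (ι × M))}

/-- If all transversals of a blow-up look like `G`, then edges of `G` can be copied using arbitrary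
clones of their vertices. -/
lemma image_clone_mem [Nonempty B] {x : ι × B → A}
    (hx : ∀ g : ι → B, sampled E (fun i => x (i, g i)) = G) {e : Finset (ι × M)} (he : e ∈ G)
    (b : ι × M → B) : e.image (fun v => (x (v.1, b v), v.2)) ∈ E := by
  classical
  have hinj : Set.InjOn Prod.fst (e : Set (ι × M)) := by
    rw [← hx fun _ => Classical.arbitrary B] at he
    exact card_image_iff.1 (mem_filter.1 he).2.1
  let g : ι → B := fun i => if h : ∃ v ∈ e, v.1 = i then b h.choose else Classical.arbitrary B
  have hg : ∀ v ∈ e, g v.1 = b v := by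
    intro v hv
    have h : ∃ w ∈ e, w.1 = v.1 := ⟨v, hv, rfl⟩
    simp only [g, dif_pos h]
    rw [hinj h.choose_spec.1 hv h.choose_spec.2]
  rw [← hx g] at he
  convert (mem_filter.1 he).2.2 using 1
  refine image_congr fun v hv => ?_
  simp only [lift, Prod.map, hg v hv, id]

/-- An oriented edge of `G` yields long connections using private slots. -/
lemma exists_clone_tile (hl : 2 * ℓ < k) (hE : ∀ e ∈ E, #e = k) {K : Type} [Nonempty K] {h : ℕ}
    (hh : 1 ≤ h) {x : ι × (K × Fin (h + 1)) → A} (hinj : Function.Injective x)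
    (hx : ∀ g : ι → K × Fin (h + 1), sampled E (fun i => x (i, g i)) = G)
    {o : Finset (ι × M) × Finset (ι × M) × Finset (ι × M)} (ho : o ∈ orientedEdges k ℓ G)
    {slot : ι × M → ℕ → K}
    (hs : ∀ v, ∀ c < edgeWeight o v, ∀ c' < edgeWeight o v, slot v c = slot v c' → c = c') :
    ∃ X I Y, Conn k ℓ E X I Y ∧ #(X ∪ I ∪ Y) = 2 * h * (k - ℓ) + ℓ ∧
      ∀ w ∈ X ∪ I ∪ Y, ∃ v, ∃ c < edgeWeight o v, ∃ a, w = (x (v.1, (slot v c, a)), v.2) := by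
  obtain ⟨X, M', Y⟩ := o
  obtain ⟨-, ⟨h1, h2, h3⟩, ⟨h4, h5, h6⟩, he⟩ := mem_filter.1 ho
  dsimp only at h1 h2 h3 h4 h5 h6 he
  let z : ℕ → Fin 2 → ι × M → A × M :=
    fun a c v => (x (v.1, (slot v c, Fin.ofNat (h + 1) a)), v.2)
  let T : Fin 2 → Finset (ι × M) := fun c => univ.filter fun v => (c : ℕ) < edgeWeight (X, M', Y) v
  have hT : X ∪ M' ∪ Y ⊆ T 0 := fun v hv => mem_filter.2 ⟨mem_univ _, by
    simp only [mem_union] at hv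
    rcases hv with (hv | hv) | hv <;> simp [edgeWeight, hv]⟩
  have hT' : M' ⊆ T 1 := fun v hv => mem_filter.2 ⟨mem_univ _, by
    simp only [edgeWeight, hv, if_true, Fin.coe_ofNat_eq_mod]
    omega⟩
  have hz : ∀ a ≤ h, ∀ a' ≤ h, ∀ c c' v v', z a c v = z a' c' v' → v ∈ T c → v' ∈ T c' →
      a = a' ∧ c = c' := by
    intro a ha a' ha' c c' v v' heq hv hv'
    simp only [z, Prod.mk.injEq] at heq
    obtain ⟨h7, h8⟩ := heq
    have h9 := hinj h7
    simp only [Prod.mk.injEq] at h9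
    obtain ⟨h9, h10, h11⟩ := h9
    obtain rfl : v = v' := Prod.ext h9 h8
    refine ⟨?_, Fin.ext (hs v c (mem_filter.1 hv).2 c' (mem_filter.1 hv').2 h10)⟩
    have h12 := congrArg Fin.val h11
    simpa [Fin.ofNat, Nat.mod_eq_of_lt (Nat.lt_succ_of_le ha),
      Nat.mod_eq_of_lt (Nat.lt_succ_of_le ha')] using h12
  obtain ⟨I, h7, h8, h9⟩ := exists_long_conn hl hE h1.le h2.le h3.le hT hT' hz (fun a ha => by
      rw [← image_union, ← image_union]
      exact image_clone_mem hx he fun v => (slot v 0, Fin.ofNat (h + 1) a)) (fun a ha => by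
      have := image_clone_mem hx he fun v => if v ∈ X then (slot v 0, Fin.ofNat (h + 1) (a + 1)) else
        if v ∈ M' then (slot v 1, Fin.ofNat (h + 1) a) else (slot v 0, Fin.ofNat (h + 1) a)
      rw [image_union, image_union] at this
      rw [disjoint_right] at h4 h5 h6
      convert this using 1
      rw [union_comm (X.image _), union_comm _ (Y.image _), ← union_assoc]
      congr 1
      · congr 1
        · exact image_congr fun v hv => by simp [z, h5 (mem_coe.1 hv), h6 (mem_coe.1 hv)]
        · exact image_congr fun v hv => by simp [z, mem_coe.1 hv, h4 (mem_coe.1 hv)]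
      · exact image_congr fun v hv => by simp [z, mem_coe.1 hv]) h hh le_rfl
  have hd := h7.disjoint
  refine ⟨_, I, _, h7, ?_, fun w hw => ?_⟩
  · rw [card_union_of_disjoint (disjoint_union_left.2 hd.2), card_union_of_disjoint hd.1,
      h7.card_left, h7.card_right]
    omega
  · rcases mem_union.1 hw with hw | hw
    · obtain ⟨a, -, c, v, hv, rfl⟩ := h9 w hw
      exact ⟨v, c, (mem_filter.1 hv).2, _, rfl⟩
    · obtain ⟨v, hv, rfl⟩ := mem_image.1 hw
      exact ⟨v, 0, (mem_filter.1 (hT (subset_union_left (subset_union_left hv)))).2, _, rfl⟩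

/-- A family of oriented edges of bounded load yields disjoint tiles in the blow-up. -/
lemma exists_clone_tiles (hl : 2 * ℓ < k) (hE : ∀ e ∈ E, #e = k) {n h : ℕ} (hn : 0 < n)
    (hh : 1 ≤ h) {x : ι × (Fin n × Fin (h + 1)) → A} (hinj : Function.Injective x)
    (hx : ∀ g : ι → Fin n × Fin (h + 1), sampled E (fun i => x (i, g i)) = G)
    {N : ℕ} {F : Fin N → Finset (ι × M) × Finset (ι × M) × Finset (ι × M)} {I : Finset (Fin N)}
    (hF : ∀ t, F t ∈ orientedEdges k ℓ G) (hload : ∀ v, load edgeWeight F I v ≤ n) :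
    ∃ 𝒩 : Finset (Finset (A × M)), #𝒩 = #I ∧
      (∀ Q ∈ 𝒩, ∀ Q' ∈ 𝒩, Q ≠ Q' → Disjoint Q Q') ∧
      ∀ Q ∈ 𝒩, #Q = 2 * h * (k - ℓ) + ℓ ∧ (∃ X I Y, Conn k ℓ E X I Y ∧ Q = X ∪ I ∪ Y) ∧
        ∀ w ∈ Q, w.1 ∈ univ.image x := by
  have : Nonempty (Fin n) := ⟨⟨0, hn⟩⟩
  obtain ⟨slot, hslot⟩ := exists_slots edgeWeight F I hn hload
  have h1 : ∀ t ∈ I, ∃ X J Y, Conn k ℓ E X J Y ∧ #(X ∪ J ∪ Y) = 2 * h * (k - ℓ) + ℓ ∧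
      ∀ w ∈ X ∪ J ∪ Y, ∃ v, ∃ c < edgeWeight (F t) v, ∃ a, w = (x (v.1, (slot v t c, a)), v.2) :=
    fun t ht => exists_clone_tile hl hE hh hinj hx (hF t) (slot := fun v => slot v t)
      fun v c hc c' hc' heq => (hslot v t ht t ht c hc c' hc' heq).2
  choose! X J Y hC hcard hmem using h1
  have hdis : ∀ t ∈ I, ∀ t' ∈ I, t ≠ t' → Disjoint (X t ∪ J t ∪ Y t) (X t' ∪ J t' ∪ Y t') := by
    intro t ht t' ht' htt
    rw [disjoint_left]
    intro w hw hw'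
    obtain ⟨v, c, hc, a, rfl⟩ := hmem t ht w hw
    obtain ⟨v', c', hc', a', heq⟩ := hmem t' ht' _ hw'
    simp only [Prod.mk.injEq] at heq
    have h9 := hinj heq.1
    simp only [Prod.mk.injEq] at h9
    obtain rfl : v = v' := Prod.ext h9.1 heq.2
    exact htt (hslot v t ht t' ht' c hc c' hc' h9.2.1).1
  refine ⟨I.image fun t => X t ∪ J t ∪ Y t, card_image_of_injOn fun t ht t' ht' heq => ?_, ?_, ?_⟩
  · by_contra hne
    have h2 := hdis t ht t' ht' hne
    rw [← show X t ∪ J t ∪ Y t = X t' ∪ J t' ∪ Y t' from heq, disjoint_self_iff_empty] at h2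
    have h3 := hcard t ht
    rw [h2, card_empty] at h3
    have h4 : 0 < 2 * h * (k - ℓ) := by
      have : 0 < k - ℓ := by omega
      positivity
    omega
  · simp only [mem_image]
    rintro _ ⟨t, ht, rfl⟩ _ ⟨t', ht', rfl⟩ hne
    exact hdis t ht t' ht' fun h' => hne (by rw [h'])
  · simp only [mem_image]
    rintro _ ⟨t, ht, rfl⟩
    refine ⟨hcard t ht, ⟨_, _, _, hC t ht, rfl⟩, fun w hw => ?_⟩
    obtain ⟨v, c, -, a, rfl⟩ := hmem t ht w hw
    exact ⟨_, mem_univ _, rfl⟩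

end

/-- Some value of a map to a finite type is attained with positive density. -/
lemma Dens.exists_fiber {S Ω : Type} [Fintype S] [Nonempty S] [Fintype Ω] {c : ℝ}
    {P : Ω → Prop} (h : Dens c P) (τ : Ω → S) :
    ∃ s, Dens (c / Fintype.card S) fun ω => P ω ∧ τ ω = s := by
  classical
  by_contra! hcon
  rw [dens_iff] at h
  have h1 : ∀ s ∈ (univ : Finset S), (#{ω | P ω ∧ τ ω = s} : ℝ) <
      c / Fintype.card S * Fintype.card Ω := fun s _ => by
    have := hcon s
    rwa [dens_iff, not_le] at this
  have h2 := sum_lt_sum_of_nonempty univ_nonempty h1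
  have h3 : #{ω | P ω} = ∑ s : S, #{ω | P ω ∧ τ ω = s} := by
    rw [card_eq_sum_card_fiberwise fun ω _ => mem_univ (τ ω)]
    simp only [filter_filter]
  rw [sum_const, card_univ, nsmul_eq_mul, ← Nat.cast_sum, ← h3] at h2
  have h4 : (Fintype.card S : ℝ) ≠ 0 := Nat.cast_ne_zero.2 Fintype.card_ne_zero
  have h5 : (Fintype.card S : ℝ) * (c / Fintype.card S * Fintype.card Ω) = c * Fintype.card Ω := by
    field_simp
  linarith

lemma dens_notMem_half {ι A : Type} [Fintype ι] [DecidableEq ι] [Fintype A] [DecidableEq A]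
    {α : ℝ} (hα : 0 < α) (hα1 : α ≤ 1) {J : Finset A} (hJ : (#J : ℝ) ≤ (1 - α) * Fintype.card A)
    (hA : 0 < Fintype.card A) (hι : 0 < Fintype.card ι) :
    Dens (α / 2) fun ω : ι → A => Dens (α / 2) fun p => ω p ∉ J := by
  have hA' : (0 : ℝ) < Fintype.card A := Nat.cast_pos.2 hA
  have h1 : ∀ p : ι, Dens α fun ω : ι → A => ω p ∉ J := by
    intro p
    have h2 : Dens 1 fun _ : ι → A => True := Dens.of_forall fun _ => trivial
    refine ((h2.and_not (Q := fun ω : ι → A => ω p ∈ J) (d := 1 - α) ?_).mono_left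
      (by linarith)).mono fun ω h => h.2
    have h3 : (_ : ℝ) ≤ _ := Nat.cast_le.2 (card_filter_apply_mem p J)
    push_cast at h3
    have h4 : (#J : ℝ) * Fintype.card (ι → A) ≤
        (1 - α) * Fintype.card A * Fintype.card (ι → A) :=
      mul_le_mul_of_nonneg_right hJ (Nat.cast_nonneg _)
    refine le_of_mul_le_mul_left (h3.trans (h4.trans_eq ?_)) hA'
    ring
  refine (Dens.swap (b := α / 2) (by linarith) hι h1).mono_left ?_
  rw [le_div_iff₀ (by linarith)]
  nlinarith

lemma card_image_clone_inter {ι A K : Type} [Fintype ι] [DecidableEq ι] [Fintype K] [DecidableEq A]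
    {x : ι × K → A} {J : Finset A} {J₀ : Finset ι}
    (hx : ∀ g : ι → K, (univ.filter fun p => x (p, g p) ∈ J) = J₀) :
    #(univ.image x ∩ J) ≤ #J₀ * Fintype.card K := by
  have : univ.image x ∩ J ⊆ (J₀ ×ˢ univ).image x := by
    intro a ha
    obtain ⟨ha1, ha2⟩ := mem_inter.1 ha
    obtain ⟨⟨i, g⟩, -, rfl⟩ := mem_image.1 ha1
    refine mem_image_of_mem _ (mem_product.2 ⟨?_, mem_univ _⟩)
    rw [← hx fun _ => g]
    exact mem_filter.2 ⟨mem_univ _, ha2⟩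
  refine (card_le_card this).trans (card_image_le.trans ?_)
  rw [card_product, card_univ]

lemma retile_count {α s q R h m : ℝ} (hα : 0 < α) (hα1 : α ≤ 1) (hh : 4 ≤ α * h) (hs : 0 < s)
    (hq : 0 < q) (hR : 0 < R) (hm : h * R ≤ m) :
    (1 - α / 2) * s * (R * q * (h + 1)) < (1 - α / 8) * (s * m * q) :=
  calc (1 - α / 2) * s * (R * q * (h + 1)) = (1 - α / 2) * (h + 1) * (s * q * R) := by ring
    _ < (1 - α / 8) * h * (s * q * R) :=
      mul_lt_mul_of_pos_right (by linarith) (by positivity)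
    _ = (1 - α / 8) * (s * (h * R) * q) := by ring
    _ ≤ (1 - α / 8) * (s * m * q) := by
      refine mul_le_mul_of_nonneg_left ?_ (by linarith)
      gcongr

/-- In a pair-dense hypergraph on `A × Fin m`, where a positive proportion of the fibres is not in
`J`, one finds a set `B` of fibres and a family of more than `#(B ∩ J)` disjoint tiles in `B`. -/
lemma exists_retile {k ℓ h : ℕ} {θ α : ℝ} (hℓ : 1 ≤ ℓ) (hl : 2 * ℓ < k)
    (hθ : 2 * (1 / (2 * (k - ℓ) : ℕ) : ℝ) - (1 / (2 * (k - ℓ) : ℕ) : ℝ) ^ 2 < θ) (hθ1 : θ ≤ 1)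
    (hα : 0 < α) (hα1 : α ≤ 1) (hh : 4 ≤ α * h) :
    ∃ n₀ : ℕ, ∀ (A : Type) [Fintype A] [DecidableEq A]
      (E : Finset (Finset (A × Fin (2 * h * (k - ℓ) + ℓ)))), n₀ ≤ Fintype.card A →
      PairDense k θ E → ∀ J : Finset A, (#J : ℝ) ≤ (1 - α) * Fintype.card A →
      ∃ (B : Finset A) (𝒩 : Finset (Finset (A × Fin (2 * h * (k - ℓ) + ℓ)))), #(B ∩ J) < #𝒩 ∧
        (∀ Q ∈ 𝒩, ∀ Q' ∈ 𝒩, Q ≠ Q' → Disjoint Q Q') ∧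
        ∀ Q ∈ 𝒩, #Q = 2 * h * (k - ℓ) + ℓ ∧ (∃ X I Y, Conn k ℓ E X I Y ∧ Q = X ∪ I ∪ Y) ∧
          ∀ w ∈ Q, w.1 ∈ B := by
  set R : ℕ := 2 * (k - ℓ) with hR
  set m : ℕ := 2 * h * (k - ℓ) + ℓ with hm
  have hR1 : 1 ≤ R := by omega
  have hR1' : (1 : ℝ) ≤ R := by exact_mod_cast hR1
  have hR' : (0 : ℝ) < R := by linarith
  have hm0 : 0 < m := by omega
  have hh1 : 1 ≤ h := by
    by_contra h'
    obtain rfl : h = 0 := by omega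
    norm_num at hh
  set thr : ℝ := 2 * (1 / (R : ℝ)) - (1 / (R : ℝ)) ^ 2 with hthr
  have hthr0 : 0 ≤ thr := by
    have h3 : (1 / (R : ℝ)) ≤ 1 := by
      rw [div_le_one hR']
      exact hR1'
    have h4 : (0 : ℝ) ≤ 1 / (R : ℝ) := by positivity
    nlinarith
  have hθ0 : 0 ≤ θ := by linarith
  set κ : ℝ := α / (8 * R) with hκ
  have hκ0 : 0 < κ := by positivity
  have hκR : κ * R = α / 8 := by
    rw [hκ]
    field_simp
  have hκ1 : κ ≤ 1 / 8 := by
    rw [hκ, div_le_iff₀ (by positivity)]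
    linarith
  set η : ℝ := κ ^ 2 / 3 with hη
  have hη0 : 0 < η := by positivity
  have hη1 : η ≤ 1 / 2 := by nlinarith
  obtain ⟨q, hq⟩ := exists_nat_ge (2 / η)
  rw [div_le_iff₀' hη0] at hq
  have hq0 : 0 < q := by
    rcases Nat.eq_zero_or_pos q with rfl | h'
    · norm_num at hq
    · exact h'
  set δ : ℝ := (θ - thr) / 4 with hδ
  have hδ0 : 0 < δ := by
    rw [hδ]
    linarith
  set ν : ℝ := α / 16 with hν
  have hν0 : 0 < ν := by positivity
  obtain ⟨s, hs⟩ := exists_nat_ge ((2 * k + 1) / δ + (k : ℝ) ^ 2 / (η ^ (k - 2) / 4) +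
    16 / (δ ^ 2 * (ν * η ^ (k - 2))) + 1)
  have p1 : 0 ≤ (2 * k + 1) / δ := by positivity
  have p2 : 0 ≤ (k : ℝ) ^ 2 / (η ^ (k - 2) / 4) := by positivity
  have p3 : 0 ≤ 16 / (δ ^ 2 * (ν * η ^ (k - 2))) := by positivity
  have hs0' : (0 : ℝ) < s := by linarith
  have hs0 : 0 < s := Nat.cast_pos.1 hs0'
  have s1 : 2 * k + 1 ≤ δ * s := (div_le_iff₀' hδ0).1 (by linarith)
  have s2 : (k : ℝ) ^ 2 ≤ η ^ (k - 2) / 4 * s := (div_le_iff₀' (by positivity)).1 (by linarith)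
  have s3 : 16 / (δ ^ 2 * s) ≤ ν * η ^ (k - 2) := by
    have : 16 / (δ ^ 2 * (ν * η ^ (k - 2))) ≤ s := by linarith
    rw [div_le_iff₀ (by positivity)] at this ⊢
    linarith
  let S := Finset (Finset (Fin s × Fin m)) × Finset (Fin s)
  let n := R * q
  have hn0 : 0 < n := Nat.mul_pos hR1 hq0
  let b := Fintype.card (Fin n × Fin (h + 1)) ^ Fintype.card (Fin s)
  set c : ℝ := α / 4 / Fintype.card S with hc
  have hS0 : (0 : ℝ) < Fintype.card S := Nat.cast_pos.2 Fintype.card_pos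
  have hc0 : 0 < c := by positivity
  let D : ℕ := Fintype.card (Fin s × (Fin n × Fin (h + 1)))
  obtain ⟨n₀, hn₀⟩ := exists_nat_ge ((s : ℝ) ^ 2 / ν + (D * (D + 1) : ℝ) / (c ^ b / 4) + 1)
  have p4 : 0 ≤ (s : ℝ) ^ 2 / ν := by positivity
  have p5 : 0 ≤ (D * (D + 1) : ℝ) / (c ^ b / 4) := by positivity
  refine ⟨n₀, fun A _ _ E hA hE J hJ => ?_⟩
  have hA' : (n₀ : ℝ) ≤ Fintype.card A := Nat.cast_le.2 hA
  have hA0 : 0 < Fintype.card A := Nat.cast_pos.1 (show (0 : ℝ) < _ by linarith)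
  have a1 : (s : ℝ) ^ 2 ≤ ν * Fintype.card A := (div_le_iff₀' hν0).1 (by linarith)
  have a2 : (D * (D + 1) : ℝ) ≤ c ^ b / 4 * Fintype.card A :=
    (div_le_iff₀' (by positivity)).1 (by linarith)
  have d1 := hE.dens_rich hθ0 hθ1 hδ0 hη0 hA0 (by simpa using hm0) (ι := Fin s) (ν := ν)
    (by simpa using hs0) (by simpa using s1) (by simpa using s2) (by simpa using s3)
    (by simpa using a1)
  have d2 := dens_notMem_half (ι := Fin s) hα hα1 hJ hA0 (by simpa using hs0)
  have d3 := (d1.and d2).mono_left (c' := α / 4) (by rw [hν]; linarith)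
  obtain ⟨⟨G, J₀⟩, d4⟩ := d3.exists_fiber
    fun ω => ((sampled E ω, univ.filter fun p => ω p ∈ J) : S)
  have : Nonempty A := Fintype.card_pos_iff.1 hA0
  obtain ⟨ω₀, ⟨⟨hω₀, hrich⟩, hdens⟩, hτ⟩ := d4.exists_mem hc0
  simp only [Prod.mk.injEq] at hτ
  obtain ⟨rfl, rfl⟩ := hτ
  have d5 := d4.mono (Q := fun ω => sampled E ω = sampled E ω₀ ∧
    (univ.filter fun p => ω p ∈ J) = univ.filter fun p => ω₀ p ∈ J) fun ω hω => by
      simpa only [Prod.mk.injEq] using hω.2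
  obtain ⟨x, ⟨hx, hxinj, -⟩⟩ := (Dens.blowup_injective (B := Fin n × Fin (h + 1)) hc0.le d5 ∅
    (by
      rw [card_empty, Nat.cast_zero, add_zero]
      exact a2) hA0).exists_mem (by positivity)
  have hU : Fintype.card (Fin s × Fin m) = s * m := by simp
  obtain ⟨F, I, hF, hI, hload⟩ := hrich.exists_family hℓ hl (κ := κ) (q := q)
    (fun e he => hE.card_sampled hω₀ he) (by
      change thr < _
      rw [hδ]
      linarith) (by
      rw [hU]
      positivity) hη0 hη1 hκ0.le (by rw [hη]; linarith) hq
  obtain ⟨𝒩, h𝒩, h𝒩', h𝒩''⟩ := exists_clone_tiles hl hE.card_eq hn0 hh1 hxinj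
    (fun g => (hx g).1) hF hload
  refine ⟨univ.image x, 𝒩, ?_, h𝒩', h𝒩''⟩
  rw [h𝒩, ← Nat.cast_lt (α := ℝ)]
  refine lt_of_lt_of_le ?_ hI
  rw [dens_iff, Fintype.card_fin] at hdens
  have b1 := card_image_clone_inter fun g => (hx g).2
  rw [Fintype.card_prod, Fintype.card_fin, Fintype.card_fin] at b1
  have b2 : #{p | ω₀ p ∈ J} + #{p | ω₀ p ∉ J} = s := by
    rw [card_filter_add_card_filter_not]
    simp
  have b3 : (#{p | ω₀ p ∈ J} : ℝ) ≤ (1 - α / 2) * s := by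
    have : (#{p | ω₀ p ∈ J} : ℝ) + #{p | ω₀ p ∉ J} = s := by exact_mod_cast b2
    linarith
  have b4 : (#(univ.image x ∩ J) : ℝ) ≤ (1 - α / 2) * s * (R * q * (h + 1)) := by
    refine (Nat.cast_le.2 b1).trans ?_
    push_cast
    rw [show (n : ℝ) = R * q from Nat.cast_mul _ _]
    gcongr
  refine b4.trans_lt ?_
  rw [hκR, hU]
  have b5 : (h * R : ℝ) ≤ m := by
    rw [← Nat.cast_mul]
    exact Nat.cast_le.2 (by linarith [show m = h * R + ℓ by rw [hm, hR]; ring])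
  rw [Nat.cast_mul s m]
  exact retile_count hα hα1 hh hs0' (Nat.cast_pos.2 hq0) hR' b5

section
variable {V W : Type} [DecidableEq V] [DecidableEq W] {k ℓ : ℕ}

/-- The edges of `W` whose image is an edge of `V`. -/
def pullback [Fintype W] (E : Finset (Finset V)) (φ : W → V) : Finset (Finset W) :=
  univ.filter fun e => e.image φ ∈ E

lemma Conn.image [Fintype W] {E : Finset (Finset V)} {φ : W → V} (hφ : Function.Injective φ)
    {X I Y : Finset W} (h : Conn k ℓ (pullback E φ) X I Y) :
    Conn k ℓ E (X.image φ) (I.image φ) (Y.image φ) := by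
  induction h with
  | edge hX hM hY hXM hXY hMY he =>
    refine Conn.edge ?_ ?_ ?_ ((disjoint_image hφ).2 hXM) ((disjoint_image hφ).2 hXY)
      ((disjoint_image hφ).2 hMY) ?_
    · rwa [card_image_of_injective _ hφ]
    · rwa [card_image_of_injective _ hφ]
    · rwa [card_image_of_injective _ hφ]
    · rw [← image_union, ← image_union]
      exact (mem_filter.1 he).2
  | trans h₁ h₂ hd ih₁ ih₂ =>
    rw [image_union, image_union]
    refine Conn.trans ih₁ ih₂ ?_
    rw [← image_union, ← image_union]
    exact (disjoint_image hφ).2 hd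

lemma PairDense.pullback [Fintype V] [Fintype W] {E : Finset (Finset V)} {θ δ : ℝ}
    (h : PairDense k θ E) {φ : W → V} (hφ : Function.Injective φ) (hδ : 2 * δ ≤ θ)
    (hW : (Fintype.card V : ℝ) - Fintype.card W ≤ δ * Fintype.card V) :
    PairDense k (θ - 2 * δ) (pullback E φ) := by
  refine ⟨fun e he => ?_, fun S hS => ?_⟩
  · rw [← h.card_eq _ (mem_filter.1 he).2, card_image_of_injective _ hφ]
  have h1 := h.dens (S.image φ) (by rw [card_image_of_injective _ hφ, hS])
  rw [dens_iff] at h1 ⊢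
  have hWV : Fintype.card W ≤ Fintype.card V := Fintype.card_le_of_injective φ hφ
  have hT : #(univ \ univ.image φ) = Fintype.card V - Fintype.card W := by
    rw [card_sdiff_of_subset (subset_univ _), card_univ, card_image_of_injective _ hφ, card_univ]
  set T := univ \ univ.image φ with hTdef
  have h2 : ({p : V × V | insert p.1 (insert p.2 (S.image φ)) ∈ E} : Finset (V × V)) ⊆
      ({p : W × W | insert p.1 (insert p.2 S) ∈ LooseHam.pullback E φ} : Finset (W × W)).image
        (Prod.map φ φ) ∪ (T ×ˢ univ ∪ univ ×ˢ T) := by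
    rintro ⟨a, b⟩ hp
    have hp := (mem_filter.1 hp).2
    simp only [mem_union, mem_product, mem_univ, and_true, true_and]
    by_cases ha : a ∈ T
    · exact Or.inr (Or.inl ha)
    by_cases hb : b ∈ T
    · exact Or.inr (Or.inr hb)
    simp only [hTdef, mem_sdiff, mem_univ, true_and, not_not, mem_image] at ha hb
    obtain ⟨a, rfl⟩ := ha
    obtain ⟨b, rfl⟩ := hb
    refine Or.inl (mem_image.2 ⟨(a, b), mem_filter.2 ⟨mem_univ _, mem_filter.2 ⟨mem_univ _, ?_⟩⟩,
      rfl⟩)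
    simpa only [image_insert] using hp
  have h3 := (card_le_card h2).trans ((card_union_le _ _).trans
    (Nat.add_le_add card_image_le (card_union_le _ _)))
  rw [card_product, card_product, hT, card_univ] at h3
  have h4 : (_ : ℝ) ≤ _ := Nat.cast_le.2 h3
  push_cast [Nat.cast_sub hWV] at h4
  simp only [Fintype.card_prod, Nat.cast_mul] at h1 ⊢
  have h5 : (Fintype.card W : ℝ) * Fintype.card W ≤ Fintype.card V * Fintype.card V := by
    gcongr
  have h6 : (θ - 2 * δ) * ((Fintype.card W : ℝ) * Fintype.card W) ≤
      (θ - 2 * δ) * (Fintype.card V * Fintype.card V) :=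
    mul_le_mul_of_nonneg_left h5 (by linarith)
  have h7 : ((Fintype.card V : ℝ) - Fintype.card W) * Fintype.card V ≤
      δ * Fintype.card V * Fintype.card V :=
    mul_le_mul_of_nonneg_right hW (Nat.cast_nonneg _)
  nlinarith

/-- A family of disjoint connections with `m` vertices each, avoiding `F`. -/
structure IsTiling (k ℓ : ℕ) (E : Finset (Finset V)) (m : ℕ) (F : Finset V)
    (𝒯 : Finset (Finset V)) : Prop where
  disj : ∀ Q ∈ 𝒯, ∀ Q' ∈ 𝒯, Q ≠ Q' → Disjoint Q Q'
  card_eq : ∀ Q ∈ 𝒯, #Q = m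
  conn : ∀ Q ∈ 𝒯, ∃ X I Y, Conn k ℓ E X I Y ∧ Q = X ∪ I ∪ Y
  avoid : ∀ Q ∈ 𝒯, Disjoint Q F

lemma exists_max_tiling [Fintype V] (k ℓ : ℕ) (E : Finset (Finset V)) (m : ℕ) (F : Finset V) :
    ∃ 𝒯, IsTiling k ℓ E m F 𝒯 ∧ ∀ 𝒯', IsTiling k ℓ E m F 𝒯' → #𝒯' ≤ #𝒯 := by
  classical
  obtain ⟨𝒯, h1, h2⟩ := exists_max_image (univ.filter fun 𝒯 => IsTiling k ℓ E m F 𝒯) card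
    ⟨∅, mem_filter.2 ⟨mem_univ _, by simp, by simp, by simp, by simp⟩⟩
  exact ⟨𝒯, (mem_filter.1 h1).2, fun 𝒯' h => h2 _ (mem_filter.2 ⟨mem_univ _, h⟩)⟩

/-- Tiles and further disjoint sets of the same size parametrise most of the vertices. -/
lemma IsTiling.exists_param {E : Finset (Finset V)} {m p : ℕ} {F Z : Finset V}
    {𝒯 : Finset (Finset V)} (h : IsTiling k ℓ E m F 𝒯) (hZF : Disjoint Z F)
    (hZ : ∀ Q ∈ 𝒯, Disjoint Q Z) (hp : p * m ≤ #Z) :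
    ∃ φ : (𝒯 ⊕ Fin p) × Fin m → V, Function.Injective φ ∧ (∀ w, φ w ∉ F) ∧
      (∀ Q j, φ (Sum.inl Q, j) ∈ Q.1) ∧ ∀ i j, φ (Sum.inr i, j) ∈ Z := by
  obtain ⟨ψ⟩ : Nonempty (Fin p × Fin m ↪ Z) := by
    rw [Function.Embedding.nonempty_iff_card_le]
    simpa using hp
  let χ : ∀ Q : 𝒯, Q.1 ≃ Fin m := fun Q => equivFinOfCardEq (h.card_eq _ Q.2)
  let φ : (𝒯 ⊕ Fin p) × Fin m → V := fun w =>
    Sum.elim (fun Q => ((χ Q).symm w.2 : V)) (fun i => (ψ (i, w.2) : V)) w.1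
  have h1 : ∀ Q j, φ (Sum.inl Q, j) ∈ Q.1 := fun Q j => ((χ Q).symm j).2
  have h2 : ∀ i j, φ (Sum.inr i, j) ∈ Z := fun i j => (ψ (i, j)).2
  refine ⟨φ, ?_, ?_, h1, h2⟩
  · rintro ⟨Q | i, j⟩ ⟨Q' | i', j'⟩ heq
    · have hQ : Q = Q' := by
        by_contra hne
        exact disjoint_left.1 (h.disj _ Q.2 _ Q'.2 fun h' => hne (Subtype.ext h')) (h1 Q j)
          (heq ▸ h1 Q' j')
      subst hQ
      have h3 := (χ Q).symm.injective (Subtype.ext heq)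
      simp only at h3
      rw [h3]
    · exact (disjoint_left.1 (hZ _ Q.2) (h1 Q j) (heq ▸ h2 i' j')).elim
    · exact (disjoint_left.1 (hZ _ Q'.2) (h1 Q' j') (heq ▸ h2 i j)).elim
    · have h3 := ψ.injective (Subtype.ext heq)
      simp only [Prod.mk.injEq] at h3
      rw [h3.1, h3.2]
  · rintro ⟨Q | i, j⟩
    · exact disjoint_left.1 (h.avoid _ Q.2) (h1 Q j)
    · exact disjoint_left.1 hZF (h2 i j)

/-- The tiles over a set of parameters can be replaced. -/
lemma IsTiling.exchange [Fintype V] {E : Finset (Finset V)} {m p : ℕ} {F Z : Finset V}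
    {𝒯 : Finset (Finset V)} (h : IsTiling k ℓ E m F 𝒯) (hm : 0 < m)
    (hZ : ∀ Q ∈ 𝒯, Disjoint Q Z) {φ : (𝒯 ⊕ Fin p) × Fin m → V} (hφ : Function.Injective φ)
    (hφF : ∀ w, φ w ∉ F) (hφ𝒯 : ∀ Q j, φ (Sum.inl Q, j) ∈ Q.1) (hφZ : ∀ i j, φ (Sum.inr i, j) ∈ Z)
    {B : Finset (𝒯 ⊕ Fin p)} {𝒩 : Finset (Finset ((𝒯 ⊕ Fin p) × Fin m))}
    (h₁ : ∀ Q ∈ 𝒩, ∀ Q' ∈ 𝒩, Q ≠ Q' → Disjoint Q Q')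
    (h₂ : ∀ Q ∈ 𝒩, #Q = m ∧ (∃ X I Y, Conn k ℓ (LooseHam.pullback E φ) X I Y ∧ Q = X ∪ I ∪ Y) ∧
      ∀ w ∈ Q, w.1 ∈ B) :
    ∃ 𝒯', IsTiling k ℓ E m F 𝒯' ∧ #𝒯' + #(B ∩ univ.map Function.Embedding.inl) = #𝒯 + #𝒩 := by
  set 𝒯₁ := (univ.filter fun Q : 𝒯 => Sum.inl Q ∉ B).map (Function.Embedding.subtype _) with h𝒯₁
  have hd : ∀ Q ∈ 𝒯₁, ∀ Q' ∈ 𝒩, Disjoint Q (Q'.image φ) := by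
    intro Q hQ Q' hQ'
    obtain ⟨Q, hQB, rfl⟩ := mem_map.1 hQ
    rw [disjoint_right]
    intro v hv hvQ
    obtain ⟨⟨Q₁ | i, j⟩, hw, rfl⟩ := mem_image.1 hv
    · have h3 := (h₂ Q' hQ').2.2 _ hw
      refine disjoint_left.1 (h.disj _ Q.2 _ Q₁.2 fun h' => ?_) hvQ (hφ𝒯 Q₁ j)
      rw [Subtype.ext h'] at hQB
      exact (mem_filter.1 hQB).2 h3
    · exact disjoint_left.1 (hZ _ Q.2) hvQ (hφZ i j)
  have h𝒯₁𝒯 : ∀ Q ∈ 𝒯₁, Q ∈ 𝒯 := by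
    intro Q hQ
    obtain ⟨Q, -, rfl⟩ := mem_map.1 hQ
    exact Q.2
  have hcard : #𝒯₁ + #(B ∩ univ.map Function.Embedding.inl) = #𝒯 := by
    have h3 : B ∩ univ.map Function.Embedding.inl =
        (univ.filter fun Q : 𝒯 => Sum.inl Q ∈ B).map Function.Embedding.inl := by
      ext w
      simp only [mem_inter, mem_map, mem_univ, true_and, mem_filter]
      constructor
      · rintro ⟨h4, a, rfl⟩
        exact ⟨a, h4, rfl⟩
      · rintro ⟨a, h4, rfl⟩
        exact ⟨h4, a, rfl⟩
    rw [h3, h𝒯₁, card_map, card_map, add_comm, card_filter_add_card_filter_not, card_univ,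
      Fintype.card_coe]
  have himg : #(𝒩.image fun Q => Q.image φ) = #𝒩 :=
    card_image_of_injective _ (image_injective hφ)
  refine ⟨𝒯₁ ∪ 𝒩.image fun Q => Q.image φ, ⟨?_, ?_, ?_, ?_⟩, ?_⟩
  · intro Q hQ Q' hQ' hne
    rcases mem_union.1 hQ with hQ | hQ <;> rcases mem_union.1 hQ' with hQ' | hQ'
    · exact h.disj _ (h𝒯₁𝒯 Q hQ) _ (h𝒯₁𝒯 Q' hQ') hne
    · obtain ⟨Q', hQ₀', rfl⟩ := mem_image.1 hQ'
      exact hd _ hQ _ hQ₀'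
    · obtain ⟨Q, hQ₀, rfl⟩ := mem_image.1 hQ
      exact (hd _ hQ' _ hQ₀).symm
    · obtain ⟨Q, hQ₀, rfl⟩ := mem_image.1 hQ
      obtain ⟨Q', hQ₀', rfl⟩ := mem_image.1 hQ'
      exact (disjoint_image hφ).2 (h₁ _ hQ₀ _ hQ₀' fun h' => hne (by rw [h']))
  · intro Q hQ
    rcases mem_union.1 hQ with hQ | hQ
    · exact h.card_eq _ (h𝒯₁𝒯 Q hQ)
    · obtain ⟨Q, hQ₀, rfl⟩ := mem_image.1 hQ
      rw [card_image_of_injective _ hφ, (h₂ Q hQ₀).1]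
  · intro Q hQ
    rcases mem_union.1 hQ with hQ | hQ
    · exact h.conn _ (h𝒯₁𝒯 Q hQ)
    · obtain ⟨Q, hQ₀, rfl⟩ := mem_image.1 hQ
      obtain ⟨X, I, Y, h3, rfl⟩ := (h₂ Q hQ₀).2.1
      exact ⟨_, _, _, h3.image hφ, by rw [image_union, image_union]⟩
  · intro Q hQ
    rcases mem_union.1 hQ with hQ | hQ
    · exact h.avoid _ (h𝒯₁𝒯 Q hQ)
    · obtain ⟨Q, hQ₀, rfl⟩ := mem_image.1 hQ
      rw [disjoint_left]
      intro v hv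
      obtain ⟨w, -, rfl⟩ := mem_image.1 hv
      exact hφF w
  · have h3 : Disjoint 𝒯₁ (𝒩.image fun Q => Q.image φ) := by
      rw [disjoint_left]
      intro Q hQ hQ'
      obtain ⟨Q', hQ₀', rfl⟩ := mem_image.1 hQ'
      have h4 := hd _ hQ _ hQ₀'
      rw [disjoint_self_iff_empty] at h4
      have h5 := (h₂ Q' hQ₀').1
      rw [← card_image_of_injective Q' hφ, h4, card_empty] at h5
      omega
    rw [card_union_of_disjoint h3, himg]
    omega

/-- Pair-dense hypergraphs have almost perfect tilings by long connections. -/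
lemma exists_tiling {h : ℕ} {θ α δ : ℝ} (hℓ : 1 ≤ ℓ) (hl : 2 * ℓ < k)
    (hδ0 : 0 < δ) (hδ : 8 * δ ≤
      θ - (2 * (1 / (2 * (k - ℓ) : ℕ) : ℝ) - (1 / (2 * (k - ℓ) : ℕ) : ℝ) ^ 2)) (hθ1 : θ ≤ 1)
    (hα : 0 < α) (hα1 : α ≤ 1) (hh : 8 ≤ α * h) :
    ∃ n₀ : ℕ, ∀ (V : Type) [Fintype V] [DecidableEq V] (E : Finset (Finset V)),
      n₀ ≤ Fintype.card V → PairDense k θ E → ∀ F : Finset V, (#F : ℝ) ≤ δ * Fintype.card V →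
      ∃ 𝒯, IsTiling k ℓ E (2 * h * (k - ℓ) + ℓ) F 𝒯 ∧
        (#(univ \ (F ∪ 𝒯.biUnion id)) : ℝ) ≤ α * Fintype.card V := by
  set thr : ℝ := 2 * (1 / (2 * (k - ℓ) : ℕ) : ℝ) - (1 / (2 * (k - ℓ) : ℕ) : ℝ) ^ 2 with hthr
  set m : ℕ := 2 * h * (k - ℓ) + ℓ with hm
  have hthr0 : 0 ≤ thr := by
    have h3 : (1 / (2 * (k - ℓ) : ℕ) : ℝ) ≤ 1 := by
      rw [div_le_one (Nat.cast_pos.2 (by omega))]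
      exact_mod_cast (by omega)
    have h4 : (0 : ℝ) ≤ 1 / (2 * (k - ℓ) : ℕ) := by positivity
    nlinarith
  have hm0 : 0 < m := by omega
  have hm0' : (1 : ℝ) ≤ m := by exact_mod_cast hm0
  obtain ⟨n₁, H⟩ := exists_retile (h := h) (α := α / 2) hℓ hl
    (show thr < θ - 2 * (2 * δ) by linarith) (by linarith) (by linarith) (by linarith)
    (by linarith)
  obtain ⟨n₀, hn₀⟩ := exists_nat_ge (m / δ + 2 * m / α + 2 * n₁ * m)
  have p1 : 0 ≤ m / δ := by positivity
  have p2 : 0 ≤ 2 * m / α := by positivity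
  have p3 : (0 : ℝ) ≤ 2 * n₁ * m := by positivity
  refine ⟨n₀, fun V _ _ E hV hE F hF => ?_⟩
  have hV' : (n₀ : ℝ) ≤ Fintype.card V := Nat.cast_le.2 hV
  have q1 : m ≤ δ * Fintype.card V := (div_le_iff₀' hδ0).1 (by linarith)
  have q2 : 2 * m ≤ α * Fintype.card V := (div_le_iff₀' hα).1 (by linarith)
  obtain ⟨𝒯, h𝒯, hmax⟩ := exists_max_tiling k ℓ E m F
  refine ⟨𝒯, h𝒯, ?_⟩
  by_contra! hcon
  set Z := univ \ (F ∪ 𝒯.biUnion id) with hZdef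
  have hZF : Disjoint Z F := disjoint_sdiff.symm.mono_right subset_union_left
  have hZ : ∀ Q ∈ 𝒯, Disjoint Q Z := fun Q hQ =>
    disjoint_sdiff.mono_left ((subset_biUnion_of_mem id hQ).trans subset_union_right)
  obtain ⟨p, hp⟩ : ∃ p, p = #Z / m := ⟨_, rfl⟩
  have hpm : p * m ≤ #Z := hp ▸ Nat.div_mul_le_self #Z m
  obtain ⟨φ, hφ, hφF, hφ𝒯, hφZ⟩ := h𝒯.exists_param hZF hZ hpm
  have hpZ : #Z ≤ p * m + m := by
    have := Nat.div_add_mod #Z m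
    have h2 := Nat.mod_lt #Z hm0
    rw [← hp, mul_comm] at this
    omega
  have hcard𝒯 : #(𝒯.biUnion id) = #𝒯 * m := by
    exact (card_biUnion h𝒯.disj).trans (sum_const_nat h𝒯.card_eq)
  have hV1 : Fintype.card V = #Z + #(F ∪ 𝒯.biUnion id) := by
    rw [hZdef, ← card_univ, ← card_sdiff_add_card_eq_card (subset_univ (F ∪ 𝒯.biUnion id))]
  have hV2 : #Z + #𝒯 * m ≤ Fintype.card V := by
    rw [hV1, ← hcard𝒯]
    exact Nat.add_le_add_left (card_le_card subset_union_right) _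
  have hV3 : Fintype.card V ≤ (#𝒯 + p) * m + m + #F := by
    have := card_union_le F (𝒯.biUnion id)
    rw [hcard𝒯] at this
    rw [hV1, add_mul]
    omega
  have hA : Fintype.card (𝒯 ⊕ Fin p) = #𝒯 + p := by simp
  have hpZ' : (#Z : ℝ) ≤ p * m + m := by exact_mod_cast hpZ
  have hV2' : (#Z : ℝ) + #𝒯 * m ≤ Fintype.card V := by exact_mod_cast hV2
  have hV3' : (Fintype.card V : ℝ) ≤ (#𝒯 + p) * m + m + #F := by exact_mod_cast hV3
  have hpm' : (p : ℝ) * m ≤ #Z := by exact_mod_cast hpm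
  obtain ⟨B, 𝒩, hB, h₁, h₂⟩ := H (𝒯 ⊕ Fin p) (LooseHam.pullback E φ) (by
      rw [hA, ← Nat.cast_le (α := ℝ)]
      push_cast
      have h3 : (n₁ : ℝ) * m ≤ (#𝒯 + p) * m := by
        have h4 : δ * Fintype.card V ≤ 1 / 8 * Fintype.card V :=
        mul_le_mul_of_nonneg_right (by linarith) (Nat.cast_nonneg _)
        linarith
      exact le_of_mul_le_mul_right h3 (by linarith))
    (hE.pullback hφ (by linarith) (by
      rw [Fintype.card_prod, hA, Fintype.card_fin, Nat.cast_mul (#𝒯 + p) m, Nat.cast_add #𝒯 p]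
      linarith))
    (univ.map Function.Embedding.inl) (by
      rw [card_map, card_univ, Fintype.card_coe, hA]
      push_cast
      have h3 : α / 2 * Fintype.card V ≤ p * m := by linarith
      have h4 : α / 2 * ((#𝒯 + p) * m) ≤ α / 2 * Fintype.card V := by
        gcongr
        linarith
      have h5 : α / 2 * (#𝒯 + p) ≤ (p : ℝ) := by
        refine le_of_mul_le_mul_right ?_ (show (0 : ℝ) < m by linarith)
        linarith
      linarith)
  obtain ⟨𝒯', h𝒯', hc⟩ := h𝒯.exchange hm0 hZ hφ hφF hφ𝒯 hφZ h₁ h₂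
  have := hmax 𝒯' h𝒯'
  omega

end

section Assembly

variable {n k ℓ m N M : ℕ} {E : Finset (Finset (Fin n))} {X Y P R : Finset (Fin n)}
  {F : Finset (Fin n)} {𝒯 : Finset (Finset (Fin n))} {s : ℕ}

lemma IsTiling.exists_sys (h : IsTiling k ℓ E s F 𝒯) :
    ∃ L : List (Finset (Fin n) × Finset (Fin n)),
      L.length = #𝒯 ∧ Sys k ℓ E L (𝒯.biUnion id) := by
  have h1 : ∀ Q, ∃ p : Finset (Fin n) × Finset (Fin n), Q ∈ 𝒯 → Sys k ℓ E [p] Q := by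
    intro Q
    by_cases hQ : Q ∈ 𝒯
    · obtain ⟨X, I, Y, hc, rfl⟩ := h.conn Q hQ
      exact ⟨(X, Y), fun _ => hc.sys⟩
    · exact ⟨(∅, ∅), fun h => absurd h hQ⟩
  choose f hf using h1
  refine ⟨𝒯.toList.flatMap fun Q => [f Q], by simp, ?_⟩
  have := Sys.flatMap (fun Q => [f Q]) id 𝒯.toList 𝒯.nodup_toList
    (fun Q hQ => hf Q (by simpa using hQ))
    (fun Q hQ Q' hQ' hne => h.disj Q (by simpa using hQ) Q' (by simpa using hQ') hne)
  simpa only [toList_toFinset] using this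

/-- The absorbing path, the tiles and the reservoir form an almost spanning cycle whose leftover
is absorbed. -/
lemma hasHamCycle_of_parts (hl : 2 * ℓ < k) (hn : 2 * k ≤ n) (hdvd : (k - ℓ) ∣ n)
    (habs : ∀ U, Disjoint U P → (k - ℓ) ∣ #U → #U ≤ M →
      ∃ I, Conn k ℓ E X I Y ∧ X ∪ I ∪ Y = P ∪ U)
    (hR : Flex k ℓ E R m N) (hRP : Disjoint R P) (h𝒯 : IsTiling k ℓ E s (P ∪ R) 𝒯)
    (hN : m * (#𝒯 + 1) ≤ N) (hM : #(univ \ (P ∪ 𝒯.biUnion id)) ≤ M) :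
    HasHamCycle n k ℓ E := by
  obtain ⟨L, hLlen, hL⟩ := h𝒯.exists_sys
  set T := 𝒯.biUnion id with hT
  have hTF : Disjoint T (P ∪ R) := by
    rw [hT, disjoint_biUnion_left]
    exact h𝒯.avoid
  rw [disjoint_union_right] at hTF
  obtain ⟨I₀, hI₀, hI₀P⟩ := habs ∅ (by simp) (by simp) (by simp)
  rw [union_empty] at hI₀P
  have hS₀ : Sys k ℓ E ((X, Y) :: L) (P ∪ T) :=
    hI₀P ▸ Sys.cons hI₀ hL (hI₀P ▸ hTF.1.symm)
  obtain ⟨J, hJR, hJ, -, hJm⟩ := hR.exists_links ((X, Y) :: L) (P ∪ T) ∅ (by simp) hS₀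
    (by simpa [hLlen] using hN)
  have hRPT : Disjoint R (P ∪ T) := disjoint_union_right.2 ⟨hRP, hTF.2.symm⟩
  have hPTJ : Disjoint (P ∪ T) J := (hRPT.mono_left hJR).symm
  obtain ⟨hne, I₁, hI₁, hI₁A⟩ := hS₀.exists_conn hJ hPTJ
  set Z := (((X, Y) :: L).getLast hne).2 with hZ
  change Conn k ℓ E X I₁ Z at hI₁
  change X ∪ I₁ ∪ Z = _ at hI₁A
  obtain ⟨C, hCR, hC, hCJ, -⟩ := hR Z X J hI₁.card_right hI₁.card_left hI₁.disjoint.2.1.symm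
    (hJm.trans (by simpa [hLlen] using hN))
  have hCA : Disjoint (P ∪ T ∪ J) C :=
    disjoint_union_left.2 ⟨(hRPT.mono_left hCR).symm, hCJ.symm⟩
  set U := univ \ (P ∪ T ∪ J ∪ C) with hU
  have hUd : Disjoint (P ∪ T ∪ J ∪ C) U := disjoint_sdiff
  have hcard : #I₁ + ℓ + (#C + ℓ) + #U = n := by
    have h1 : #(P ∪ T ∪ J) = ℓ + #I₁ + ℓ := by
      rw [← hI₁A, card_union_of_disjoint
        (disjoint_union_left.2 ⟨hI₁.disjoint.2.1, hI₁.disjoint.2.2⟩),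
        card_union_of_disjoint hI₁.disjoint.1, hI₁.card_left, hI₁.card_right]
    have h2 := card_union_of_disjoint hCA
    have h3 := card_sdiff_add_card_eq_card (subset_univ (P ∪ T ∪ J ∪ C))
    rw [card_univ, Fintype.card_fin, ← hU] at h3
    omega
  have hUdvd : (k - ℓ) ∣ #U := by
    obtain ⟨a, ha⟩ := hI₁.exists_card hl
    obtain ⟨b, hb⟩ := hC.exists_card hl
    rw [← hcard, ha, hb] at hdvd
    exact (Nat.dvd_add_right (Dvd.intro_left (a + b) (add_mul a b _))).1 hdvd
  simp only [disjoint_union_left] at hUd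
  obtain ⟨⟨⟨hPU, hTU⟩, hJU⟩, hCU⟩ := hUd
  obtain ⟨I₂, hI₂, hI₂P⟩ := habs U hPU.symm hUdvd ((card_le_card (sdiff_subset_sdiff subset_rfl
    (subset_union_left.trans subset_union_left))).trans hM)
  have hPUT : Disjoint (P ∪ U) T := disjoint_union_left.2 ⟨hTF.1.symm, hTU.symm⟩
  have hS₂ : Sys k ℓ E ((X, Y) :: L) (P ∪ U ∪ T) :=
    hI₂P ▸ Sys.cons hI₂ hL (hI₂P ▸ hPUT)
  obtain ⟨_, I₃, hI₃, hI₃A⟩ := hS₂.exists_conn hJ (by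
    simp only [disjoint_union_left] at hPTJ ⊢
    exact ⟨⟨hPTJ.1, hJU.symm⟩, hPTJ.2⟩)
  change Conn k ℓ E X I₃ Z at hI₃
  change X ∪ I₃ ∪ Z = _ at hI₃A
  have hdC : Disjoint (X ∪ I₃ ∪ Z) C := by
    rw [hI₃A]
    simp only [disjoint_union_left] at hCA ⊢
    exact ⟨⟨⟨hCA.1.1, hCU.symm⟩, hCA.1.2⟩, hCA.2⟩
  refine hasHamCycle_of_conn hl hn hdvd hI₃ hC ?_ ?_
  · rw [disjoint_union_left] at hdC
    exact disjoint_union_right.2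
      ⟨disjoint_union_left.2 ⟨hI₃.disjoint.2.1, hI₃.disjoint.2.2⟩, hdC.1⟩
  · rw [← union_assoc, hI₃A, eq_univ_iff_forall]
    intro v
    have : v ∈ U ↔ v ∉ P ∪ T ∪ J ∪ C := by simp [hU]
    simp only [mem_union] at this ⊢
    tauto

end Assembly

section Main

variable {k ℓ : ℕ} {θ : ℝ}

/-- The pair density above which loose Hamiltonian cycles are found. -/
noncomputable def threshold (k ℓ : ℕ) : ℝ :=
  2 * (1 / (2 * (k - ℓ) : ℕ) : ℝ) - (1 / (2 * (k - ℓ) : ℕ) : ℝ) ^ 2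

lemma threshold_eq (hl : ℓ < k) :
    threshold k ℓ = (4 * ((k - ℓ : ℕ) : ℝ) - 1) / (4 * ((k - ℓ : ℕ) : ℝ) ^ 2) := by
  have : (0 : ℝ) < (k - ℓ : ℕ) := by exact_mod_cast Nat.sub_pos_of_lt hl
  unfold threshold
  push_cast
  field_simp
  ring

lemma threshold_pos (hl : ℓ < k) : 0 < threshold k ℓ := by
  have : (1 : ℝ) ≤ (k - ℓ : ℕ) := by exact_mod_cast Nat.sub_pos_of_lt hl
  rw [threshold_eq hl]
  have : (0 : ℝ) < 4 * ((k - ℓ : ℕ) : ℝ) - 1 := by linarith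
  positivity

lemma threshold_lt_one (hl : ℓ < k) : threshold k ℓ < 1 := by
  have : (1 : ℝ) ≤ (k - ℓ : ℕ) := by exact_mod_cast Nat.sub_pos_of_lt hl
  rw [threshold_eq hl, div_lt_one (by positivity)]
  nlinarith

lemma exists_hasHamCycle (hk : 3 ≤ k) (hℓ : 1 ≤ ℓ) (hl : 2 * ℓ < k)
    (hθ : threshold k ℓ < θ) (hθ1 : θ ≤ 1) :
    ∃ n₀ : ℕ, ∀ n : ℕ, n₀ ≤ n → (k - ℓ) ∣ n → ∀ E : Finset (Finset (Fin n)),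
      PairDense k θ E → HasHamCycle n k ℓ E := by
  have hlk : ℓ < k := by omega
  have hθ0 : 0 < θ := (threshold_pos hlk).trans hθ
  have h3 : k = 3 → 7 / 16 ≤ θ := by
    rintro rfl
    obtain rfl : ℓ = 1 := by omega
    refine le_trans (le_of_eq ?_) hθ.le
    norm_num [threshold]
  obtain ⟨cA, hcA, habs⟩ := exists_absorbing_path hk hℓ hl hθ0 hθ1 h3
  obtain ⟨cR, hcR, m, hres⟩ := exists_reservoir hk hℓ hl hθ0 hθ1 h3
  obtain ⟨δ, hδ, hδ8⟩ : ∃ δ : ℝ, 0 < δ ∧ 8 * δ = θ - threshold k ℓ :=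
    ⟨(θ - threshold k ℓ) / 8, by linarith, by ring⟩
  obtain ⟨βA, hβA, hβAc, hβAR, hβAδ⟩ : ∃ β : ℝ, 0 < β ∧ β ≤ cA ∧ β ≤ cR ∧ β ≤ δ / 2 :=
    ⟨min cA (min cR (δ / 2)), by positivity, by simp, by simp, by simp⟩
  obtain ⟨α, hα, hα1, hαA⟩ : ∃ α : ℝ, 0 < α ∧ α ≤ 1 ∧ α ≤ cA * βA / 2 :=
    ⟨min 1 (cA * βA / 2), by positivity, by simp, by simp⟩
  obtain ⟨βR, hβR, hβRc, hβRδ, hβRA⟩ : ∃ β : ℝ, 0 < β ∧ β ≤ cR ∧ β ≤ δ / 2 ∧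
      β ≤ cA * βA / 2 :=
    ⟨min cR (min (δ / 2) (cA * βA / 2)), by positivity, by simp, by simp, by simp⟩
  set ε := cR * βR with hε
  have hε0 : 0 < ε := by positivity
  obtain ⟨h, hh⟩ := exists_nat_ge (8 / α + 2 * m / ε)
  have hhα : 8 ≤ α * h := by
    have : 8 / α ≤ h := le_trans (le_add_of_nonneg_right (by positivity)) hh
    rw [div_le_iff₀ hα] at this
    linarith
  have hhm : 2 * m ≤ ε * h := by
    have : 2 * m / ε ≤ h := le_trans (le_add_of_nonneg_left (by positivity)) hh
    rw [div_le_iff₀ hε0] at this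
    linarith
  obtain ⟨nA, hnA⟩ := habs βA hβA hβAc
  obtain ⟨nR, hnR⟩ := hres βR hβR hβRc
  obtain ⟨nT, hnT⟩ := exists_tiling (h := h) (θ := θ) hℓ hl hδ hδ8.le hθ1 hα hα1 hhα
  obtain ⟨n₁, hn₁⟩ := exists_nat_ge (2 * (m + 1) / ε)
  refine ⟨nA + nR + nT + n₁ + 2 * k, fun n hn hdvd E hE => ?_⟩
  have hn1 : 2 * (m + 1) ≤ ε * n := by
    have : 2 * (m + 1) / ε ≤ n := hn₁.trans (by norm_cast; omega)
    rw [div_le_iff₀ hε0] at this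
    linarith
  obtain ⟨X, Y, P, hP, hPabs⟩ := hnA (Fin n) E (by rw [Fintype.card_fin]; omega) hE
  obtain ⟨R, hRP, hR, hflex⟩ := hnR (Fin n) E (by rw [Fintype.card_fin]; omega) hE P
    (hP.trans (by gcongr)) ⌊ε * n⌋₊ (by
      rw [Fintype.card_fin]; exact Nat.floor_le (by positivity))
  rw [Fintype.card_fin] at hP hR
  obtain ⟨𝒯, h𝒯, hleft⟩ := hnT (Fin n) E (by rw [Fintype.card_fin]; omega) hE (P ∪ R) (by
    rw [Fintype.card_fin]
    calc ((#(P ∪ R) : ℕ) : ℝ) ≤ #P + #R := by exact_mod_cast card_union_le _ _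
      _ ≤ δ / 2 * n + δ / 2 * n := by
        refine add_le_add (hP.trans ?_) (hR.trans ?_) <;> gcongr
      _ = δ * n := by ring)
  rw [Fintype.card_fin] at hleft
  refine hasHamCycle_of_parts (M := ⌊cA * βA * n⌋₊) hl (by omega) hdvd
    (fun U hUP hU hUM => hPabs U hUP hU ?_) hflex hRP h𝒯 ?_ ?_
  · rw [Fintype.card_fin]
    exact (Nat.le_floor_iff (by positivity)).1 hUM
  · have h1 : #𝒯 * h ≤ n := by
      calc #𝒯 * h ≤ #𝒯 * (2 * h * (k - ℓ) + ℓ) := by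
            have : 1 ≤ k - ℓ := by omega
            gcongr
            nlinarith
        _ = #(𝒯.biUnion id) := by
          rw [card_biUnion (t := id) h𝒯.disj]
          simp only [id]
          rw [sum_congr rfl h𝒯.card_eq, sum_const, smul_eq_mul]
        _ ≤ n := (card_le_univ _).trans (by rw [Fintype.card_fin])
    rw [Nat.le_floor_iff (by positivity)]
    have h2 : (#𝒯 : ℝ) * h ≤ n := by exact_mod_cast h1
    have h3 : (#𝒯 : ℝ) * (2 * m) ≤ #𝒯 * (ε * h) := by gcongr
    have h4 : ε * (#𝒯 * h) ≤ ε * n := by gcongr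
    push_cast
    nlinarith
  · rw [Nat.le_floor_iff (by positivity)]
    have h1 : univ \ (P ∪ 𝒯.biUnion id) ⊆ univ \ (P ∪ R ∪ 𝒯.biUnion id) ∪ R := by
      intro v
      simp only [mem_union, mem_sdiff, mem_univ, true_and]
      tauto
    calc ((#(univ \ (P ∪ 𝒯.biUnion id)) : ℕ) : ℝ)
        ≤ #(univ \ (P ∪ R ∪ 𝒯.biUnion id)) + #R := by
          exact_mod_cast (card_le_card h1).trans (card_union_le _ _)
      _ ≤ cA * βA / 2 * n + cA * βA / 2 * n := by
          refine add_le_add (hleft.trans ?_) (hR.trans ?_) <;> gcongr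
      _ = cA * βA * n := by ring

/-- The number of ordered pairs completing `S` to an edge is at least twice the degree of `S`. -/
lemma two_mul_deg_le {n : ℕ} {E : Finset (Finset (Fin n))} (hE : Uniform n k E) (hk : 2 ≤ k)
    {S : Finset (Fin n)} (hS : #S = k - 2) :
    2 * deg E S ≤ #{p : Fin n × Fin n | insert p.1 (insert p.2 S) ∈ E} := by
  rw [deg, card_eq_sum_card_fiberwise (t := {e ∈ E | S ⊆ e})
    (f := fun p : Fin n × Fin n => insert p.1 (insert p.2 S)), mul_comm, ← smul_eq_mul]
  · refine card_nsmul_le_sum _ _ _ fun e he => ?_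
    rw [mem_filter] at he
    have hc : #(e \ S) = 2 := by
      rw [card_sdiff_of_subset he.2, hE e he.1]
      omega
    obtain ⟨a, b, hab, hS⟩ := card_eq_two.1 hc
    have h1 : insert a (insert b S) = e := by
      rw [← sdiff_union_of_subset he.2, hS, insert_union, singleton_union]
    rw [← card_pair (show (a, b) ≠ (b, a) by simp [hab])]
    refine card_le_card (insert_subset ?_ (singleton_subset_iff.2 ?_))
    · simp [h1, he.1]
    · simp [insert_comm b a, h1, he.1]
  · intro p hp
    simp only [coe_filter, mem_univ, true_and, Set.mem_ofPred_eq] at hp ⊢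
    exact ⟨hp, (subset_insert _ _).trans (subset_insert _ _)⟩

lemma pairDense_of_minDeg {n : ℕ} {E : Finset (Finset (Fin n))} (hE : Uniform n k E)
    (hk : 2 ≤ k) {c : ℝ} (hc : c ≤ (c - θ) * n)
    (h : c * (n.choose 2 : ℝ) ≤ (minDeg n E (k - 2) : ℝ)) : PairDense k θ E := by
  refine ⟨hE, fun S hS => ?_⟩
  classical
  rw [dens_iff, Fintype.card_prod, Fintype.card_fin]
  have h1 : minDeg n E (k - 2) ≤ deg E S := Nat.sInf_le ⟨S, hS, rfl⟩
  have h2 := two_mul_deg_le hE hk hS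
  have h3 : (2 * minDeg n E (k - 2) : ℝ) ≤
      #{p : Fin n × Fin n | insert p.1 (insert p.2 S) ∈ E} := by
    exact_mod_cast (Nat.mul_le_mul_left 2 h1).trans h2
  rw [Nat.cast_choose_two] at h
  have h4 : c * n ≤ (c - θ) * n * n := by gcongr
  push_cast
  nlinarith

end Main

end LooseHam

/-- For all integers `k ≥ 3` and `1 ≤ ℓ < k/2` and every `γ > 0` there
exists `n₀` such that every `k`-uniform hypergraph `H` on `n ≥ n₀` vertices with
`(k-ℓ) ∣ n` and `δ_{k-2}(H) ≥ ((4(k-ℓ)-1)/(4(k-ℓ)²) + γ)·C(n,2)` contains a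
Hamiltonian ℓ-cycle. -/
theorem statement2 (k ℓ : ℕ) (hk : 3 ≤ k) (hl : 1 ≤ ℓ) (hlk : 2 * ℓ < k)
    (γ : ℝ) (hγ : 0 < γ) :
    ∃ n₀ : ℕ, ∀ n : ℕ, n₀ ≤ n → (k - ℓ) ∣ n →
      ∀ E : Finset (Finset (Fin n)), Uniform n k E →
        ((4 * ((k - ℓ : ℕ) : ℝ) - 1) / (4 * ((k - ℓ : ℕ) : ℝ) ^ 2) + γ) * (n.choose 2 : ℝ) ≤
          (minDeg n E (k - 2) : ℝ) →
        HasHamCycle n k ℓ E := by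
  rw [← LooseHam.threshold_eq (by omega : ℓ < k)]
  have h1 := LooseHam.threshold_lt_one (by omega : ℓ < k)
  set c := LooseHam.threshold k ℓ + γ with hc
  obtain ⟨θ, hθ, hθ1, hθc⟩ : ∃ θ, LooseHam.threshold k ℓ < θ ∧ θ ≤ 1 ∧ θ < c :=
    ⟨min 1 (LooseHam.threshold k ℓ + γ / 2), by simp [h1, hγ], by simp,
      (min_le_right _ _).trans_lt (by rw [hc]; linarith)⟩
  obtain ⟨n₀, hn₀⟩ := LooseHam.exists_hasHamCycle hk hl hlk hθ hθ1
  obtain ⟨n₁, hn₁⟩ := exists_nat_ge (c / (c - θ))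
  refine ⟨max n₀ n₁, fun n hn hdvd E hE hdeg => ?_⟩
  refine hn₀ n (le_of_max_le_left hn) hdvd E (LooseHam.pairDense_of_minDeg hE (by omega) ?_ hdeg)
  have h2 : c / (c - θ) ≤ n := hn₁.trans (by exact_mod_cast le_of_max_le_right hn)
  rwa [div_le_iff₀' (sub_pos.2 hθc)] at h2
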